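/- Lieb-Thirring inequality for extended anyons: there exists a constant C > 0, independent of R, α and N, such that for every R > 0, every α ∈ [0,2], every N ≥ 1 and every L²-normalized antisymmetric wave function Ψ_N ∈ L²_asym(ℝ^{2N}) (smooth and compactly supported suffices), one has E_α^R[Ψ_N] ≥ C·|α − 1|·∫_{ℝ²} ρ_{Ψ_N}(x)² dx. -/

import Mathlib

open MeasureTheory

noncomputable section

abbrev E2 : Type := EuclideanSpace ℝ (Fin 2)

/-- The 90° rotation `(x¹,x²)^⊥ := (−x²,x¹)`. -/
def perp (x : E2) : E2 := (WithLp.equiv 2 (Fin 2 → ℝ)).symm ![-(x 1), x 0]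

/-- Regularized norm `|x|_R := max(|x|, R)`. -/
def regNorm (R : ℝ) (x : E2) : ℝ := max ‖x‖ R

def basisVec (c : Fin 2) : E2 := EuclideanSpace.single c 1

/-- The direction in `N`-particle configuration space corresponding to moving
particle `j` in coordinate direction `c`. -/
def dirv (N : ℕ) (j : Fin N) (c : Fin 2) : Fin N → E2 :=
  Function.update (0 : Fin N → E2) j (basisVec c)

/-- Antisymmetry of an `N`-particle wave function. -/
def Antisym (N : ℕ) (Ψ : (Fin N → E2) → ℂ) : Prop :=
  ∀ σ : Equiv.Perm (Fin N), ∀ X : Fin N → E2,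
    Ψ (X ∘ σ) = ((Equiv.Perm.sign σ : ℤ) : ℂ) * Ψ X

/-- One-particle density `ρ_Ψ`. -/
def density (N : ℕ) (Ψ : (Fin N → E2) → ℂ) (x : E2) : ℝ :=
  ∑ j : Fin N, ∫ Y : {k : Fin N // k ≠ j} → E2,
    ‖Ψ (fun k => if h : k = j then x else Y ⟨k, h⟩)‖ ^ 2

/-- Component `c` of `∇_{x_j} |Ψ|` at configuration `X`. -/
def gradAbs {N : ℕ} (Ψ : (Fin N → E2) → ℂ) (j : Fin N) (X : Fin N → E2) (c : Fin 2) : ℝ :=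
  fderiv ℝ (fun Z => ‖Ψ Z‖) X (dirv N j c)

/-- The axis-parallel closed square with lower-left corner `a` and side length `L`. -/
def square (a : E2) (L : ℝ) : Set E2 := {x | ∀ i : Fin 2, x i ∈ Set.Icc (a i) (a i + L)}

/-- Extended-anyon vector potential `A^R(x_j)` felt by particle `j`. -/
def Avec (R : ℝ) {N : ℕ} (X : Fin N → E2) (j : Fin N) : E2 :=
  ∑ k ∈ Finset.univ.erase j, ((regNorm R (X j - X k)) ^ 2)⁻¹ • perp (X j - X k)

/-- Component `c` of `(−i∇_{x_j} + α A^R(x_j)) Ψ` at configuration `X`. -/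
def covD (R α : ℝ) {N : ℕ} (Ψ : (Fin N → E2) → ℂ) (j : Fin N) (X : Fin N → E2)
    (c : Fin 2) : ℂ :=
  -Complex.I * fderiv ℝ Ψ X (dirv N j c) + ((α * Avec R X j c : ℝ) : ℂ) * Ψ X

/-- Total kinetic energy `E_α^R[Ψ]` of extended anyons. -/
def kinE (R α : ℝ) (N : ℕ) (Ψ : (Fin N → E2) → ℂ) : ℝ :=
  ∑ j : Fin N, ∫ X : Fin N → E2, ∑ c : Fin 2, ‖covD R α Ψ j X c‖ ^ 2



open Set in
theorem osc1d {F : Type*} [NormedAddCommGroup F] [NormedSpace ℝ F] [CompleteSpace F]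
    {g g' : ℝ → F} {G : ℝ → ℝ} (hg : ∀ s, HasDerivAt g (g' s) s) (hc : Continuous g')
    (hG : Continuous G) (hb : ∀ s, ‖g' s‖ ≤ G s) {p L x y : ℝ}
    (hx : x ∈ Icc p (p + L)) (hy : y ∈ Icc p (p + L)) :
    ‖g x - g y‖ ≤ ∫ s in p..(p + L), G s := by
  have hL : p ≤ p + L := hx.1.trans hx.2
  have h0 : ∀ s, 0 ≤ G s := fun s => (norm_nonneg _).trans (hb s)
  have key : ∀ x ∈ Icc p (p + L), ∀ y ∈ Icc p (p + L), y ≤ x →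
      ‖g x - g y‖ ≤ ∫ s in p..(p + L), G s := by
    intro x hx y hy hyx
    rw [← intervalIntegral.integral_eq_sub_of_hasDerivAt (fun s _ => hg s)
      (hc.intervalIntegrable _ _)]
    refine (intervalIntegral.norm_integral_le_of_norm_le hyx
      (Filter.Eventually.of_forall fun s _ => hb s) (hG.intervalIntegrable _ _)).trans ?_
    exact intervalIntegral.integral_mono_interval hy.1 hyx hx.2
      (Filter.Eventually.of_forall h0) (hG.intervalIntegrable _ _)
  rcases le_total y x with h | h
  · exact key x hx y hy h
  · rw [norm_sub_rev]; exact key y hy x hx h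

theorem cov_hasDerivAt {z : ℝ → ℂ} {d : ℂ} {a : ℝ} {s : ℝ}
    (hz : HasDerivAt z (Complex.I * (d - a * z s)) s) :
    HasDerivAt (fun s => ‖z s‖ ^ 2) (2 * inner ℝ (z s) (Complex.I * d)) s := by
  have h := hz.norm_sq
  convert h using 2
  simp only [Complex.inner]
  simp
  ring

theorem cov_bound (z d : ℂ) : ‖2 * inner ℝ z (Complex.I * d)‖ ≤ 2 * ‖z‖ * ‖d‖ := by
  rw [norm_mul, mul_assoc]
  have := norm_inner_le_norm (𝕜 := ℝ) z (Complex.I * d)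
  simp only [norm_mul, Complex.norm_I, one_mul] at this
  simpa using this

open Set in
theorem osc_sq {z d : ℝ → ℂ} {a : ℝ → ℝ}
    (hz : ∀ s, HasDerivAt z (Complex.I * (d s - a s * z s)) s) (hd : Continuous d)
    {p L x y : ℝ} (hx : x ∈ Icc p (p + L)) (hy : y ∈ Icc p (p + L)) :
    |‖z x‖ ^ 2 - ‖z y‖ ^ 2| ≤ ∫ s in p..(p + L), 2 * ‖z s‖ * ‖d s‖ := by
  have hzc : Continuous z := continuous_iff_continuousAt.2 fun s => (hz s).continuousAt
  refine osc1d (g := fun s => ‖z s‖ ^ 2) (g' := fun s => 2 * inner ℝ (z s) (Complex.I * d s))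
    (fun s => cov_hasDerivAt (hz s)) ?_ ?_ (fun s => cov_bound _ _) hx hy
  · fun_prop
  · fun_prop

open Set in
theorem sup_sq {z d : ℝ → ℂ} {a : ℝ → ℝ}
    (hz : ∀ s, HasDerivAt z (Complex.I * (d s - a s * z s)) s) (hd : Continuous d)
    {p L q l x : ℝ} (hx : x ∈ Icc p (p + L)) (hl : 0 < l) (hq : p ≤ q) (hql : q + l ≤ p + L) :
    ‖z x‖ ^ 2 ≤ (1 / l) * (∫ s in q..(q + l), ‖z s‖ ^ 2) + ∫ s in p..(p + L), 2 * ‖z s‖ * ‖d s‖ := by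
  have hzc : Continuous z := continuous_iff_continuousAt.2 fun s => (hz s).continuousAt
  set K := ∫ s in p..(p + L), 2 * ‖z s‖ * ‖d s‖
  have h1 : ∀ y ∈ Icc q (q + l), ‖z x‖ ^ 2 - K ≤ ‖z y‖ ^ 2 := by
    intro y hy
    have := osc_sq hz hd hx (y := y) ⟨hq.trans hy.1, hy.2.trans hql⟩
    have := (abs_le.1 this).2
    linarith
  have h2 : (∫ _s in q..(q + l), (‖z x‖ ^ 2 - K)) ≤ ∫ s in q..(q + l), ‖z s‖ ^ 2 := by
    apply intervalIntegral.integral_mono_on (by linarith)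
    · simp
    · exact (by fun_prop : Continuous fun s => ‖z s‖ ^ 2).intervalIntegrable _ _
    · exact h1
  rw [intervalIntegral.integral_const] at h2
  simp only [add_sub_cancel_left, smul_eq_mul] at h2
  have h3 : ‖z x‖ ^ 2 - K ≤ (1 / l) * ∫ s in q..(q + l), ‖z s‖ ^ 2 := by
    rw [one_div, ← div_eq_inv_mul, le_div_iff₀ hl]; linarith
  linarith

open Set in
theorem transport_real {z d : ℝ → ℂ} {a : ℝ → ℝ}
    (hz : ∀ s, HasDerivAt z (Complex.I * (d s - a s * z s)) s) (hd : Continuous d)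
    {p L q l : ℝ} (hL : 0 < L) (hl : 0 < l) (hq : p ≤ q) (hql : q + l ≤ p + L) :
    (∫ s in p..(p + L), ‖z s‖ ^ 2) ≤ (2 * L / l) * (∫ s in q..(q + l), ‖z s‖ ^ 2)
      + (4 * L ^ 2) * ∫ s in p..(p + L), ‖d s‖ ^ 2 := by
  have hzc : Continuous z := continuous_iff_continuousAt.2 fun s => (hz s).continuousAt
  have hzi : IntervalIntegrable (fun s => ‖z s‖ ^ 2) volume p (p + L) :=
    (by fun_prop : Continuous fun s => ‖z s‖ ^ 2).intervalIntegrable _ _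
  have hdi : IntervalIntegrable (fun s => ‖d s‖ ^ 2) volume p (p + L) :=
    (by fun_prop : Continuous fun s => ‖d s‖ ^ 2).intervalIntegrable _ _
  have h1 : (∫ s in p..(p + L), 2 * ‖z s‖ * ‖d s‖) ≤
      ∫ s in p..(p + L), ((1 / (2 * L)) * ‖z s‖ ^ 2 + 2 * L * ‖d s‖ ^ 2) := by
    apply intervalIntegral.integral_mono_on (by linarith)
    · exact (by fun_prop : Continuous fun s => 2 * ‖z s‖ * ‖d s‖).intervalIntegrable _ _
    · exact (hzi.const_mul _).add (hdi.const_mul _)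
    · intro s _
      have : (1 / (2 * L)) * ‖z s‖ ^ 2 + 2 * L * ‖d s‖ ^ 2 - 2 * ‖z s‖ * ‖d s‖
        = (1 / (2 * L)) * (‖z s‖ - 2 * L * ‖d s‖) ^ 2 := by field_simp; ring
      have h : 0 ≤ (1 / (2 * L)) * (‖z s‖ - 2 * L * ‖d s‖) ^ 2 := by positivity
      linarith
  rw [intervalIntegral.integral_add (hzi.const_mul _) (hdi.const_mul _),
    intervalIntegral.integral_const_mul, intervalIntegral.integral_const_mul] at h1
  set A := ∫ s in p..(p + L), ‖z s‖ ^ 2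
  set B := ∫ s in q..(q + l), ‖z s‖ ^ 2
  set D := ∫ s in p..(p + L), ‖d s‖ ^ 2
  have h2 : A ≤ ∫ _s in p..(p + L), ((1 / l) * B + (1 / (2 * L) * A + 2 * L * D)) := by
    apply intervalIntegral.integral_mono_on (by linarith) hzi
    · simp
    · intro s hs
      exact (sup_sq hz hd hs hl hq hql).trans (by gcongr)
  rw [intervalIntegral.integral_const] at h2
  simp only [add_sub_cancel_left, smul_eq_mul] at h2
  have h3 : L * (1 / l * B + (1 / (2 * L) * A + 2 * L * D)) =
    (L / l) * B + A / 2 + 2 * L ^ 2 * D := by field_simp; ring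
  rw [h3] at h2
  have h4 : 2 * L / l * B = 2 * (L / l * B) := by ring
  rw [h4]; linarith

open Set in
theorem lint_Ico {f : ℝ → ℝ} (hf : Continuous f) (h0 : ∀ s, 0 ≤ f s) {p q : ℝ} (h : p ≤ q) :
    ∫⁻ s in Ico p q, ENNReal.ofReal (f s) = ENNReal.ofReal (∫ s in p..q, f s) := by
  rw [intervalIntegral.integral_of_le h, ofReal_integral_eq_lintegral_ofReal]
  · exact setLIntegral_congr Ico_ae_eq_Ioc
  · exact (hf.intervalIntegrable p q).1
  · exact Filter.Eventually.of_forall h0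

open Set in
theorem transport1d {z d : ℝ → ℂ} {a : ℝ → ℝ}
    (hz : ∀ s, HasDerivAt z (Complex.I * (d s - a s * z s)) s) (hd : Continuous d)
    {p L q l : ℝ} (hL : 0 < L) (hl : 0 < l) (hq : p ≤ q) (hql : q + l ≤ p + L) :
    (∫⁻ s in Ico p (p + L), ENNReal.ofReal (‖z s‖ ^ 2)) ≤
      ENNReal.ofReal (2 * L / l) * (∫⁻ s in Ico q (q + l), ENNReal.ofReal (‖z s‖ ^ 2))
      + ENNReal.ofReal (4 * L ^ 2) * ∫⁻ s in Ico p (p + L), ENNReal.ofReal (‖d s‖ ^ 2) := by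
  have hzc : Continuous z := continuous_iff_continuousAt.2 fun s => (hz s).continuousAt
  have cz : Continuous fun s => ‖z s‖ ^ 2 := by fun_prop
  have cd : Continuous fun s => ‖d s‖ ^ 2 := by fun_prop
  rw [lint_Ico cz (fun _ => by positivity) (by linarith),
    lint_Ico cz (fun _ => by positivity) (by linarith),
    lint_Ico cd (fun _ => by positivity) (by linarith),
    ← ENNReal.ofReal_mul (by positivity), ← ENNReal.ofReal_mul (by positivity),
    ← ENNReal.ofReal_add]
  · exact ENNReal.ofReal_le_ofReal (transport_real hz hd hL hl hq hql)
  · exact mul_nonneg (by positivity)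
      (intervalIntegral.integral_nonneg (by linarith) fun _ _ => by positivity)
  · exact mul_nonneg (by positivity)
      (intervalIntegral.integral_nonneg (by linarith) fun _ _ => by positivity)

/-- Integral over the plane in coordinates. -/
theorem lintegral_E2 {F : E2 → ENNReal} (hF : Measurable F) :
    ∫⁻ x, F x = ∫⁻ s : ℝ, ∫⁻ t : ℝ, F !₂[s, t] := by
  have h1 := (EuclideanSpace.volume_preserving_symm_measurableEquiv_toLp (Fin 2)).symm
  have h2 := (volume_preserving_finTwoArrow ℝ).symm
  have h3 := h1.comp h2
  rw [← h3.lintegral_comp hF]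
  have : Measurable fun a : ℝ × ℝ => F !₂[a.1, a.2] := by
    apply hF.comp
    apply (MeasurableEquiv.toLp 2 (Fin 2 → ℝ)).measurable.comp
    apply measurable_pi_lambda
    intro i; fin_cases i
    · exact measurable_fst
    · exact measurable_snd
  rw [← lintegral_prod (fun a : ℝ × ℝ => F !₂[a.1, a.2]) this.aemeasurable]
  rfl


/-- Half-open box. -/
def box (a : E2) (L : ℝ) : Set E2 := {x | ∀ i : Fin 2, x i ∈ Set.Ico (a i) (a i + L)}

theorem measurableSet_box (a : E2) (L : ℝ) : MeasurableSet (box a L) := by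
  have : box a L = ⋂ i : Fin 2, (fun x : E2 => x i) ⁻¹' Set.Ico (a i) (a i + L) := by
    ext x; simp [box]
  rw [this]
  refine MeasurableSet.iInter fun i => measurableSet_Ico.preimage ?_
  exact (by fun_prop : Continuous fun x : E2 => x i).measurable

theorem measurable_mk2 : Measurable fun a : ℝ × ℝ => (!₂[a.1, a.2] : E2) := by
  apply (MeasurableEquiv.toLp 2 (Fin 2 → ℝ)).measurable.comp
  apply measurable_pi_lambda
  intro i; fin_cases i
  · exact measurable_fst
  · exact measurable_snd

theorem setLIntegral_box {F : E2 → ENNReal} (hF : Measurable F) (a : E2) (L : ℝ) :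
    ∫⁻ x in box a L, F x = ∫⁻ s in Set.Ico (a 0) (a 0 + L), ∫⁻ t in Set.Ico (a 1) (a 1 + L),
      F !₂[s, t] := by
  rw [← lintegral_indicator (measurableSet_box a L),
    lintegral_E2 (hF.indicator (measurableSet_box a L)), ← lintegral_indicator measurableSet_Ico]
  congr 1; ext s
  by_cases hs : s ∈ Set.Ico (a 0) (a 0 + L)
  · rw [Set.indicator_of_mem hs, ← lintegral_indicator measurableSet_Ico]
    congr 1; ext t
    by_cases ht : t ∈ Set.Ico (a 1) (a 1 + L)
    · rw [Set.indicator_of_mem ht, Set.indicator_of_mem]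
      intro i; fin_cases i
      · exact hs
      · exact ht
    · rw [Set.indicator_of_notMem ht, Set.indicator_of_notMem]
      intro h; exact ht (h 1)
  · rw [Set.indicator_of_notMem hs]
    rw [← lintegral_zero]
    congr 1; ext t
    rw [Set.indicator_of_notMem]
    intro h; exact hs (h 0)

theorem mk2_add0 (s t : ℝ) : (!₂[s, t] : E2) = !₂[0, t] + s • basisVec 0 := by
  ext i; fin_cases i <;> simp [basisVec]

theorem mk2_add1 (s t : ℝ) : (!₂[s, t] : E2) = !₂[s, 0] + t • basisVec 1 := by
  ext i; fin_cases i <;> simp [basisVec]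

theorem continuous_mk2 : Continuous fun a : ℝ × ℝ => (!₂[a.1, a.2] : E2) := by
  have : (fun a : ℝ × ℝ => (!₂[a.1, a.2] : E2)) = fun a =>
      a.1 • basisVec 0 + a.2 • basisVec 1 := by
    ext a i; fin_cases i <;> simp [basisVec]
  rw [this]; fun_prop

theorem hasDerivAt_mk0 {F : Type*} [NormedAddCommGroup F] [NormedSpace ℝ F] {w : E2 → F}
    (hw : Differentiable ℝ w) (s t : ℝ) :
    HasDerivAt (fun s => w !₂[s, t]) (fderiv ℝ w !₂[s, t] (basisVec 0)) s := by
  have h1 : HasDerivAt (fun s : ℝ => (!₂[s, t] : E2)) (basisVec 0) s := by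
    have : (fun s : ℝ => (!₂[s, t] : E2)) = fun s => !₂[0, t] + s • basisVec 0 := by
      ext1 s; exact mk2_add0 s t
    rw [this]
    simpa using ((hasDerivAt_id s).smul_const (basisVec 0)).const_add (!₂[0, t] : E2)
  exact (hw !₂[s, t]).hasFDerivAt.comp_hasDerivAt s h1

theorem hasDerivAt_mk1 {F : Type*} [NormedAddCommGroup F] [NormedSpace ℝ F] {w : E2 → F}
    (hw : Differentiable ℝ w) (s t : ℝ) :
    HasDerivAt (fun t => w !₂[s, t]) (fderiv ℝ w !₂[s, t] (basisVec 1)) t := by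
  have h1 : HasDerivAt (fun t : ℝ => (!₂[s, t] : E2)) (basisVec 1) t := by
    have : (fun t : ℝ => (!₂[s, t] : E2)) = fun t => !₂[s, 0] + t • basisVec 1 := by
      ext1 t; exact mk2_add1 s t
    rw [this]
    simpa using ((hasDerivAt_id t).smul_const (basisVec 1)).const_add (!₂[s, 0] : E2)
  exact (hw !₂[s, t]).hasFDerivAt.comp_hasDerivAt t h1

theorem fderiv_eq_of_cov {D f z : ℂ} {a : ℝ} (h : D = -Complex.I * f + a * z) :
    f = Complex.I * (D - a * z) := by
  rw [h]
  linear_combination f * Complex.I_mul_I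

theorem transport2d {w : E2 → ℂ} {d : Fin 2 → E2 → ℂ} {a : Fin 2 → E2 → ℝ}
    (hw : Differentiable ℝ w) (hd : ∀ c, Continuous (d c))
    (h : ∀ c x, d c x = -Complex.I * fderiv ℝ w x (basisVec c) + (a c x : ℝ) * w x)
    {p q : E2} {L l : ℝ} (hl : 0 < l) (hL : L = 32 * l) (hq : ∀ i, p i ≤ q i)
    (hql : ∀ i, q i + l ≤ p i + L) :
    (∫⁻ x in box p L, ENNReal.ofReal (‖w x‖ ^ 2)) ≤
      5000 * ((∫⁻ x in box q l, ENNReal.ofReal (‖w x‖ ^ 2))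
        + ENNReal.ofReal (L ^ 2) * ∫⁻ x in box p L, ENNReal.ofReal (∑ c, ‖d c x‖ ^ 2)) := by
  have hL0 : 0 < L := by linarith
  have hwc : Continuous w := hw.continuous
  have mw : Measurable fun x => ENNReal.ofReal (‖w x‖ ^ 2) :=
    (ENNReal.continuous_ofReal.comp (by fun_prop)).measurable
  have md : ∀ c, Measurable fun x => ENNReal.ofReal (‖d c x‖ ^ 2) := fun c =>
    (ENNReal.continuous_ofReal.comp (((hd c).norm).pow 2)).measurable
  have mmk : ∀ {F : E2 → ENNReal}, Measurable F → Measurable fun a : ℝ × ℝ => F !₂[a.1, a.2] :=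
    fun hF => hF.comp measurable_mk2
  have hsum : ∀ x, ENNReal.ofReal (∑ c, ‖d c x‖ ^ 2) =
      ENNReal.ofReal (‖d 0 x‖ ^ 2) + ENNReal.ofReal (‖d 1 x‖ ^ 2) := by
    intro x
    rw [Fin.sum_univ_two, ENNReal.ofReal_add (by positivity) (by positivity)]
  have e32 : 2 * L / l = 64 := by rw [hL]; field_simp; norm_num
  -- first coordinate
  have s1 : ∀ t, (∫⁻ s in Set.Ico (p 0) (p 0 + L), ENNReal.ofReal (‖w !₂[s, t]‖ ^ 2)) ≤
      ENNReal.ofReal 64 * (∫⁻ s in Set.Ico (q 0) (q 0 + l), ENNReal.ofReal (‖w !₂[s, t]‖ ^ 2))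
      + ENNReal.ofReal (4 * L ^ 2) *
        ∫⁻ s in Set.Ico (p 0) (p 0 + L), ENNReal.ofReal (‖d 0 !₂[s, t]‖ ^ 2) := by
    intro t
    have := transport1d (z := fun s => w !₂[s, t]) (d := fun s => d 0 !₂[s, t])
      (a := fun s => a 0 !₂[s, t]) (fun s => by
        have := hasDerivAt_mk0 hw s t
        rwa [fderiv_eq_of_cov (h 0 !₂[s, t])] at this)
      ((hd 0).comp (continuous_mk2.comp (by fun_prop : Continuous fun s : ℝ => (s, t))))
      hL0 hl (hq 0) (hql 0)
    rwa [e32] at this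
  have s2 : ∀ s, (∫⁻ t in Set.Ico (p 1) (p 1 + L), ENNReal.ofReal (‖w !₂[s, t]‖ ^ 2)) ≤
      ENNReal.ofReal 64 * (∫⁻ t in Set.Ico (q 1) (q 1 + l), ENNReal.ofReal (‖w !₂[s, t]‖ ^ 2))
      + ENNReal.ofReal (4 * L ^ 2) *
        ∫⁻ t in Set.Ico (p 1) (p 1 + L), ENNReal.ofReal (‖d 1 !₂[s, t]‖ ^ 2) := by
    intro s
    have := transport1d (z := fun t => w !₂[s, t]) (d := fun t => d 1 !₂[s, t])
      (a := fun t => a 1 !₂[s, t]) (fun t => by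
        have := hasDerivAt_mk1 hw s t
        rwa [fderiv_eq_of_cov (h 1 !₂[s, t])] at this)
      ((hd 1).comp (continuous_mk2.comp (by fun_prop : Continuous fun t : ℝ => (s, t))))
      hL0 hl (hq 1) (hql 1)
    rwa [e32] at this
  simp_rw [hsum]
  rw [lintegral_add_left (md 0)]
  set E0 := ∫⁻ x in box p L, ENNReal.ofReal (‖d 0 x‖ ^ 2) with hE0
  set E1 := ∫⁻ x in box p L, ENNReal.ofReal (‖d 1 x‖ ^ 2) with hE1
  have step1 : (∫⁻ x in box p L, ENNReal.ofReal (‖w x‖ ^ 2)) ≤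
      ENNReal.ofReal 64 * (∫⁻ s in Set.Ico (q 0) (q 0 + l), ∫⁻ t in Set.Ico (p 1) (p 1 + L),
        ENNReal.ofReal (‖w !₂[s, t]‖ ^ 2)) + ENNReal.ofReal (4 * L ^ 2) * E0 := by
    rw [setLIntegral_box mw, lintegral_lintegral_swap (mmk mw).aemeasurable]
    refine (lintegral_mono fun t => s1 t).trans ?_
    rw [lintegral_add_left, lintegral_const_mul, lintegral_const_mul, hE0,
      setLIntegral_box (md 0), lintegral_lintegral_swap (f := fun t s => ENNReal.ofReal (‖w !₂[s, t]‖ ^ 2))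
        ((mmk mw).comp measurable_swap).aemeasurable,
      lintegral_lintegral_swap (f := fun s t => ENNReal.ofReal (‖d 0 !₂[s, t]‖ ^ 2))
        (mmk (md 0)).aemeasurable]
    · exact Measurable.lintegral_prod_left' (mmk (md 0))
    · exact Measurable.lintegral_prod_left' (mmk mw)
    · exact (Measurable.lintegral_prod_left' (mmk mw)).const_mul _
  have step2 : (∫⁻ s in Set.Ico (q 0) (q 0 + l), ∫⁻ t in Set.Ico (p 1) (p 1 + L),
        ENNReal.ofReal (‖w !₂[s, t]‖ ^ 2)) ≤
      ENNReal.ofReal 64 * (∫⁻ x in box q l, ENNReal.ofReal (‖w x‖ ^ 2)) +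
        ENNReal.ofReal (4 * L ^ 2) * E1 := by
    refine (lintegral_mono fun s => s2 s).trans ?_
    rw [lintegral_add_left, lintegral_const_mul, lintegral_const_mul, hE1,
      setLIntegral_box (md 1), setLIntegral_box mw]
    · refine add_le_add le_rfl (mul_le_mul' le_rfl ?_)
      exact lintegral_mono_set (Set.Ico_subset_Ico (hq 0) (hql 0))
    · exact Measurable.lintegral_prod_right' (mmk (md 1))
    · exact Measurable.lintegral_prod_right' (mmk mw)
    · exact (Measurable.lintegral_prod_right' (mmk mw)).const_mul _
  have e4 : ENNReal.ofReal (4 * L ^ 2) = 4 * ENNReal.ofReal (L ^ 2) := by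
    rw [ENNReal.ofReal_mul (by norm_num)]; norm_num
  have e64 : ENNReal.ofReal 64 = 64 := by norm_num
  rw [e4, e64] at step1 step2
  set W := ∫⁻ x in box q l, ENNReal.ofReal (‖w x‖ ^ 2)
  set K2 := ENNReal.ofReal (L ^ 2)
  calc _ ≤ 64 * (64 * W + 4 * K2 * E1) + 4 * K2 * E0 := step1.trans (by gcongr)
    _ = 4096 * W + 256 * (K2 * E1) + 4 * (K2 * E0) := by ring
    _ ≤ 5000 * W + 5000 * (K2 * E1) + 5000 * (K2 * E0) := by gcongr <;> norm_num
    _ = _ := by ring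


theorem ind_eq {A B : Type*} {s : Set A} {t : Set B} {f : A → ENNReal} {g : B → ENNReal}
    {a : A} {b : B} (h : a ∈ s ↔ b ∈ t) (hfg : f a = g b) : s.indicator f a = t.indicator g b := by
  by_cases ha : a ∈ s
  · rw [Set.indicator_of_mem ha, Set.indicator_of_mem (h.1 ha), hfg]
  · rw [Set.indicator_of_notMem ha, Set.indicator_of_notMem (fun hb => ha (h.2 hb))]

/-- The regularised two-body field. -/
def bR (R : ℝ) (x : E2) : E2 := ((regNorm R x) ^ 2)⁻¹ • perp x

theorem perp_0 (x : E2) : perp x 0 = - x 1 := by simp [perp]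
theorem perp_1 (x : E2) : perp x 1 = x 0 := by simp [perp]

theorem continuous_perp : Continuous perp := by
  have : perp = fun x => (-(x 1)) • basisVec 0 + (x 0) • basisVec 1 := by
    ext x i; fin_cases i <;> simp [basisVec, perp]
  rw [this]; fun_prop

theorem continuous_bR {R : ℝ} (hR : 0 < R) : Continuous (bR R) := by
  unfold bR regNorm
  refine Continuous.smul (Continuous.inv₀ ((continuous_norm.max continuous_const).pow 2) fun x => ?_)
    continuous_perp
  have : 0 < max ‖x‖ R := lt_max_of_lt_right hR
  exact (pow_pos this 2).ne'

theorem Avec_eq (R : ℝ) {N : ℕ} (X : Fin N → E2) (j : Fin N) :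
    Avec R X j = ∑ k ∈ Finset.univ.erase j, bR R (X j - X k) := rfl

theorem continuous_Avec {R : ℝ} (hR : 0 < R) {N : ℕ} (j : Fin N) :
    Continuous fun X : Fin N → E2 => Avec R X j := by
  simp_rw [Avec_eq]
  refine continuous_finsetSum _ fun k _ => (continuous_bR hR).comp (by fun_prop)

theorem continuous_covD {R α : ℝ} (hR : 0 < R) {N : ℕ} {Ψ : (Fin N → E2) → ℂ}
    (hΨ : ContDiff ℝ 1 Ψ) (j : Fin N) (c : Fin 2) :
    Continuous fun X => covD R α Ψ j X c := by
  unfold covD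
  have h1 : Continuous fun X => fderiv ℝ Ψ X (dirv N j c) :=
    (hΨ.continuous_fderiv (by norm_num)).clm_apply continuous_const
  have h2 := continuous_Avec hR j
  have h3 := hΨ.continuous
  fun_prop

/-- density integrand -/
def fE {N : ℕ} (Ψ : (Fin N → E2) → ℂ) (X : Fin N → E2) : ENNReal := ENNReal.ofReal (‖Ψ X‖ ^ 2)

/-- energy integrand -/
def eE (R α : ℝ) {N : ℕ} (Ψ : (Fin N → E2) → ℂ) (j : Fin N) (X : Fin N → E2) : ENNReal :=
  ENNReal.ofReal (∑ c, ‖covD R α Ψ j X c‖ ^ 2)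

theorem measurable_fE {N : ℕ} {Ψ : (Fin N → E2) → ℂ} (hΨ : ContDiff ℝ 1 Ψ) :
    Measurable (fE Ψ) :=
  (ENNReal.continuous_ofReal.comp (hΨ.continuous.norm.pow 2)).measurable

theorem continuous_e {R α : ℝ} (hR : 0 < R) {N : ℕ} {Ψ : (Fin N → E2) → ℂ}
    (hΨ : ContDiff ℝ 1 Ψ) (j : Fin N) : Continuous fun X => ∑ c, ‖covD R α Ψ j X c‖ ^ 2 :=
  continuous_finsetSum _ fun c _ => (continuous_covD hR hΨ j c).norm.pow 2

theorem measurable_eE {R α : ℝ} (hR : 0 < R) {N : ℕ} {Ψ : (Fin N → E2) → ℂ}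
    (hΨ : ContDiff ℝ 1 Ψ) (j : Fin N) : Measurable (eE R α Ψ j) :=
  (ENNReal.continuous_ofReal.comp (continuous_e hR hΨ j)).measurable

theorem fderivUpd {N : ℕ} {Ψ : (Fin N → E2) → ℂ} (hΨ : ContDiff ℝ 1 Ψ) (X : Fin N → E2)
    (j : Fin N) (x v : E2) :
    fderiv ℝ (fun x => Ψ (Function.update X j x)) x v =
      fderiv ℝ Ψ (Function.update X j x) (Function.update 0 j v) := by
  have h1 := hasFDerivAt_update (𝕜 := ℝ) X (i := j) x
  have h2 := ((hΨ.differentiable (by norm_num)) (Function.update X j x)).hasFDerivAt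
  have h3 := (h2.comp x h1).fderiv
  have : (Ψ ∘ Function.update X j) = fun x => Ψ (Function.update X j x) := rfl
  rw [this] at h3
  rw [h3]
  simp only [ContinuousLinearMap.comp_apply]
  congr 1
  ext k : 1
  by_cases hk : k = j
  · subst hk; simp
  · simp [hk]

theorem differentiable_update {N : ℕ} {Ψ : (Fin N → E2) → ℂ} (hΨ : ContDiff ℝ 1 Ψ)
    (X : Fin N → E2) (j : Fin N) : Differentiable ℝ (fun x => Ψ (Function.update X j x)) := by
  intro x
  have h1 := hasFDerivAt_update (𝕜 := ℝ) X (i := j) x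
  have h2 := ((hΨ.differentiable (by norm_num)) (Function.update X j x)).hasFDerivAt
  exact (h2.comp x h1).differentiableAt

theorem covD_update (R α : ℝ) {N : ℕ} {Ψ : (Fin N → E2) → ℂ} (hΨ : ContDiff ℝ 1 Ψ)
    (X : Fin N → E2) (j : Fin N) (x : E2) (c : Fin 2) :
    covD R α Ψ j (Function.update X j x) c =
      -Complex.I * fderiv ℝ (fun x => Ψ (Function.update X j x)) x (basisVec c) +
        ((α * Avec R (Function.update X j x) j c : ℝ) : ℂ) * Ψ (Function.update X j x) := by
  rw [fderivUpd hΨ]; rfl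

theorem transportN {R α : ℝ} (hR : 0 < R) {N : ℕ} {Ψ : (Fin N → E2) → ℂ}
    (hΨ : ContDiff ℝ 1 Ψ) (j : Fin N) {p q : E2} {L l : ℝ} (hl : 0 < l) (hL : L = 32 * l)
    (hq : ∀ i, p i ≤ q i) (hql : ∀ i, q i + l ≤ p i + L) {Γ : Set (Fin N → E2)}
    (hΓ : MeasurableSet Γ) (h1 : ∀ X ∈ Γ, X j ∈ box p L)
    (h2 : ∀ X ∈ Γ, ∀ x ∈ box p L, Function.update X j x ∈ Γ) :
    (∫⁻ X in Γ, fE Ψ X) ≤ 5000 * ((∫⁻ X in Γ ∩ {X | X j ∈ box q l}, fE Ψ X) +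
      ENNReal.ofReal (L ^ 2) * ∫⁻ X in Γ, eE R α Ψ j X) := by
  have hTm : MeasurableSet {X : Fin N → E2 | X j ∈ box q l} :=
    (measurableSet_box q l).preimage (measurable_pi_apply j)
  have mf := measurable_fE hΨ
  have me := measurable_eE (α := α) hR hΨ j
  have mg : Measurable fun a => (Γ ∩ {X | X j ∈ box q l}).indicator (fE Ψ) a +
      ENNReal.ofReal (L ^ 2) * Γ.indicator (eE R α Ψ j) a :=
    (mf.indicator (hΓ.inter hTm)).add ((me.indicator hΓ).const_mul _)
  rw [← lintegral_indicator hΓ, ← lintegral_indicator hΓ, ← lintegral_indicator (hΓ.inter hTm),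
    ← lintegral_const_mul _ (me.indicator hΓ), ← lintegral_add_left (mf.indicator (hΓ.inter hTm)),
    ← lintegral_const_mul _ mg]
  refine lintegral_le_of_lmarginal_le {j} (mf.indicator hΓ) (mg.const_mul _) ?_
  intro X
  rw [lmarginal_singleton, lmarginal_singleton]
  dsimp only
  by_cases hX : ∃ x, Function.update X j x ∈ Γ
  · obtain ⟨x0, hx0⟩ := hX
    have hsec : ∀ x, Function.update X j x ∈ Γ ↔ x ∈ box p L := by
      intro x
      constructor
      · intro h; simpa using h1 _ h
      · intro h; simpa using h2 _ hx0 x h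
    have hsub : box q l ⊆ box p L := fun x hx i =>
      ⟨(hq i).trans (hx i).1, (hx i).2.trans_le (hql i)⟩
    have key := transport2d (w := fun x => Ψ (Function.update X j x))
      (d := fun c x => covD R α Ψ j (Function.update X j x) c)
      (a := fun c x => α * Avec R (Function.update X j x) j c)
      (differentiable_update hΨ X j)
      (fun c => (continuous_covD hR hΨ j c).comp (continuous_const.update j continuous_id))
      (fun c x => covD_update R α hΨ X j x c) hl hL hq hql
    have mu : Measurable fun x : E2 => Function.update X j x := measurable_update X
    have e1 : ∀ x, Γ.indicator (fE Ψ) (Function.update X j x) =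
        (box p L).indicator (fun x => fE Ψ (Function.update X j x)) x := by
      exact fun x => ind_eq (hsec x) rfl
    have e2 : ∀ x, (Γ ∩ {X | X j ∈ box q l}).indicator (fE Ψ) (Function.update X j x) =
        (box q l).indicator (fun x => fE Ψ (Function.update X j x)) x := by
      intro x
      have : x ∈ box p L ∧ x ∈ box q l ↔ x ∈ box q l := and_iff_right_of_imp fun h => hsub h
      refine ind_eq ?_ rfl
      rw [← this, ← hsec]
      simp
    have e3 : ∀ x, Γ.indicator (eE R α Ψ j) (Function.update X j x) =
        (box p L).indicator (fun x => eE R α Ψ j (Function.update X j x)) x := by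
      exact fun x => ind_eq (hsec x) rfl
    simp_rw [e1, e2, e3]
    have mf' := mf.comp mu
    have me' := me.comp mu
    rw [lintegral_const_mul, lintegral_add_left, lintegral_const_mul,
      lintegral_indicator (measurableSet_box _ _), lintegral_indicator (measurableSet_box _ _),
      lintegral_indicator (measurableSet_box _ _)]
    · exact key
    · exact me'.indicator (measurableSet_box _ _)
    · exact mf'.indicator (measurableSet_box _ _)
    · exact (mf'.indicator (measurableSet_box _ _)).add
        ((me'.indicator (measurableSet_box _ _)).const_mul _)
  · push Not at hX
    simp [Set.indicator, hX]


theorem interval_cs {g : ℝ → ℝ} (hg : Continuous g) {p L : ℝ} (hL : 0 < L) :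
    (∫ s in p..(p + L), g s) ^ 2 ≤ L * ∫ s in p..(p + L), g s ^ 2 := by
  set A := ∫ s in p..(p + L), g s with hA
  set B := ∫ s in p..(p + L), g s ^ 2 with hB
  have h : 0 ≤ ∫ s in p..(p + L), (g s - A / L) ^ 2 :=
    intervalIntegral.integral_nonneg (by linarith) fun _ _ => by positivity
  have i1 : IntervalIntegrable (fun s => g s ^ 2) volume p (p + L) :=
    (hg.pow 2).intervalIntegrable _ _
  have i2 : IntervalIntegrable (fun s => (2 * (A / L)) * g s) volume p (p + L) :=
    (hg.const_mul _).intervalIntegrable _ _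
  have e : (fun s => (g s - A / L) ^ 2) = fun s => g s ^ 2 - (2 * (A / L)) * g s + (A / L) ^ 2 := by
    ext s; ring
  rw [e, intervalIntegral.integral_add (i1.sub i2) (by simp), intervalIntegral.integral_sub i1 i2,
    intervalIntegral.integral_const_mul, intervalIntegral.integral_const, ← hA, ← hB] at h
  simp only [add_sub_cancel_left, smul_eq_mul] at h
  have : B - 2 * (A / L) * A + L * (A / L) ^ 2 = B - A ^ 2 / L := by field_simp; ring
  rw [this] at h
  have : A ^ 2 / L ≤ B := by linarith
  rw [div_le_iff₀ hL] at this
  linarith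

theorem one_add_exp_lower {t : ℝ} (h0 : 0 ≤ t) (h2 : t ≤ 2) :
    2 * |1 - t| ≤ ‖1 + Complex.exp (Complex.I * (Real.pi * t : ℝ))‖ := by
  have e : 1 + Complex.exp (Complex.I * (Real.pi * t : ℝ)) =
      Complex.exp (Complex.I * (Real.pi * t / 2 : ℝ)) * ((2 * Real.cos (Real.pi * t / 2) : ℝ) : ℂ) := by
    push_cast
    rw [Complex.two_cos, mul_add, ← Complex.exp_add, ← Complex.exp_add]
    have : Complex.I * (Real.pi * t / 2) + -(Real.pi * t / 2 : ℂ) * Complex.I = 0 := by ring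
    have h' : Complex.I * (Real.pi * t / 2 : ℂ) + (Real.pi * t / 2) * Complex.I =
      Complex.I * (Real.pi * t) := by ring
    rw [this, h', Complex.exp_zero]; ring
  rw [e, norm_mul, mul_comm Complex.I, Complex.norm_exp_ofReal_mul_I, one_mul, Complex.norm_real,
    Real.norm_eq_abs, abs_mul, abs_two]
  refine mul_le_mul_of_nonneg_left ?_ (by norm_num)
  have e2 : Real.cos (Real.pi * t / 2) = Real.sin (Real.pi / 2 * (1 - t)) := by
    rw [← Real.sin_pi_div_two_sub]; congr 1; ring
  rw [e2]
  have hpi := Real.pi_pos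
  have key : ∀ y : ℝ, 0 ≤ y → y ≤ 1 → y ≤ Real.sin (Real.pi / 2 * y) := by
    intro y hy hy1
    have := Real.mul_le_sin (x := Real.pi / 2 * y) (by positivity) (by nlinarith)
    have e : 2 / Real.pi * (Real.pi / 2 * y) = y := by field_simp
    rwa [e] at this
  rcases le_total 0 (1 - t) with h | h
  · rw [abs_of_nonneg h]
    exact (key _ h (by linarith)).trans (le_abs_self _)
  · rw [abs_of_nonpos h]
    have := key (-(1 - t)) (by linarith) (by linarith)
    refine this.trans ?_
    rw [mul_neg, Real.sin_neg]
    exact neg_le_abs _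

theorem angular {z δ : ℝ → ℂ} {a : ℝ → ℝ}
    (hz : ∀ s, HasDerivAt z (Complex.I * (δ s - a s * z s)) s) (hδ : Continuous δ)
    (ha : Continuous a) (hodd : ∀ φ, z (φ + Real.pi) = - z φ) {t : ℝ} (ht0 : 0 ≤ t) (ht2 : t ≤ 2)
    (hflux : ∀ φ, ∫ s in φ..(φ + Real.pi), a s = Real.pi * t)
    (hper : ∀ φ, ‖δ (φ + 2 * Real.pi)‖ = ‖δ φ‖) :
    (1 - t) ^ 2 * ∫ φ in (-Real.pi)..Real.pi, ‖z φ‖ ^ 2 ≤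
      5 * ∫ φ in (-Real.pi)..Real.pi, ‖δ φ‖ ^ 2 := by
  have hpi := Real.pi_pos
  have hzc : Continuous z := continuous_iff_continuousAt.2 fun s => (hz s).continuousAt
  set P : ℝ → ℝ := fun φ => ∫ s in (0 : ℝ)..φ, a s with hP
  have hPd : ∀ φ, HasDerivAt P (a φ) φ := fun φ => ha.integral_hasStrictDerivAt 0 φ |>.hasDerivAt
  set Z : ℝ → ℂ := fun φ => Complex.exp (Complex.I * (P φ : ℝ)) * z φ with hZ
  have hZd : ∀ φ, HasDerivAt Z (Complex.exp (Complex.I * (P φ : ℝ)) * (Complex.I * δ φ)) φ := by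
    intro φ
    have h1 : HasDerivAt (fun φ => Complex.I * ((P φ : ℝ) : ℂ)) (Complex.I * (a φ : ℂ)) φ :=
      ((hPd φ).ofReal_comp).const_mul _
    have h2 := h1.cexp.mul (hz φ)
    refine h2.congr_deriv ?_
    ring
  have hPc : Continuous P := continuous_iff_continuousAt.2 fun s => (hPd s).continuousAt
  have hnorm : ∀ φ, ‖Complex.exp (Complex.I * (P φ : ℝ)) * (Complex.I * δ φ)‖ ≤ ‖δ φ‖ := by
    intro φ
    rw [norm_mul, mul_comm Complex.I ((P φ : ℝ) : ℂ), Complex.norm_exp_ofReal_mul_I]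
    simp
  set D := ∫ φ in (-Real.pi)..Real.pi, ‖δ φ‖ ^ 2 with hD
  have per : Function.Periodic (fun φ => ‖δ φ‖ ^ 2) (2 * Real.pi) := fun φ => by
    simp only; rw [hper]
  have hDφ : ∀ φ, ∫ s in φ..(φ + Real.pi), ‖δ s‖ ^ 2 ≤ D := by
    intro φ
    have := per.intervalIntegral_add_eq φ (-Real.pi)
    have e : -Real.pi + 2 * Real.pi = Real.pi := by ring
    rw [e] at this
    rw [hD, ← this]
    apply intervalIntegral.integral_mono_interval le_rfl (by linarith) (by linarith)
    · exact Filter.Eventually.of_forall fun _ => by positivity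
    · exact (hδ.norm.pow 2).intervalIntegrable _ _
  have pt : ∀ φ, 4 * ((1 - t) ^ 2 * ‖z φ‖ ^ 2) ≤ Real.pi * D := by
    intro φ
    have h1 := osc1d hZd (by fun_prop) hδ.norm hnorm (p := φ) (L := Real.pi)
      (x := φ + Real.pi) (y := φ) ⟨by linarith, le_rfl⟩ ⟨le_rfl, by linarith⟩
    have hPP : P (φ + Real.pi) = P φ + Real.pi * t := by
      rw [← hflux φ, hP]
      exact (intervalIntegral.integral_add_adjacent_intervals (ha.intervalIntegrable _ _)
        (ha.intervalIntegrable _ _)).symm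
    have h2 : Z (φ + Real.pi) - Z φ = - (Complex.exp ((P φ : ℝ) * Complex.I) * z φ *
        (1 + Complex.exp (Complex.I * (Real.pi * t : ℝ)))) := by
      simp only [hZ]
      rw [hPP, hodd, Complex.ofReal_add, mul_add, Complex.exp_add, mul_comm Complex.I ((P φ : ℝ) : ℂ)]
      ring
    rw [h2, norm_neg, norm_mul, norm_mul, Complex.norm_exp_ofReal_mul_I, one_mul] at h1
    have h3 : ‖z φ‖ * (2 * |1 - t|) ≤ ∫ s in φ..(φ + Real.pi), ‖δ s‖ :=
      (mul_le_mul_of_nonneg_left (one_add_exp_lower ht0 ht2) (norm_nonneg _)).trans h1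
    have h4 : (‖z φ‖ * (2 * |1 - t|)) ^ 2 ≤ (∫ s in φ..(φ + Real.pi), ‖δ s‖) ^ 2 :=
      pow_le_pow_left₀ (by positivity) h3 2
    have h5 := interval_cs hδ.norm (p := φ) hpi
    have h6 := mul_le_mul_of_nonneg_left (hDφ φ) hpi.le
    have h7 : (‖z φ‖ * (2 * |1 - t|)) ^ 2 = 4 * ((1 - t) ^ 2 * ‖z φ‖ ^ 2) := by
      rw [mul_pow, mul_pow, sq_abs]; ring
    linarith
  have h := intervalIntegral.integral_mono_on (a := -Real.pi) (b := Real.pi)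
    (f := fun φ => 4 * ((1 - t) ^ 2 * ‖z φ‖ ^ 2)) (g := fun _ => Real.pi * D) (μ := volume) (by linarith)
    ((by fun_prop : Continuous fun φ => 4 * ((1 - t) ^ 2 * ‖z φ‖ ^ 2)).intervalIntegrable _ _)
    (by simp) (fun φ _ => pt φ)
  rw [intervalIntegral.integral_const_mul, intervalIntegral.integral_const_mul,
    intervalIntegral.integral_const, smul_eq_mul] at h
  have hD0 : 0 ≤ D := intervalIntegral.integral_nonneg (by linarith) fun _ _ => by positivity
  have hpi2 : Real.pi ^ 2 ≤ 10 := by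
    have := Real.pi_lt_d2
    nlinarith
  nlinarith


/-- Polar coordinates. -/
def pol (ρ φ : ℝ) : E2 := !₂[ρ * Real.cos φ, ρ * Real.sin φ]

theorem continuous_pol : Continuous fun p : ℝ × ℝ => pol p.1 p.2 :=
  continuous_mk2.comp (f := fun p : ℝ × ℝ => (p.1 * Real.cos p.2, p.1 * Real.sin p.2)) (by fun_prop)

theorem norm_pol (ρ φ : ℝ) : ‖pol ρ φ‖ = |ρ| := by
  rw [EuclideanSpace.norm_eq, Fin.sum_univ_two]
  simp only [pol, Real.norm_eq_abs, sq_abs]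
  have : (!₂[ρ * Real.cos φ, ρ * Real.sin φ] : E2) 0 ^ 2 + (!₂[ρ * Real.cos φ, ρ * Real.sin φ] : E2) 1 ^ 2
      = ρ ^ 2 := by
    simp
    nlinarith [Real.sin_sq_add_cos_sq φ]
  rw [this, Real.sqrt_sq_eq_abs]

open Set in
theorem polar_ball {g : E2 → ℝ} (hg : Continuous g) (h0 : ∀ x, 0 ≤ g x) {D : ℝ} (hD : 0 < D) :
    ∫⁻ x in Metric.ball (0 : E2) D, ENNReal.ofReal (g x) =
      ENNReal.ofReal (∫ ρ in (0 : ℝ)..D, ρ * ∫ φ in (-Real.pi)..Real.pi, g (pol ρ φ)) := by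
  have hpi := Real.pi_pos
  have hgp : Continuous (fun p : ℝ × ℝ => g (pol p.1 p.2)) := hg.comp continuous_pol
  have mG : Measurable fun x => ENNReal.ofReal (g x) := (ENNReal.continuous_ofReal.comp hg).measurable
  have mI := mG.indicator (Metric.isOpen_ball (x := (0 : E2)) (ε := D)).measurableSet
  have mI2 := mI.comp measurable_mk2
  rw [← lintegral_indicator Metric.isOpen_ball.measurableSet, lintegral_E2 mI,
    ← lintegral_prod (fun a : ℝ × ℝ => (Metric.ball (0 : E2) D).indicator
      (fun x => ENNReal.ofReal (g x)) !₂[a.1, a.2]) mI2.aemeasurable]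
  rw [← Measure.volume_eq_prod, ← lintegral_comp_polarCoord_symm]
  have e1 : ∀ p ∈ polarCoord.target, ENNReal.ofReal p.1 • (Metric.ball (0 : E2) D).indicator
      (fun x => ENNReal.ofReal (g x)) !₂[(polarCoord.symm p).1, (polarCoord.symm p).2] =
      (Iio D).indicator (fun ρ => ENNReal.ofReal (ρ * g (pol ρ p.2))) p.1 := by
    rintro ⟨ρ, φ⟩ hp
    simp only [polarCoord_target, mem_prod, mem_Ioi, mem_Ioo] at hp
    simp only [polarCoord_symm_apply]
    change ENNReal.ofReal ρ • (Metric.ball (0 : E2) D).indicator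
      (fun x => ENNReal.ofReal (g x)) (pol ρ φ) = _
    by_cases h : ρ < D
    · rw [indicator_of_mem, indicator_of_mem (by exact h), ENNReal.ofReal_mul hp.1.le, smul_eq_mul]
      rw [mem_ball_zero_iff, norm_pol, abs_of_pos hp.1]; exact h
    · rw [indicator_of_notMem, indicator_of_notMem (by exact h), smul_zero]
      rw [mem_ball_zero_iff, norm_pol, abs_of_pos hp.1]; exact h
  rw [setLIntegral_congr_fun polarCoord.open_target.measurableSet e1]
  have mJ : Measurable fun p : ℝ × ℝ =>
      (Iio D).indicator (fun ρ => ENNReal.ofReal (ρ * g (pol ρ p.2))) p.1 := by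
    have : (fun p : ℝ × ℝ => (Iio D).indicator (fun ρ => ENNReal.ofReal (ρ * g (pol ρ p.2))) p.1)
      = ((fun p : ℝ × ℝ => p.1) ⁻¹' (Iio D)).indicator
        (fun p => ENNReal.ofReal (p.1 * g (pol p.1 p.2))) := by
      ext p
      exact ind_eq Iff.rfl rfl
    rw [this]
    exact (ENNReal.continuous_ofReal.comp (continuous_fst.mul hgp)).measurable.indicator
      (measurableSet_Iio.preimage measurable_fst)
  rw [polarCoord_target, Measure.volume_eq_prod, ← Measure.prod_restrict,
    lintegral_prod _ mJ.aemeasurable]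
  have e2 : ∀ ρ ∈ Ioi (0 : ℝ), ∫⁻ φ in Ioo (-Real.pi) Real.pi,
      (Iio D).indicator (fun ρ => ENNReal.ofReal (ρ * g (pol ρ φ))) ρ =
      (Iio D).indicator (fun ρ => ENNReal.ofReal (ρ * ∫ φ in (-Real.pi)..Real.pi, g (pol ρ φ))) ρ := by
    intro ρ hρ
    have hρ' : 0 < ρ := hρ
    by_cases h : ρ ∈ Iio D
    · simp only [indicator_of_mem h]
      have c1 : Continuous fun φ => ρ * g (pol ρ φ) :=
        continuous_const.mul (hgp.comp (by fun_prop : Continuous fun φ : ℝ => (ρ, φ)))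
      rw [setLIntegral_congr (Ioo_ae_eq_Ico), lint_Ico c1
        (fun φ => mul_nonneg hρ'.le (h0 _)) (by linarith), intervalIntegral.integral_const_mul]
    · simp only [indicator_of_notMem h, lintegral_zero]
  rw [setLIntegral_congr_fun measurableSet_Ioi e2, lintegral_indicator measurableSet_Iio,
    Measure.restrict_restrict measurableSet_Iio]
  have e3 : Iio D ∩ Ioi 0 = Ioo 0 D := by ext; simp [and_comm]
  have cH : Continuous fun ρ => ∫ φ in (-Real.pi)..Real.pi, g (pol ρ φ) :=
    intervalIntegral.continuous_parametric_intervalIntegral_of_continuous' (f := fun ρ φ => g (pol ρ φ)) hgp _ _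
  have cA : Continuous fun ρ : ℝ => |ρ| * ∫ φ in (-Real.pi)..Real.pi, g (pol ρ φ) :=
    continuous_abs.mul cH
  have e4 : ∫⁻ ρ in Ico 0 D, ENNReal.ofReal (ρ * ∫ φ in (-Real.pi)..Real.pi, g (pol ρ φ)) =
      ∫⁻ ρ in Ico 0 D, ENNReal.ofReal (|ρ| * ∫ φ in (-Real.pi)..Real.pi, g (pol ρ φ)) :=
    setLIntegral_congr_fun measurableSet_Ico fun ρ hρ => by
      rw [abs_of_nonneg hρ.1]
  rw [e3, setLIntegral_congr Ioo_ae_eq_Ico, e4, lint_Ico cA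
    (fun ρ => mul_nonneg (abs_nonneg _)
      (intervalIntegral.integral_nonneg (by linarith) fun _ _ => h0 _)) hD.le]
  congr 1
  apply intervalIntegral.integral_congr
  intro ρ hρ
  rw [uIcc_of_le hD.le] at hρ
  simp only
  rw [abs_of_nonneg hρ.1]

theorem Fineq {α s : ℝ} (h0 : 0 ≤ α) (h2 : α ≤ 2) (hs : 0 ≤ s) :
    (|α - 1| / 36 * (1 + 2 / (1 + s))) ^ 2 - |α - 1| / 9 * (s / (1 + s) ^ 2) ≤
      (1 - α * min 1 s) ^ 2 / 144 := by
  set ν := |α - 1| with hν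
  have hν0 : 0 ≤ ν := abs_nonneg _
  have hν1 : ν ≤ 1 := abs_le.2 ⟨by linarith, by linarith⟩
  have hA : (ν / 36 * (1 + 2 / (1 + s))) ^ 2 ≤ ν ^ 2 / 144 := by
    have h1 : 2 / (1 + s) ≤ 2 := by
      rw [div_le_iff₀ (by linarith)]; linarith
    have h3 : 0 ≤ 2 / (1 + s) := by positivity
    have : ν / 36 * (1 + 2 / (1 + s)) ≤ ν / 12 := by nlinarith
    have := pow_le_pow_left₀ (by positivity) this 2
    linarith [this, (by ring : (ν / 12) ^ 2 = ν ^ 2 / 144)]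
  have hB : 0 ≤ ν / 9 * (s / (1 + s) ^ 2) := by positivity
  rcases le_total 1 s with h | h
  · rw [min_eq_left h, mul_one]
    have : ν ^ 2 = (1 - α) ^ 2 := by rw [hν, sq_abs]; ring
    linarith
  · rw [min_eq_right h]
    rcases le_total α 1 with ha | ha
    · have e : ν = 1 - α := by rw [hν, abs_of_nonpos (by linarith)]; ring
      have : ν ≤ 1 - α * s := by nlinarith
      have := pow_le_pow_left₀ hν0 this 2
      linarith
    · have e : α = 1 + ν := by rw [hν, abs_of_nonneg (by linarith)]; ring
      have h3 : s / 4 ≤ s / (1 + s) ^ 2 := by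
        apply div_le_div_of_nonneg_left hs (by positivity); nlinarith
      have h4 : ν / 9 * (s / 4) ≤ ν / 9 * (s / (1 + s) ^ 2) := by gcongr
      have h5 : ν ^ 2 - (1 - α * s) ^ 2 = (s * (1 + ν) - (1 - ν)) * ((1 + ν) * (1 - s)) := by
        rw [e]; ring
      have h6 : s * (1 + ν) - (1 - ν) ≤ 2 * s * ν := by nlinarith
      have h7 : (1 + ν) * (1 - s) ≤ 2 := by nlinarith
      have h8 : 0 ≤ (1 + ν) * (1 - s) := mul_nonneg (by linarith) (by linarith)
      have h9 : ν ^ 2 - (1 - α * s) ^ 2 ≤ 2 * s * ν * 2 := by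
        rw [h5]
        exact (mul_le_mul_of_nonneg_right h6 h8).trans
          (mul_le_mul_of_nonneg_left h7 (by positivity))
      nlinarith

theorem swap_cont {g : ℝ → ℝ → ℝ} (hg : Continuous fun p : ℝ × ℝ => g p.1 p.2) (a b c d : ℝ) :
    ∫ x in a..b, ∫ y in c..d, g x y = ∫ y in c..d, ∫ x in a..b, g x y := by
  apply intervalIntegral_intervalIntegral_swap
  have : IntegrableOn (Function.uncurry g) (Set.uIcc a b ×ˢ Set.uIcc c d) :=
    (ContinuousOn.integrableOn_compact (isCompact_uIcc.prod isCompact_uIcc) hg.continuousOn)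
  exact this.mono_set (Set.prod_mono Set.uIoc_subset_uIcc Set.uIoc_subset_uIcc)

theorem pol_eq (ρ φ : ℝ) : pol ρ φ = (ρ * Real.cos φ) • basisVec 0 + (ρ * Real.sin φ) • basisVec 1 := by
  ext i; fin_cases i <;> simp [basisVec, pol]

theorem pol_add_pi (ρ φ : ℝ) : pol ρ (φ + Real.pi) = - pol ρ φ := by
  ext i; fin_cases i <;> simp [pol]

theorem pol_add_two_pi (ρ φ : ℝ) : pol ρ (φ + 2 * Real.pi) = pol ρ φ := by
  ext i; fin_cases i <;> simp [pol]

theorem hasDerivAt_pol_rad (ρ φ : ℝ) : HasDerivAt (fun ρ => pol ρ φ) (pol 1 φ) ρ := by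
  simp_rw [pol_eq]
  have := (((hasDerivAt_id ρ).mul_const (Real.cos φ)).smul_const (basisVec 0)).add
    (((hasDerivAt_id ρ).mul_const (Real.sin φ)).smul_const (basisVec 1))
  exact this

theorem hasDerivAt_pol_ang (ρ φ : ℝ) : HasDerivAt (fun φ => pol ρ φ)
    ((ρ * -Real.sin φ) • basisVec 0 + (ρ * Real.cos φ) • basisVec 1) φ := by
  simp_rw [pol_eq]
  have := (((Real.hasDerivAt_cos φ).const_mul ρ).smul_const (basisVec 0)).add
    (((Real.hasDerivAt_sin φ).const_mul ρ).smul_const (basisVec 1))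
  exact this

theorem rot_norm (u v : ℂ) (φ : ℝ) :
    ‖(Real.cos φ : ℂ) * u + (Real.sin φ : ℂ) * v‖ ^ 2 +
      ‖-(Real.sin φ : ℂ) * u + (Real.cos φ : ℂ) * v‖ ^ 2 = ‖u‖ ^ 2 + ‖v‖ ^ 2 := by
  have := Real.sin_sq_add_cos_sq φ
  generalize Real.cos φ = c at *
  generalize Real.sin φ = s at *
  simp only [← Complex.normSq_eq_norm_sq, Complex.normSq_apply]
  simp
  linear_combination (u.re ^ 2 + u.im ^ 2 + v.re ^ 2 + v.im ^ 2) * this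

section
variable {w : E2 → ℂ} {d : Fin 2 → E2 → ℂ} {a : Fin 2 → E2 → ℝ}

/-- radial covariant derivative -/
def drad (d : Fin 2 → E2 → ℂ) (ρ φ : ℝ) : ℂ :=
  (Real.cos φ : ℂ) * d 0 (pol ρ φ) + (Real.sin φ : ℂ) * d 1 (pol ρ φ)

/-- angular covariant derivative -/
def dang (d : Fin 2 → E2 → ℂ) (ρ φ : ℝ) : ℂ :=
  -(Real.sin φ : ℂ) * d 0 (pol ρ φ) + (Real.cos φ : ℂ) * d 1 (pol ρ φ)

theorem continuous_drad (hd : ∀ c, Continuous (d c)) :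
    Continuous fun p : ℝ × ℝ => drad d p.1 p.2 := by
  have h0 : Continuous fun p : ℝ × ℝ => d 0 (pol p.1 p.2) := (hd 0).comp continuous_pol
  have h1 : Continuous fun p : ℝ × ℝ => d 1 (pol p.1 p.2) := (hd 1).comp continuous_pol
  exact (Continuous.mul (by fun_prop) h0).add (Continuous.mul (by fun_prop) h1)

theorem continuous_dang (hd : ∀ c, Continuous (d c)) :
    Continuous fun p : ℝ × ℝ => dang d p.1 p.2 := by
  have h0 : Continuous fun p : ℝ × ℝ => d 0 (pol p.1 p.2) := (hd 0).comp continuous_pol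
  have h1 : Continuous fun p : ℝ × ℝ => d 1 (pol p.1 p.2) := (hd 1).comp continuous_pol
  exact (Continuous.mul (by fun_prop) h0).add (Continuous.mul (by fun_prop) h1)

theorem hasDerivAt_rad (hw : Differentiable ℝ w)
    (h : ∀ c x, d c x = -Complex.I * fderiv ℝ w x (basisVec c) + (a c x : ℝ) * w x) (ρ φ : ℝ) :
    HasDerivAt (fun ρ => w (pol ρ φ)) (Complex.I * (drad d ρ φ -
      ((Real.cos φ * a 0 (pol ρ φ) + Real.sin φ * a 1 (pol ρ φ) : ℝ) : ℂ) * w (pol ρ φ))) ρ := by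
  have := (hw (pol ρ φ)).hasFDerivAt.comp_hasDerivAt ρ (hasDerivAt_pol_rad ρ φ)
  refine this.congr_deriv ?_
  rw [pol_eq 1 φ, map_add, map_smul, map_smul, fderiv_eq_of_cov (h 0 (pol ρ φ)),
    fderiv_eq_of_cov (h 1 (pol ρ φ))]
  simp only [drad, Complex.real_smul]
  push_cast
  ring

theorem hasDerivAt_ang (hw : Differentiable ℝ w)
    (h : ∀ c x, d c x = -Complex.I * fderiv ℝ w x (basisVec c) + (a c x : ℝ) * w x) (ρ φ : ℝ) :
    HasDerivAt (fun φ => w (pol ρ φ)) (Complex.I * ((ρ : ℂ) * dang d ρ φ -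
      ((ρ * (-Real.sin φ * a 0 (pol ρ φ) + Real.cos φ * a 1 (pol ρ φ)) : ℝ) : ℂ) * w (pol ρ φ))) φ := by
  have := (hw (pol ρ φ)).hasFDerivAt.comp_hasDerivAt φ (hasDerivAt_pol_ang ρ φ)
  refine this.congr_deriv ?_
  rw [map_add, map_smul, map_smul, fderiv_eq_of_cov (h 0 (pol ρ φ)),
    fderiv_eq_of_cov (h 1 (pol ρ φ))]
  simp only [dang, Complex.real_smul]
  push_cast
  ring
end


theorem deriv_F (ν R ρ : ℝ) (hR : 0 < R) :
    HasDerivAt (fun ρ => ν / 36 * (1 + 2 * (R ^ 2 / (R ^ 2 + ρ ^ 2))))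
      (ν / 36 * (2 * (-(R ^ 2 * (2 * ρ)) / (R ^ 2 + ρ ^ 2) ^ 2))) ρ := by
  have h1 : HasDerivAt (fun ρ : ℝ => R ^ 2 + ρ ^ 2) (2 * ρ) ρ := by
    simpa using ((hasDerivAt_pow 2 ρ).const_add (R ^ 2))
  have h2 := (hasDerivAt_const ρ (R ^ 2)).div h1 (by positivity)
  have h3 := ((h2.const_mul 2).const_add 1).const_mul (ν / 36)
  refine h3.congr_deriv ?_
  simp

theorem F_ineq2 {α ρ R : ℝ} (h0 : 0 ≤ α) (h2 : α ≤ 2) (hR : 0 < R) (hρ : 0 < ρ) :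
    |α - 1| / 36 * (2 * (-(R ^ 2 * (2 * ρ)) / (R ^ 2 + ρ ^ 2) ^ 2)) +
      (|α - 1| / 36 * (1 + 2 * (R ^ 2 / (R ^ 2 + ρ ^ 2)))) ^ 2 / ρ ≤
      (1 - α * min 1 (ρ ^ 2 / R ^ 2)) ^ 2 / 5 / ρ := by
  have h := Fineq h0 h2 (s := ρ ^ 2 / R ^ 2) (by positivity)
  have e1 : 2 / (1 + ρ ^ 2 / R ^ 2) = 2 * (R ^ 2 / (R ^ 2 + ρ ^ 2)) := by field_simp
  have e2 : (ρ ^ 2 / R ^ 2) / (1 + ρ ^ 2 / R ^ 2) ^ 2 = R ^ 2 * ρ ^ 2 / (R ^ 2 + ρ ^ 2) ^ 2 := by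
    field_simp
  rw [e1, e2] at h
  have e3 : |α - 1| / 36 * (2 * (-(R ^ 2 * (2 * ρ)) / (R ^ 2 + ρ ^ 2) ^ 2)) =
      -(|α - 1| / 9 * (R ^ 2 * ρ ^ 2 / (R ^ 2 + ρ ^ 2) ^ 2)) / ρ := by field_simp; ring
  rw [e3, ← add_div]
  gcongr
  have : (0 : ℝ) ≤ (1 - α * min 1 (ρ ^ 2 / R ^ 2)) ^ 2 := sq_nonneg _
  linarith

theorem sec_left {X : Type*} [TopologicalSpace X] {g : ℝ → ℝ → X}
    (h : Continuous fun p : ℝ × ℝ => g p.1 p.2) (ρ : ℝ) : Continuous fun φ => g ρ φ :=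
  h.comp (Continuous.prodMk continuous_const continuous_id)

theorem sec_right {X : Type*} [TopologicalSpace X] {g : ℝ → ℝ → X}
    (h : Continuous fun p : ℝ × ℝ => g p.1 p.2) (φ : ℝ) : Continuous fun ρ => g ρ φ :=
  h.comp (Continuous.prodMk continuous_id continuous_const)

theorem cont_pol {X : Type*} [TopologicalSpace X] {f : E2 → X} (hf : Continuous f) :
    Continuous fun p : ℝ × ℝ => f (pol p.1 p.2) := hf.comp continuous_pol

theorem cont_pol_left {X : Type*} [TopologicalSpace X] {f : E2 → X} (hf : Continuous f) (ρ : ℝ) :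
    Continuous fun φ => f (pol ρ φ) := sec_left (g := fun ρ φ => f (pol ρ φ)) (cont_pol hf) ρ

theorem cont_pol_right {X : Type*} [TopologicalSpace X] {f : E2 → X} (hf : Continuous f) (φ : ℝ) :
    Continuous fun ρ => f (pol ρ φ) := sec_right (g := fun ρ φ => f (pol ρ φ)) (cont_pol hf) φ

section
variable {w : E2 → ℂ} {d : Fin 2 → E2 → ℂ} {a : Fin 2 → E2 → ℝ}

theorem radial (hw : Differentiable ℝ w) (hd : ∀ c, Continuous (d c))
    (h : ∀ c x, d c x = -Complex.I * fderiv ℝ w x (basisVec c) + (a c x : ℝ) * w x)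
    {F F' : ℝ → ℝ} (hFd : ∀ ρ, HasDerivAt F (F' ρ) ρ) (cF' : Continuous F') (hF0 : ∀ ρ, 0 ≤ F ρ)
    {ρ1 ρ2 : ℝ} (h1 : 0 < ρ1) (h12 : ρ1 ≤ ρ2) (φ : ℝ) :
    F ρ2 * ‖w (pol ρ2 φ)‖ ^ 2 - F ρ1 * ‖w (pol ρ1 φ)‖ ^ 2 ≤
      ∫ ρ in ρ1..ρ2, ((F' ρ + F ρ ^ 2 / max ρ ρ1) * ‖w (pol ρ φ)‖ ^ 2 +
        ρ * ‖drad d ρ φ‖ ^ 2) := by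
  have cF : Continuous F := continuous_iff_continuousAt.2 fun s => (hFd s).continuousAt
  have cφ1 : Continuous fun ρ => w (pol ρ φ) :=
    cont_pol_right hw.continuous φ
  have cφ2 : Continuous fun ρ => drad d ρ φ :=
    sec_right (g := drad d) (continuous_drad hd) φ
  have hder : ∀ ρ, HasDerivAt (fun ρ => F ρ * ‖w (pol ρ φ)‖ ^ 2)
      (F' ρ * ‖w (pol ρ φ)‖ ^ 2 +
        F ρ * (2 * inner ℝ (w (pol ρ φ)) (Complex.I * drad d ρ φ))) ρ := fun ρ =>
    (hFd ρ).mul (cov_hasDerivAt (hasDerivAt_rad hw h ρ φ))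
  have cder : Continuous fun ρ => (F' ρ * ‖w (pol ρ φ)‖ ^ 2 +
      F ρ * (2 * inner ℝ (w (pol ρ φ)) (Complex.I * drad d ρ φ))) :=
    (cF'.mul (cφ1.norm.pow 2)).add
      (cF.mul (continuous_const.mul (cφ1.inner (continuous_const.mul cφ2))))
  have cm : Continuous fun ρ : ℝ => F ρ ^ 2 / max ρ ρ1 :=
    Continuous.div (by fun_prop) (by fun_prop) fun p => (lt_max_of_lt_right h1).ne'
  have cg : Continuous fun ρ => (F' ρ + F ρ ^ 2 / max ρ ρ1) * ‖w (pol ρ φ)‖ ^ 2 +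
        ρ * ‖drad d ρ φ‖ ^ 2 :=
    ((cF'.add cm).mul (cφ1.norm.pow 2)).add (continuous_id.mul (cφ2.norm.pow 2))
  rw [← intervalIntegral.integral_eq_sub_of_hasDerivAt (fun ρ _ => hder ρ)
    (cder.intervalIntegrable _ _)]
  apply intervalIntegral.integral_mono_on h12 (cder.intervalIntegrable _ _)
    (cg.intervalIntegrable _ _)
  intro ρ hρ
  have hρ0 : 0 < ρ := h1.trans_le hρ.1
  rw [max_eq_left hρ.1]
  have hb := (le_abs_self _).trans (cov_bound (w (pol ρ φ)) (drad d ρ φ))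
  have h3 := mul_le_mul_of_nonneg_left hb (hF0 ρ)
  generalize ‖w (pol ρ φ)‖ = A at *
  generalize ‖drad d ρ φ‖ = B at *
  have h4 : F ρ * (2 * A * B) ≤ F ρ ^ 2 / ρ * A ^ 2 + ρ * B ^ 2 := by
    have : F ρ ^ 2 / ρ * A ^ 2 + ρ * B ^ 2 - F ρ * (2 * A * B) = (F ρ * A - ρ * B) ^ 2 / ρ := by
      field_simp; ring
    have h5 : 0 ≤ (F ρ * A - ρ * B) ^ 2 / ρ := by positivity
    linarith
  linarith

theorem angpart (hw : Differentiable ℝ w) (hd : ∀ c, Continuous (d c)) (ha : ∀ c, Continuous (a c))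
    (h : ∀ c x, d c x = -Complex.I * fderiv ℝ w x (basisVec c) + (a c x : ℝ) * w x)
    (hodd : ∀ x, w (-x) = - w x) {ρ t : ℝ} (hρ0 : 0 < ρ) (ht0 : 0 ≤ t) (ht2 : t ≤ 2)
    (hflux : ∀ φ, ∫ s in φ..(φ + Real.pi),
      ρ * (-Real.sin s * a 0 (pol ρ s) + Real.cos s * a 1 (pol ρ s)) = Real.pi * t)
    {K : ℝ} (hK : K ≤ (1 - t) ^ 2 / 5 / ρ) :
    (∫ φ in (-Real.pi)..Real.pi, (K * ‖w (pol ρ φ)‖ ^ 2 + ρ * ‖drad d ρ φ‖ ^ 2)) ≤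
      ρ * ∫ φ in (-Real.pi)..Real.pi, ∑ c, ‖d c (pol ρ φ)‖ ^ 2 := by
  have hpi := Real.pi_pos
  have cι : Continuous fun φ : ℝ => (ρ, φ) := by fun_prop
  have cWρ : Continuous fun φ => w (pol ρ φ) := cont_pol_left hw.continuous ρ
  have crρ : Continuous fun φ => drad d ρ φ := sec_left (g := drad d) (continuous_drad hd) ρ
  have caρ : Continuous fun φ => dang d ρ φ := sec_left (g := dang d) (continuous_dang hd) ρ
  have ci : ∀ c, Continuous fun φ => a c (pol ρ φ) := fun c =>
    cont_pol_left (ha c) ρ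
  have k2 := angular (z := fun φ => w (pol ρ φ)) (δ := fun φ => (ρ : ℂ) * dang d ρ φ)
    (fun φ => hasDerivAt_ang hw h ρ φ) (continuous_const.mul caρ)
    (continuous_const.mul ((Real.continuous_sin.neg.mul (ci 0)).add (Real.continuous_cos.mul (ci 1))))
    (fun φ => by simp only [pol_add_pi, hodd]) ht0 ht2 hflux
    (fun φ => by simp only [dang, pol_add_two_pi, Real.sin_add_two_pi, Real.cos_add_two_pi])
  have e1 : (fun φ => ‖(ρ : ℂ) * dang d ρ φ‖ ^ 2) = fun φ => ρ ^ 2 * ‖dang d ρ φ‖ ^ 2 := by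
    ext φ; rw [norm_mul, mul_pow, Complex.norm_real, Real.norm_eq_abs, sq_abs]
  rw [e1, intervalIntegral.integral_const_mul] at k2
  have e2 : (fun φ => ∑ c, ‖d c (pol ρ φ)‖ ^ 2) = fun φ => ‖drad d ρ φ‖ ^ 2 + ‖dang d ρ φ‖ ^ 2 := by
    ext φ; rw [Fin.sum_univ_two]; exact (rot_norm _ _ _).symm
  have j1 : IntervalIntegrable (fun φ => ‖drad d ρ φ‖ ^ 2) volume (-Real.pi) Real.pi :=
    (crρ.norm.pow 2).intervalIntegrable _ _
  have j2 : IntervalIntegrable (fun φ => ‖dang d ρ φ‖ ^ 2) volume (-Real.pi) Real.pi :=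
    (caρ.norm.pow 2).intervalIntegrable _ _
  have j3 : IntervalIntegrable (fun φ => ‖w (pol ρ φ)‖ ^ 2) volume (-Real.pi) Real.pi :=
    (cWρ.norm.pow 2).intervalIntegrable _ _
  have hH : 0 ≤ ∫ φ in (-Real.pi)..Real.pi, ‖w (pol ρ φ)‖ ^ 2 :=
    intervalIntegral.integral_nonneg (by linarith) fun _ _ => by positivity
  rw [e2, intervalIntegral.integral_add j1 j2,
    intervalIntegral.integral_add (j3.const_mul _) (j1.const_mul _),
    intervalIntegral.integral_const_mul, intervalIntegral.integral_const_mul]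
  generalize (∫ φ in (-Real.pi)..Real.pi, ‖w (pol ρ φ)‖ ^ 2) = Hh at *
  generalize (∫ φ in (-Real.pi)..Real.pi, ‖drad d ρ φ‖ ^ 2) = DR at *
  generalize (∫ φ in (-Real.pi)..Real.pi, ‖dang d ρ φ‖ ^ 2) = DA at *
  have k3 := mul_le_mul_of_nonneg_right hK hH
  have k4 : (1 - t) ^ 2 / 5 / ρ * Hh ≤ ρ * DA := by
    rw [div_div, div_mul_eq_mul_div, div_le_iff₀ (by positivity)]
    linarith
  linarith

theorem annulus (hw : Differentiable ℝ w) (hd : ∀ c, Continuous (d c)) (ha : ∀ c, Continuous (a c))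
    (h : ∀ c x, d c x = -Complex.I * fderiv ℝ w x (basisVec c) + (a c x : ℝ) * w x)
    (hodd : ∀ x, w (-x) = - w x) {R α D : ℝ} (hR : 0 < R) (h0 : 0 ≤ α) (h2 : α ≤ 2)
    (hflux : ∀ ρ, 0 < ρ → ρ ≤ D → ∀ φ, ∫ s in φ..(φ + Real.pi),
      ρ * (-Real.sin s * a 0 (pol ρ s) + Real.cos s * a 1 (pol ρ s)) =
        Real.pi * (α * min 1 (ρ ^ 2 / R ^ 2)))
    {ρ1 ρ2 : ℝ} (h1 : 0 < ρ1) (h12 : ρ1 ≤ ρ2) (h2D : ρ2 ≤ D) :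
    |α - 1| / 36 * (1 + 2 * (R ^ 2 / (R ^ 2 + ρ2 ^ 2))) *
        (∫ φ in (-Real.pi)..Real.pi, ‖w (pol ρ2 φ)‖ ^ 2) -
      |α - 1| / 36 * (1 + 2 * (R ^ 2 / (R ^ 2 + ρ1 ^ 2))) *
        (∫ φ in (-Real.pi)..Real.pi, ‖w (pol ρ1 φ)‖ ^ 2) ≤
      ∫ ρ in ρ1..ρ2, ρ * ∫ φ in (-Real.pi)..Real.pi, ∑ c, ‖d c (pol ρ φ)‖ ^ 2 := by
  have hpi := Real.pi_pos
  have hwc := hw.continuous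
  set F : ℝ → ℝ := fun ρ => |α - 1| / 36 * (1 + 2 * (R ^ 2 / (R ^ 2 + ρ ^ 2))) with hF
  set F' : ℝ → ℝ := fun ρ => |α - 1| / 36 * (2 * (-(R ^ 2 * (2 * ρ)) / (R ^ 2 + ρ ^ 2) ^ 2)) with hF'
  have hFd : ∀ ρ, HasDerivAt F (F' ρ) ρ := fun ρ => deriv_F _ _ _ hR
  have cF : Continuous F := continuous_iff_continuousAt.2 fun s => (hFd s).continuousAt
  have cF' : Continuous F' := by
    have : ∀ ρ : ℝ, (R ^ 2 + ρ ^ 2) ^ 2 ≠ 0 := fun ρ => by positivity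
    exact continuous_const.mul (continuous_const.mul (Continuous.div (by fun_prop) (by fun_prop) this))
  have cW : Continuous fun p : ℝ × ℝ => w (pol p.1 p.2) := hwc.comp continuous_pol
  have cr := continuous_drad hd
  have ca := continuous_dang hd
  set g : ℝ → ℝ → ℝ := fun ρ φ => (F' ρ + F ρ ^ 2 / max ρ ρ1) * ‖w (pol ρ φ)‖ ^ 2 +
    ρ * ‖drad d ρ φ‖ ^ 2 with hg
  have cg : Continuous fun p : ℝ × ℝ => g p.1 p.2 := by
    have cm : Continuous fun p : ℝ × ℝ => F p.1 ^ 2 / max p.1 ρ1 :=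
      Continuous.div (by fun_prop) (by fun_prop) fun p => (lt_max_of_lt_right h1).ne'
    exact ((Continuous.add (by fun_prop) cm).mul (cW.norm.pow 2)).add
      (continuous_fst.mul (cr.norm.pow 2))
  have cWρ : ∀ ρ, Continuous fun φ => w (pol ρ φ) := fun ρ =>
    cont_pol_left hwc ρ
  have rad : ∀ φ, F ρ2 * ‖w (pol ρ2 φ)‖ ^ 2 - F ρ1 * ‖w (pol ρ1 φ)‖ ^ 2 ≤ ∫ ρ in ρ1..ρ2, g ρ φ :=
    fun φ => radial hw hd h hFd cF' (fun ρ => by simp only [hF]; positivity) h1 h12 φ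
  have swapped := swap_cont cg ρ1 ρ2 (-Real.pi) Real.pi
  have i1 : ∀ ρ, IntervalIntegrable (fun φ => F ρ * ‖w (pol ρ φ)‖ ^ 2) volume (-Real.pi) Real.pi :=
    fun ρ => (continuous_const.mul ((cWρ ρ).norm.pow 2)).intervalIntegrable _ _
  have cgi : Continuous fun φ => ∫ ρ in ρ1..ρ2, g ρ φ :=
    intervalIntegral.continuous_parametric_intervalIntegral_of_continuous'
      (f := fun φ ρ => g ρ φ) (cg.comp continuous_swap) _ _
  have cgi' : Continuous fun ρ => ∫ φ in (-Real.pi)..Real.pi, g ρ φ :=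
    intervalIntegral.continuous_parametric_intervalIntegral_of_continuous'
      (f := fun ρ φ => g ρ φ) cg _ _
  have st1 : F ρ2 * (∫ φ in (-Real.pi)..Real.pi, ‖w (pol ρ2 φ)‖ ^ 2) -
      F ρ1 * (∫ φ in (-Real.pi)..Real.pi, ‖w (pol ρ1 φ)‖ ^ 2) ≤
      ∫ φ in (-Real.pi)..Real.pi, ∫ ρ in ρ1..ρ2, g ρ φ := by
    rw [← intervalIntegral.integral_const_mul, ← intervalIntegral.integral_const_mul,
      ← intervalIntegral.integral_sub (i1 ρ2) (i1 ρ1)]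
    exact intervalIntegral.integral_mono_on (by linarith) ((i1 ρ2).sub (i1 ρ1))
      (cgi.intervalIntegrable _ _) fun φ _ => rad φ
  refine st1.trans ?_
  rw [← swapped]
  have ce : Continuous fun p : ℝ × ℝ => ∑ c, ‖d c (pol p.1 p.2)‖ ^ 2 :=
    continuous_finsetSum _ fun c _ => ((hd c).comp continuous_pol).norm.pow 2
  have cE : Continuous fun ρ => ∫ φ in (-Real.pi)..Real.pi, ∑ c, ‖d c (pol ρ φ)‖ ^ 2 :=
    intervalIntegral.continuous_parametric_intervalIntegral_of_continuous'
      (f := fun ρ φ => ∑ c, ‖d c (pol ρ φ)‖ ^ 2) ce _ _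
  apply intervalIntegral.integral_mono_on h12 (cgi'.intervalIntegrable _ _)
    ((continuous_id.mul cE).intervalIntegrable _ _)
  intro ρ hρ
  have hρ0 : 0 < ρ := h1.trans_le hρ.1
  have k1 := F_ineq2 h0 h2 hR hρ0
  have k2 := angpart hw hd ha h hodd hρ0 (t := α * min 1 (ρ ^ 2 / R ^ 2))
    (by positivity) (by
      have : min 1 (ρ ^ 2 / R ^ 2) ≤ 1 := min_le_left _ _
      have h' : 0 ≤ min 1 (ρ ^ 2 / R ^ 2) := by positivity
      nlinarith) (hflux ρ hρ0 (hρ.2.trans h2D)) k1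
  simp only [hg]
  rw [max_eq_left hρ.1]
  exact k2
end


theorem disc {w : E2 → ℂ} {d : Fin 2 → E2 → ℂ} {a : Fin 2 → E2 → ℝ}
    (hw : Differentiable ℝ w) (hd : ∀ c, Continuous (d c)) (ha : ∀ c, Continuous (a c))
    (h : ∀ c x, d c x = -Complex.I * fderiv ℝ w x (basisVec c) + (a c x : ℝ) * w x)
    (hodd : ∀ x, w (-x) = - w x) {R α D : ℝ} (hR : 0 < R) (h0 : 0 ≤ α) (h2 : α ≤ 2)
    (hD : 0 < D)
    (hflux : ∀ ρ, 0 < ρ → ρ ≤ D → ∀ φ, ∫ s in φ..(φ + Real.pi),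
      ρ * (-Real.sin s * a 0 (pol ρ s) + Real.cos s * a 1 (pol ρ s)) =
        Real.pi * (α * min 1 (ρ ^ 2 / R ^ 2))) :
    ENNReal.ofReal |α - 1| * ∫⁻ x in Metric.ball (0 : E2) D, ENNReal.ofReal (‖w x‖ ^ 2) ≤
      ENNReal.ofReal (18 * D ^ 2) *
        ∫⁻ x in Metric.ball (0 : E2) D, ENNReal.ofReal (∑ c, ‖d c x‖ ^ 2) := by
  have hpi := Real.pi_pos
  have cw : Continuous fun x => ‖w x‖ ^ 2 := hw.continuous.norm.pow 2
  have ce : Continuous fun x => ∑ c, ‖d c x‖ ^ 2 :=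
    continuous_finsetSum _ fun c _ => (hd c).norm.pow 2
  rw [polar_ball cw (fun _ => by positivity) hD, polar_ball ce (fun _ => by positivity) hD,
    ← ENNReal.ofReal_mul (by positivity), ← ENNReal.ofReal_mul (by positivity)]
  apply ENNReal.ofReal_le_ofReal
  set H : ℝ → ℝ := fun ρ => ∫ φ in (-Real.pi)..Real.pi, ‖w (pol ρ φ)‖ ^ 2 with hH
  set K : ℝ → ℝ := fun ρ => ∫ φ in (-Real.pi)..Real.pi, ∑ c, ‖d c (pol ρ φ)‖ ^ 2 with hK
  have cH : Continuous H :=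
    intervalIntegral.continuous_parametric_intervalIntegral_of_continuous'
      (f := fun ρ φ => ‖w (pol ρ φ)‖ ^ 2) (cont_pol cw) _ _
  have cK : Continuous K :=
    intervalIntegral.continuous_parametric_intervalIntegral_of_continuous'
      (f := fun ρ φ => ∑ c, ‖d c (pol ρ φ)‖ ^ 2) (cont_pol ce) _ _
  have H0 : ∀ ρ, 0 ≤ H ρ := fun ρ =>
    intervalIntegral.integral_nonneg (by linarith) fun _ _ => by positivity
  have K0 : ∀ ρ, 0 ≤ K ρ := fun ρ =>
    intervalIntegral.integral_nonneg (by linarith) fun _ _ => by positivity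
  set En := ∫ ρ in (0 : ℝ)..D, ρ * K ρ with hEn
  have iK : ∀ p q, IntervalIntegrable (fun ρ => ρ * K ρ) volume p q := fun p q =>
    (continuous_id.mul cK).intervalIntegrable _ _
  have w0 : w 0 = 0 := by
    have := hodd 0
    rw [neg_zero] at this
    exact self_eq_neg.1 this
  have Hz : H 0 = 0 := by
    have : ∀ φ, pol 0 φ = 0 := fun φ => by ext i; fin_cases i <;> simp [pol]
    simp [hH, this, w0]
  set F : ℝ → ℝ := fun ρ => |α - 1| / 36 * (1 + 2 * (R ^ 2 / (R ^ 2 + ρ ^ 2))) with hF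
  have cF : Continuous F :=
    continuous_iff_continuousAt.2 fun s => (deriv_F _ _ s hR).continuousAt
  have key : ∀ ρ2, 0 < ρ2 → ρ2 ≤ D → F ρ2 * H ρ2 ≤ En := by
    intro ρ2 hρ2 hρD
    have ev : ∀ᶠ ρ1 in nhdsWithin (0 : ℝ) (Set.Ioi 0), F ρ2 * H ρ2 - F ρ1 * H ρ1 ≤ En := by
      have : Set.Ioo (0 : ℝ) ρ2 ∈ nhdsWithin (0 : ℝ) (Set.Ioi 0) := Ioo_mem_nhdsGT hρ2
      filter_upwards [this] with ρ1 hρ1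
      refine (annulus hw hd ha h hodd hR h0 h2 hflux hρ1.1 hρ1.2.le hρD).trans ?_
      refine intervalIntegral.integral_mono_interval hρ1.1.le hρ1.2.le hρD ?_ (iK _ _)
      refine (ae_restrict_iff' measurableSet_Ioc).2 (Filter.Eventually.of_forall fun ρ hρ => ?_)
      exact mul_nonneg hρ.1.le (K0 ρ)
    have lim : Filter.Tendsto (fun ρ1 => F ρ2 * H ρ2 - F ρ1 * H ρ1)
        (nhdsWithin (0 : ℝ) (Set.Ioi 0)) (nhds (F ρ2 * H ρ2 - F 0 * H 0)) :=
      ((continuous_const.sub (cF.mul cH)).tendsto 0).mono_left nhdsWithin_le_nhds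
    rw [Hz, mul_zero, sub_zero] at lim
    exact le_of_tendsto lim ev
  have key2 : ∀ ρ ∈ Set.Icc 0 D, |α - 1| * (ρ * H ρ) ≤ 36 * En * ρ := by
    intro ρ hρ
    rcases hρ.1.eq_or_lt with h' | h'
    · rw [← h']; simp
    · have k := key ρ h' hρ.2
      have k2 : |α - 1| / 36 * H ρ ≤ F ρ * H ρ := by
        apply mul_le_mul_of_nonneg_right _ (H0 ρ)
        simp only [hF]
        have : 0 ≤ |α - 1| / 36 * (2 * (R ^ 2 / (R ^ 2 + ρ ^ 2))) := by positivity
        linarith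
      have k3 : |α - 1| * H ρ ≤ 36 * En := by linarith
      have := mul_le_mul_of_nonneg_right k3 h'.le
      linarith
  have fin := intervalIntegral.integral_mono_on (a := 0) (b := D) (μ := volume)
    (f := fun ρ => |α - 1| * (ρ * H ρ)) (g := fun ρ => 36 * En * ρ) hD.le
    ((continuous_const.mul (continuous_id.mul cH)).intervalIntegrable _ _)
    ((continuous_const.mul continuous_id).intervalIntegrable _ _) key2
  rw [intervalIntegral.integral_const_mul, intervalIntegral.integral_const_mul, integral_id] at fin
  linarith


theorem arctan_deriv {z0 z1 : ℝ → ℝ} {a0 a1 v0 v1 s : ℝ} (h0 : HasDerivAt z0 a0 s)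
    (h1 : HasDerivAt z1 a1 s) (hp : 0 < v0 * z0 s + v1 * z1 s) :
    HasDerivAt (fun s => Real.arctan ((v0 * z1 s - v1 * z0 s) / (v0 * z0 s + v1 * z1 s)))
      ((z0 s * a1 - z1 s * a0) / (z0 s ^ 2 + z1 s ^ 2)) s := by
  have hn := ((h1.const_mul v0).sub (h0.const_mul v1)).fun_div
    ((h0.const_mul v0).add (h1.const_mul v1)) hp.ne'
  refine hn.arctan.congr_deriv ?_
  simp only [Pi.sub_apply, Pi.add_apply]
  generalize z0 s = x at *
  generalize z1 s = y at *
  have hv : 0 < v0 ^ 2 + v1 ^ 2 := by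
    rcases eq_or_ne v0 0 with h | h
    · rcases eq_or_ne v1 0 with h' | h'
      · simp [h, h'] at hp
      · positivity
    · positivity
  have hz : 0 < x ^ 2 + y ^ 2 := by
    rcases eq_or_ne x 0 with h | h
    · rcases eq_or_ne y 0 with h' | h'
      · simp [h, h'] at hp
      · positivity
    · positivity
  have hs : 1 + ((v0 * y - v1 * x) / (v0 * x + v1 * y)) ^ 2 =
      (v0 ^ 2 + v1 ^ 2) * (x ^ 2 + y ^ 2) / (v0 * x + v1 * y) ^ 2 := by
    have := hp.ne'
    rw [eq_div_iff (by positivity), div_pow, add_mul, div_mul_cancel₀ _ (by positivity)]; ring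
  rw [hs]
  field_simp
  ring

theorem normsq2 (x : E2) : ‖x‖ ^ 2 = x 0 ^ 2 + x 1 ^ 2 := by
  rw [EuclideanSpace.norm_sq_eq]; simp

theorem bR_far {R : ℝ} {x : E2} (h : R ≤ ‖x‖) (a b : ℝ) :
    bR R x 0 * a + bR R x 1 * b = (x 0 * b - x 1 * a) / (x 0 ^ 2 + x 1 ^ 2) := by
  have : regNorm R x = ‖x‖ := max_eq_left h
  simp only [bR, this, PiLp.smul_apply, smul_eq_mul, perp_0, perp_1, normsq2]
  rw [div_eq_inv_mul]; ring

theorem bR_neg (R : ℝ) (x : E2) : bR R (-x) = - bR R x := by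
  have : perp (-x) = - perp x := by ext i; fin_cases i <;> simp [perp]
  simp [bR, regNorm, this]

theorem bR_pol {R : ℝ} (hR : 0 < R) {ρ : ℝ} (hρ : 0 < ρ) (s : ℝ) :
    ρ * (-Real.sin s * bR R (pol ρ s) 0 + Real.cos s * bR R (pol ρ s) 1) =
      min 1 (ρ ^ 2 / R ^ 2) := by
  have h1 : regNorm R (pol ρ s) = max ρ R := by rw [regNorm, norm_pol, abs_of_pos hρ]
  have p0 : pol ρ s 0 = ρ * Real.cos s := by simp [pol]
  have p1 : pol ρ s 1 = ρ * Real.sin s := by simp [pol]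
  simp only [bR, h1, PiLp.smul_apply, smul_eq_mul, perp_0, perp_1, p0, p1]
  have : ρ * (-Real.sin s * ((max ρ R ^ 2)⁻¹ * -(ρ * Real.sin s)) +
      Real.cos s * ((max ρ R ^ 2)⁻¹ * (ρ * Real.cos s))) = ρ ^ 2 / max ρ R ^ 2 := by
    rw [div_eq_mul_inv]
    linear_combination (ρ ^ 2 * (max ρ R ^ 2)⁻¹) * Real.sin_sq_add_cos_sq s
  rw [this]
  rcases le_total ρ R with h | h
  · rw [max_eq_right h, min_eq_right]
    rw [div_le_one (by positivity)]; gcongr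
  · rw [max_eq_left h, min_eq_left, div_self (by positivity)]
    rw [one_le_div (by positivity)]; gcongr

/-- The vector from a far away particle to the moving one never turns by more than a right angle. -/
theorem inner_far {v r : E2} (h : ‖r‖ < ‖v‖) : 0 < v 0 * (v + r) 0 + v 1 * (v + r) 1 := by
  have h1 : |inner ℝ v r| ≤ ‖v‖ * ‖r‖ := abs_real_inner_le_norm v r
  have h2 : inner ℝ v r = v 0 * r 0 + v 1 * r 1 := by
    simp [PiLp.inner_apply, mul_comm]
  have h3 := normsq2 v
  have h4 : 0 < ‖v‖ := (norm_nonneg r).trans_lt h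
  simp only [PiLp.add_apply]
  have h5 := abs_le.1 h1
  nlinarith [mul_pos h4 (sub_pos.2 h)]

theorem flux_far {R : ℝ} (hR : 0 < R) {v : E2} {ρ : ℝ} (hρ : 0 < ρ) (h : R + ρ ≤ ‖v‖) (φ : ℝ) :
    ∫ s in φ..(φ + Real.pi), ρ * (-Real.sin s *
        ((bR R (v + (2:ℝ)⁻¹ • pol ρ s) 0 - bR R (v - (2:ℝ)⁻¹ • pol ρ s) 0) / 2) +
      Real.cos s *
        ((bR R (v + (2:ℝ)⁻¹ • pol ρ s) 1 - bR R (v - (2:ℝ)⁻¹ • pol ρ s) 1) / 2)) = 0 := by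
  have nr : ∀ s, ‖(2:ℝ)⁻¹ • pol ρ s‖ = ρ / 2 := fun s => by
    rw [norm_smul, norm_pol, abs_of_pos hρ]; norm_num; ring
  have key : ∀ (σ : ℝ), |σ| = 1 → ∀ s, HasDerivAt (fun s => Real.arctan
      ((v 0 * (v 1 + σ * (ρ * Real.sin s / 2)) - v 1 * (v 0 + σ * (ρ * Real.cos s / 2))) /
        (v 0 * (v 0 + σ * (ρ * Real.cos s / 2)) + v 1 * (v 1 + σ * (ρ * Real.sin s / 2)))))
      (bR R (v + σ • (2:ℝ)⁻¹ • pol ρ s) 0 * (σ * (ρ * -Real.sin s / 2)) +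
        bR R (v + σ • (2:ℝ)⁻¹ • pol ρ s) 1 * (σ * (ρ * Real.cos s / 2))) s := by
    intro σ hσ s
    have n1 : ‖σ • (2:ℝ)⁻¹ • pol ρ s‖ = ρ / 2 := by rw [norm_smul, nr, Real.norm_eq_abs, hσ, one_mul]
    have n2 : R ≤ ‖v + σ • (2:ℝ)⁻¹ • pol ρ s‖ := by
      have := norm_sub_le (v + σ • (2:ℝ)⁻¹ • pol ρ s) (σ • (2:ℝ)⁻¹ • pol ρ s)
      rw [add_sub_cancel_right, n1] at this
      linarith
    have e0 : (v + σ • (2:ℝ)⁻¹ • pol ρ s) 0 = v 0 + σ * (ρ * Real.cos s / 2) := by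
      simp only [pol, PiLp.add_apply, PiLp.smul_apply, smul_eq_mul]; simp; left; ring
    have e1 : (v + σ • (2:ℝ)⁻¹ • pol ρ s) 1 = v 1 + σ * (ρ * Real.sin s / 2) := by
      simp only [pol, PiLp.add_apply, PiLp.smul_apply, smul_eq_mul]; simp; left; ring
    have hp := inner_far (v := v) (r := σ • (2:ℝ)⁻¹ • pol ρ s) (by rw [n1]; linarith)
    rw [bR_far n2, e0, e1]
    rw [e0, e1] at hp
    exact arctan_deriv (((((Real.hasDerivAt_cos s).const_mul ρ).div_const 2).const_mul σ).const_add _)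
      (((((Real.hasDerivAt_sin s).const_mul ρ).div_const 2).const_mul σ).const_add _) hp
  have hder := fun s => (key 1 (by simp) s).add (key (-1) (by simp) s)
  have cb := continuous_bR hR
  have cp : Continuous fun s => pol ρ s := by
    simp_rw [pol_eq]; fun_prop
  have cc : ∀ (σ : ℝ) (i : Fin 2), Continuous fun s => bR R (v + σ • (2:ℝ)⁻¹ • pol ρ s) i := by
    intro σ i
    have h1 : Continuous fun s => v + σ • (2:ℝ)⁻¹ • pol ρ s := by
      exact (by fun_prop : Continuous fun x : E2 => v + σ • (2:ℝ)⁻¹ • x).comp cp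
    exact (by fun_prop : Continuous fun x : E2 => x i).comp (cb.comp h1)
  have hIntg := intervalIntegral.integral_eq_sub_of_hasDerivAt (a := φ) (b := φ + Real.pi)
    (fun s _ => hder s) (by
      apply Continuous.intervalIntegrable
      have k1 : ∀ σ : ℝ, Continuous fun s => σ * (ρ * -Real.sin s / 2) := fun σ => by fun_prop
      have k2 : ∀ σ : ℝ, Continuous fun s => σ * (ρ * Real.cos s / 2) := fun σ => by fun_prop
      exact (((cc 1 0).mul (k1 1)).add ((cc 1 1).mul (k2 1))).add
        (((cc (-1) 0).mul (k1 (-1))).add ((cc (-1) 1).mul (k2 (-1)))))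
  have hE : ∀ s, ρ * (-Real.sin s *
        ((bR R (v + (2:ℝ)⁻¹ • pol ρ s) 0 - bR R (v - (2:ℝ)⁻¹ • pol ρ s) 0) / 2) +
      Real.cos s *
        ((bR R (v + (2:ℝ)⁻¹ • pol ρ s) 1 - bR R (v - (2:ℝ)⁻¹ • pol ρ s) 1) / 2)) =
      bR R (v + (1:ℝ) • (2:ℝ)⁻¹ • pol ρ s) 0 * (1 * (ρ * -Real.sin s / 2)) +
        bR R (v + (1:ℝ) • (2:ℝ)⁻¹ • pol ρ s) 1 * (1 * (ρ * Real.cos s / 2)) +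
      (bR R (v + (-1:ℝ) • (2:ℝ)⁻¹ • pol ρ s) 0 * (-1 * (ρ * -Real.sin s / 2)) +
        bR R (v + (-1:ℝ) • (2:ℝ)⁻¹ • pol ρ s) 1 * (-1 * (ρ * Real.cos s / 2))) := by
    intro s
    rw [one_smul, neg_one_smul ℝ ((2:ℝ)⁻¹ • pol ρ s), ← sub_eq_add_neg]
    ring
  simp_rw [hE, hIntg]
  simp only [Pi.add_apply, Real.sin_add_pi, Real.cos_add_pi]
  rw [sub_eq_zero, add_comm]
  congr 2 <;> ring_nf


/-- Configuration with particles `j`, `k` moved to `x`, `y`. -/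
def up2 {N : ℕ} (X : Fin N → E2) (j k : Fin N) (x y : E2) : Fin N → E2 :=
  Function.update (Function.update X j x) k y

section
variable {N : ℕ} {X : Fin N → E2} {j k : Fin N}

theorem up2_j (hjk : j ≠ k) (x y : E2) : up2 X j k x y j = x := by simp [up2, hjk]
theorem up2_k (x y : E2) : up2 X j k x y k = y := by simp [up2]
theorem up2_o {m : Fin N} (h : m ≠ j) (h' : m ≠ k) (x y : E2) : up2 X j k x y m = X m := by
  simp [up2, h, h']

theorem up2_comm (hjk : j ≠ k) (x y : E2) : up2 X j k x y = up2 X k j y x := by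
  unfold up2; rw [Function.update_comm hjk]

theorem continuous_up2 : Continuous fun p : E2 × E2 => up2 X j k p.1 p.2 :=
  Continuous.update (A := fun _ : Fin N => E2)
    (Continuous.update (A := fun _ : Fin N => E2) continuous_const j continuous_fst) k continuous_snd

/-- field of the other particles -/
def extA (R : ℝ) (X : Fin N → E2) (j k : Fin N) (x : E2) : E2 :=
  ∑ m ∈ (Finset.univ.erase j).erase k, bR R (x - X m)

theorem extA_comm (R : ℝ) (x : E2) : extA R X j k x = extA R X k j x := by
  unfold extA; rw [Finset.erase_right_comm]

theorem Avec_up2_j (R : ℝ) (hjk : j ≠ k) (x y : E2) :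
    Avec R (up2 X j k x y) j = bR R (x - y) + extA R X j k x := by
  rw [Avec_eq, ← Finset.add_sum_erase _ _ (Finset.mem_erase.2 ⟨hjk.symm, Finset.mem_univ k⟩),
    up2_j hjk, up2_k, extA]
  congr 1
  refine Finset.sum_congr rfl fun m hm => ?_
  simp only [Finset.mem_erase, Finset.mem_univ, and_true] at hm
  rw [up2_o hm.2 hm.1]

theorem Avec_up2_k (R : ℝ) (hjk : j ≠ k) (x y : E2) :
    Avec R (up2 X j k x y) k = bR R (y - x) + extA R X j k y := by
  rw [up2_comm hjk, Avec_up2_j R hjk.symm, extA_comm]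

theorem continuous_extA {R : ℝ} (hR : 0 < R) : Continuous (extA R X j k) := by
  unfold extA
  exact continuous_finsetSum _ fun m _ => (continuous_bR hR).comp (by fun_prop)

theorem antisym_up2 {Ψ : (Fin N → E2) → ℂ} (hA : Antisym N Ψ) (hjk : j ≠ k) (x y : E2) :
    Ψ (up2 X j k y x) = - Ψ (up2 X j k x y) := by
  have := hA (Equiv.swap j k) (up2 X j k x y)
  rw [Equiv.Perm.sign_swap hjk] at this
  have h2 : up2 X j k x y ∘ Equiv.swap j k = up2 X j k y x := by
    funext m
    simp only [Function.comp]
    rcases eq_or_ne m j with h | h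
    · subst h; rw [Equiv.swap_apply_left, up2_k, up2_j hjk]
    · rcases eq_or_ne m k with h' | h'
      · subst h'; rw [Equiv.swap_apply_right, up2_k, up2_j hjk]
      · rw [Equiv.swap_apply_of_ne_of_ne h h', up2_o h h', up2_o h h']
  rw [h2] at this
  simpa using this

theorem hasFDerivAt_rel {Ψ : (Fin N → E2) → ℂ} (hΨ : ContDiff ℝ 1 Ψ) (hjk : j ≠ k) (c r : E2) :
    ∃ w' : E2 →L[ℝ] ℂ, HasFDerivAt
      (fun r => Ψ (up2 X j k (c + (2:ℝ)⁻¹ • r) (c - (2:ℝ)⁻¹ • r))) w' r ∧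
      ∀ i, w' (basisVec i) = (1 / 2) *
        (fderiv ℝ Ψ (up2 X j k (c + (2:ℝ)⁻¹ • r) (c - (2:ℝ)⁻¹ • r)) (dirv N j i) -
        fderiv ℝ Ψ (up2 X j k (c + (2:ℝ)⁻¹ • r) (c - (2:ℝ)⁻¹ • r)) (dirv N k i)) := by
  set P' : E2 →L[ℝ] (Fin N → E2) := ContinuousLinearMap.pi fun m =>
    if m = k then -((2:ℝ)⁻¹ • ContinuousLinearMap.id ℝ E2) else
      if m = j then (2:ℝ)⁻¹ • ContinuousLinearMap.id ℝ E2 else 0 with hP'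
  have hP : HasFDerivAt (fun r : E2 => up2 X j k (c + (2:ℝ)⁻¹ • r) (c - (2:ℝ)⁻¹ • r)) P' r := by
    rw [hP', hasFDerivAt_pi]
    intro m
    have h0 : HasFDerivAt (fun r : E2 => (2:ℝ)⁻¹ • r) ((2:ℝ)⁻¹ • ContinuousLinearMap.id ℝ E2) r :=
      ((2:ℝ)⁻¹ • ContinuousLinearMap.id ℝ E2).hasFDerivAt
    rcases eq_or_ne m k with h | h
    · subst h
      simp only [up2_k, if_true]
      exact h0.const_sub c
    · rcases eq_or_ne m j with h' | h'
      · subst h'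
        simp only [up2_j hjk, if_true, h, if_false]
        exact h0.const_add c
      · simp only [up2_o h' h, h, h', if_false]
        exact hasFDerivAt_const _ _
  refine ⟨_, (((hΨ.differentiable (by norm_num)) _).hasFDerivAt).comp r hP, fun i => ?_⟩
  have hv : P' (basisVec i) = (2:ℝ)⁻¹ • (dirv N j i - dirv N k i) := by
    funext m
    rw [hP']
    simp only [ContinuousLinearMap.pi_apply, dirv, Pi.smul_apply, Pi.sub_apply]
    rcases eq_or_ne m k with h | h
    · subst h; simp [hjk.symm]
    · rcases eq_or_ne m j with h' | h'
      · subst h'; simp [h]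
      · simp [h, h']
  rw [ContinuousLinearMap.comp_apply, hv, map_smul, map_sub]
  simp [Complex.real_smul]

theorem lint_cov2 {F : E2 → E2 → ENNReal} (hF : Measurable fun p : E2 × E2 => F p.1 p.2) :
    ∫⁻ x, ∫⁻ y, F x y = ∫⁻ c, ∫⁻ r, F (c + (2:ℝ)⁻¹ • r) (c - (2:ℝ)⁻¹ • r) := by
  have h1 : ∀ x, ∫⁻ y, F x y = ∫⁻ r, F x (x - r) := fun x =>
    (lintegral_sub_left_eq_self (fun y => F x y) x).symm
  simp_rw [h1]
  have m1 : AEMeasurable (Function.uncurry fun x r => F x (x - r)) (volume.prod volume) := by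
    refine Measurable.aemeasurable ?_
    exact hF.comp (f := fun p : E2 × E2 => (p.1, p.1 - p.2)) (by fun_prop)
  have m2 : AEMeasurable (Function.uncurry fun c r : E2 =>
      F (c + (2:ℝ)⁻¹ • r) (c - (2:ℝ)⁻¹ • r)) (volume.prod volume) := by
    refine Measurable.aemeasurable ?_
    exact hF.comp (f := fun p : E2 × E2 => (p.1 + (2:ℝ)⁻¹ • p.2, p.1 - (2:ℝ)⁻¹ • p.2)) (by fun_prop)
  rw [lintegral_lintegral_swap m1, lintegral_lintegral_swap m2]
  congr 1; ext r
  rw [← lintegral_add_right_eq_self _ ((2:ℝ)⁻¹ • r)]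
  congr 1; ext c
  congr 1
  have : r = (2:ℝ)⁻¹ • r + (2:ℝ)⁻¹ • r := by rw [← add_smul]; norm_num
  calc c + (2:ℝ)⁻¹ • r - r = c + (2:ℝ)⁻¹ • r - ((2:ℝ)⁻¹ • r + (2:ℝ)⁻¹ • r) := by rw [← this]
    _ = _ := by abel
end


section
variable {N : ℕ} {X : Fin N → E2} {j k : Fin N}

theorem flux_rel {R α : ℝ} (hR : 0 < R) {c : E2} {D : ℝ}
    (hfar : ∀ m, m ≠ j → m ≠ k → R + D ≤ ‖c - X m‖) {ρ : ℝ} (hρ : 0 < ρ) (hρD : ρ ≤ D) (φ : ℝ) :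
    ∫ s in φ..(φ + Real.pi), ρ * (-Real.sin s * (α * (bR R (pol ρ s) 0 +
        (extA R X j k (c + (2:ℝ)⁻¹ • pol ρ s) 0 - extA R X j k (c - (2:ℝ)⁻¹ • pol ρ s) 0) / 2)) +
      Real.cos s * (α * (bR R (pol ρ s) 1 +
        (extA R X j k (c + (2:ℝ)⁻¹ • pol ρ s) 1 - extA R X j k (c - (2:ℝ)⁻¹ • pol ρ s) 1) / 2))) =
      Real.pi * (α * min 1 (ρ ^ 2 / R ^ 2)) := by
  set g : Fin N → ℝ → ℝ := fun m s => ρ * (-Real.sin s *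
        ((bR R (c - X m + (2:ℝ)⁻¹ • pol ρ s) 0 - bR R (c - X m - (2:ℝ)⁻¹ • pol ρ s) 0) / 2) +
      Real.cos s *
        ((bR R (c - X m + (2:ℝ)⁻¹ • pol ρ s) 1 - bR R (c - X m - (2:ℝ)⁻¹ • pol ρ s) 1) / 2)) with hg
  have hE : ∀ s, ρ * (-Real.sin s * (α * (bR R (pol ρ s) 0 +
        (extA R X j k (c + (2:ℝ)⁻¹ • pol ρ s) 0 - extA R X j k (c - (2:ℝ)⁻¹ • pol ρ s) 0) / 2)) +
      Real.cos s * (α * (bR R (pol ρ s) 1 +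
        (extA R X j k (c + (2:ℝ)⁻¹ • pol ρ s) 1 - extA R X j k (c - (2:ℝ)⁻¹ • pol ρ s) 1) / 2))) =
      α * min 1 (ρ ^ 2 / R ^ 2) + α * ∑ m ∈ (Finset.univ.erase j).erase k, g m s := by
    intro s
    have e : ∀ i : Fin 2, extA R X j k (c + (2:ℝ)⁻¹ • pol ρ s) i -
        extA R X j k (c - (2:ℝ)⁻¹ • pol ρ s) i = ∑ m ∈ (Finset.univ.erase j).erase k,
        (bR R (c - X m + (2:ℝ)⁻¹ • pol ρ s) i - bR R (c - X m - (2:ℝ)⁻¹ • pol ρ s) i) := by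
      intro i
      rw [Finset.sum_sub_distrib]
      simp only [extA, WithLp.ofLp_sum, Finset.sum_apply]
      congr 1 <;> refine Finset.sum_congr rfl fun m _ => ?_
      · rw [add_sub_right_comm]
      · rw [sub_right_comm]
    rw [e 0, e 1, ← bR_pol hR hρ s]
    have : ∑ m ∈ (Finset.univ.erase j).erase k, g m s = ρ * (-Real.sin s *
        ((∑ m ∈ (Finset.univ.erase j).erase k, (bR R (c - X m + (2:ℝ)⁻¹ • pol ρ s) 0 -
          bR R (c - X m - (2:ℝ)⁻¹ • pol ρ s) 0)) / 2) + Real.cos s *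
        ((∑ m ∈ (Finset.univ.erase j).erase k, (bR R (c - X m + (2:ℝ)⁻¹ • pol ρ s) 1 -
          bR R (c - X m - (2:ℝ)⁻¹ • pol ρ s) 1)) / 2)) := by
      simp only [hg, Finset.sum_div, Finset.mul_sum, ← Finset.sum_add_distrib, mul_add]
    rw [this]
    ring
  simp_rw [hE]
  have cp : Continuous fun s => pol ρ s := by
    simp_rw [pol_eq]; fun_prop
  have cb : ∀ (v : E2) (σ : ℝ) (i : Fin 2), Continuous fun s => bR R (v + σ • pol ρ s) i := by
    intro v σ i
    have h1 : Continuous fun s => v + σ • pol ρ s := by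
      exact (by fun_prop : Continuous fun x : E2 => v + σ • x).comp cp
    exact (by fun_prop : Continuous fun x : E2 => x i).comp ((continuous_bR hR).comp h1)
  have cg : ∀ m, Continuous (g m) := by
    intro m
    have e : g m = fun s => ρ * (-Real.sin s *
        ((bR R (c - X m + (2:ℝ)⁻¹ • pol ρ s) 0 - bR R (c - X m + (-(2:ℝ)⁻¹) • pol ρ s) 0) / 2) +
      Real.cos s *
        ((bR R (c - X m + (2:ℝ)⁻¹ • pol ρ s) 1 - bR R (c - X m + (-(2:ℝ)⁻¹) • pol ρ s) 1) / 2)) := by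
      rw [hg]; simp only [neg_smul, ← sub_eq_add_neg]
    rw [e]
    have h1 := cb (c - X m) (2:ℝ)⁻¹
    have h2 := cb (c - X m) (-(2:ℝ)⁻¹)
    exact continuous_const.mul ((Real.continuous_sin.neg.mul (((h1 0).sub (h2 0)).div_const 2)).add
      (Real.continuous_cos.mul (((h1 1).sub (h2 1)).div_const 2)))
  have cs : Continuous fun s => α * ∑ m ∈ (Finset.univ.erase j).erase k, g m s :=
    continuous_const.mul (continuous_finsetSum _ fun m _ => cg m)
  rw [intervalIntegral.integral_add (by simp) (cs.intervalIntegrable _ _),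
    intervalIntegral.integral_const_mul α (fun s => ∑ m ∈ (Finset.univ.erase j).erase k, g m s),
    intervalIntegral.integral_finsetSum (fun m _ => (cg m).intervalIntegrable _ _)]
  have z : ∑ m ∈ (Finset.univ.erase j).erase k, ∫ s in φ..(φ + Real.pi), g m s = 0 := by
    refine Finset.sum_eq_zero fun m hm => ?_
    simp only [Finset.mem_erase, Finset.mem_univ, and_true] at hm
    exact flux_far hR hρ ((by linarith : R + ρ ≤ R + D).trans (hfar m hm.2 hm.1)) φ
  rw [z]
  simp
  ring

theorem disc_rel {R α : ℝ} (hR : 0 < R) (h0 : 0 ≤ α) (h2 : α ≤ 2) {Ψ : (Fin N → E2) → ℂ}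
    (hΨ : ContDiff ℝ 1 Ψ) (hA : Antisym N Ψ) (hjk : j ≠ k) {c : E2} {D : ℝ} (hD : 0 < D)
    (hfar : ∀ m, m ≠ j → m ≠ k → R + D ≤ ‖c - X m‖) :
    ENNReal.ofReal |α - 1| * ∫⁻ r in Metric.ball (0 : E2) D,
        fE Ψ (up2 X j k (c + (2:ℝ)⁻¹ • r) (c - (2:ℝ)⁻¹ • r)) ≤
      ENNReal.ofReal (18 * D ^ 2) * ∫⁻ r in Metric.ball (0 : E2) D,
        (eE R α Ψ j (up2 X j k (c + (2:ℝ)⁻¹ • r) (c - (2:ℝ)⁻¹ • r)) +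
          eE R α Ψ k (up2 X j k (c + (2:ℝ)⁻¹ • r) (c - (2:ℝ)⁻¹ • r))) := by
  set P : E2 → Fin N → E2 := fun r => up2 X j k (c + (2:ℝ)⁻¹ • r) (c - (2:ℝ)⁻¹ • r) with hP
  have cP : Continuous P := by
    exact continuous_up2.comp
      (by fun_prop : Continuous fun r : E2 => (c + (2:ℝ)⁻¹ • r, c - (2:ℝ)⁻¹ • r))
  have cx : ∀ i : Fin 2, Continuous fun x : E2 => x i := fun i => by fun_prop
  have key := disc (w := fun r => Ψ (P r))
    (d := fun i r => (1 / 2) * (covD R α Ψ j (P r) i - covD R α Ψ k (P r) i))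
    (a := fun i r => α * (bR R r i +
        (extA R X j k (c + (2:ℝ)⁻¹ • r) i - extA R X j k (c - (2:ℝ)⁻¹ • r) i) / 2))
    (fun r => (hasFDerivAt_rel hΨ hjk c r).choose_spec.1.differentiableAt)
    (fun i => continuous_const.mul (((continuous_covD hR hΨ j i).comp cP).sub
      ((continuous_covD hR hΨ k i).comp cP)))
    (fun i => by
      have e1 : Continuous fun r : E2 => c + (2:ℝ)⁻¹ • r := by fun_prop
      have e2 : Continuous fun r : E2 => c - (2:ℝ)⁻¹ • r := by fun_prop
      have e3 := continuous_extA (X := X) (j := j) (k := k) hR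
      exact continuous_const.mul (((cx i).comp (continuous_bR hR)).add
        ((((cx i).comp (e3.comp e1)).sub ((cx i).comp (e3.comp e2))).div_const 2)))
    (fun i r => by
      obtain ⟨w', hw', hw2⟩ := hasFDerivAt_rel (X := X) hΨ hjk c r
      have := hw'.fderiv
      simp only [hP]
      rw [this, hw2]
      simp only [covD, Avec_up2_j R hjk, Avec_up2_k R hjk]
      have e1 : c + (2:ℝ)⁻¹ • r - (c - (2:ℝ)⁻¹ • r) = r := by
        have : r = (2:ℝ)⁻¹ • r + (2:ℝ)⁻¹ • r := by rw [← add_smul]; norm_num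
        nth_rewrite 3 [this]; abel
      have e2 : c - (2:ℝ)⁻¹ • r - (c + (2:ℝ)⁻¹ • r) = - r := by
        rw [← neg_sub, e1]
      rw [e1, e2, bR_neg]
      simp only [PiLp.add_apply, PiLp.neg_apply]
      push_cast
      ring)
    (fun r => by
      simp only [hP]
      rw [smul_neg, ← sub_eq_add_neg, sub_neg_eq_add]
      exact antisym_up2 hA hjk _ _)
    hR h0 h2 hD
    (fun ρ hρ hρD φ => flux_rel hR hfar hρ hρD φ)
  refine key.trans ?_
  gcongr with r
  rw [eE, eE, ← ENNReal.ofReal_add (by positivity) (by positivity), ← Finset.sum_add_distrib]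
  refine ENNReal.ofReal_le_ofReal (Finset.sum_le_sum fun i _ => ?_)
  rw [norm_mul, mul_pow]
  have := norm_sub_le (covD R α Ψ j (P r) i) (covD R α Ψ k (P r) i)
  have h3 : ‖(1 / 2 : ℂ)‖ = 1 / 2 := by norm_num
  rw [h3]
  have h4 := norm_nonneg (covD R α Ψ j (P r) i - covD R α Ψ k (P r) i)
  have h5 := mul_self_le_mul_self h4 this
  generalize ‖covD R α Ψ j (P r) i - covD R α Ψ k (P r) i‖ = z at *
  generalize ‖covD R α Ψ j (P r) i‖ = x at *
  generalize ‖covD R α Ψ k (P r) i‖ = y at *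
  nlinarith [sq_nonneg (x - y), sq_nonneg x, sq_nonneg y]

/-- Two-body leaf, small radius. -/
theorem leafII {R α : ℝ} (hR : 0 < R) (h0 : 0 ≤ α) (h2 : α ≤ 2) {Ψ : (Fin N → E2) → ℂ}
    (hΨ : ContDiff ℝ 1 Ψ) (hA : Antisym N Ψ) (hjk : j ≠ k) {q : E2} {l : ℝ} (hl : 0 < l)
    (hRl : R ≤ 10 * l) (hfar : ∀ m, m ≠ j → m ≠ k → 16 * l ≤ ‖X m - q‖) {T Q : Set E2}
    (hTm : MeasurableSet T) (hQm : MeasurableSet Q)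
    (hT : T ⊆ Metric.ball q l) (hQ : Metric.ball q (2 * l) ⊆ Q) :
    ENNReal.ofReal |α - 1| * ∫⁻ x in T, ∫⁻ y in T, fE Ψ (up2 X j k x y) ≤
      ENNReal.ofReal (72 * l ^ 2) * ∫⁻ x in Q, ∫⁻ y in Q,
        (eE R α Ψ j (up2 X j k x y) + eE R α Ψ k (up2 X j k x y)) := by
  have mP : Measurable fun p : E2 × E2 => up2 X j k p.1 p.2 := continuous_up2.measurable
  have mf : Measurable fun p : E2 × E2 => fE Ψ (up2 X j k p.1 p.2) := (measurable_fE hΨ).comp mP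
  have me : Measurable fun p : E2 × E2 => eE R α Ψ j (up2 X j k p.1 p.2) +
      eE R α Ψ k (up2 X j k p.1 p.2) :=
    ((measurable_eE hR hΨ j).comp mP).add ((measurable_eE hR hΨ k).comp mP)
  have conv : ∀ (S : Set E2) (F : E2 → E2 → ENNReal), MeasurableSet S →
      Measurable (fun p : E2 × E2 => F p.1 p.2) → ∫⁻ x in S, ∫⁻ y in S, F x y =
      ∫⁻ c, ∫⁻ r, (S ×ˢ S).indicator (fun p : E2 × E2 => F p.1 p.2)
        (c + (2:ℝ)⁻¹ • r, c - (2:ℝ)⁻¹ • r) := by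
    intro S F hS hF
    have := lint_cov2 (F := fun x y => (S ×ˢ S).indicator (fun p : E2 × E2 => F p.1 p.2) (x, y))
      (hF.indicator (hS.prod hS))
    rw [← this, ← lintegral_indicator hS]
    congr 1; ext x
    by_cases hx : x ∈ S
    · rw [Set.indicator_of_mem hx, ← lintegral_indicator hS]
      congr 1; ext y
      exact ind_eq (by simp [hx]) rfl
    · rw [Set.indicator_of_notMem hx]
      symm
      rw [lintegral_eq_zero_iff' (by
        exact ((hF.indicator (hS.prod hS)).comp (by fun_prop)).aemeasurable)]
      filter_upwards with y
      simp [hx]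
  rw [conv T _ hTm mf, conv Q _ hQm me, ← lintegral_const_mul' _ _ ENNReal.ofReal_ne_top,
    ← lintegral_const_mul' _ _ ENNReal.ofReal_ne_top]
  refine lintegral_mono fun c => ?_
  have half : ∀ r : E2, ‖(2:ℝ)⁻¹ • r‖ = ‖r‖ / 2 := fun r => by
    rw [norm_smul]; norm_num; ring
  by_cases hc : c ∈ Metric.ball q l
  · rw [mem_ball_iff_norm] at hc
    have key := disc_rel (X := X) hR h0 h2 hΨ hA hjk (c := c) (D := 2 * l) (by positivity) (by
      intro m hm hm'
      have h1 := hfar m hm hm'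
      have h2 := norm_sub_le_norm_sub_add_norm_sub (X m) c q
      rw [norm_sub_rev (X m) c] at h2
      linarith)
    rw [show 18 * (2 * l) ^ 2 = 72 * l ^ 2 by ring] at key
    refine le_trans ?_ (key.trans ?_)
    · refine mul_le_mul_right ?_ _
      rw [← lintegral_indicator measurableSet_ball]
      refine lintegral_mono fun r => ?_
      by_cases hr : (c + (2:ℝ)⁻¹ • r, c - (2:ℝ)⁻¹ • r) ∈ T ×ˢ T
      · rw [Set.indicator_of_mem hr, Set.indicator_of_mem]
        have h1 := hT hr.1
        have h2 := hT hr.2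
        rw [mem_ball_iff_norm] at h1 h2 ⊢
        have h3 := norm_sub_le (c + (2:ℝ)⁻¹ • r - q) (c - (2:ℝ)⁻¹ • r - q)
        have h4 : c + (2:ℝ)⁻¹ • r - q - (c - (2:ℝ)⁻¹ • r - q) = r - 0 := by
          have : r = (2:ℝ)⁻¹ • r + (2:ℝ)⁻¹ • r := by rw [← add_smul]; norm_num
          nth_rewrite 3 [this]; abel
        rw [h4] at h3
        dsimp only at h1 h2
        linarith
      · rw [Set.indicator_of_notMem hr]; exact zero_le
    · refine mul_le_mul_right ?_ _
      rw [← lintegral_indicator measurableSet_ball]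
      refine lintegral_mono fun r => ?_
      by_cases hr : r ∈ Metric.ball (0 : E2) (2 * l)
      · rw [Set.indicator_of_mem hr, Set.indicator_of_mem]
        rw [mem_ball_zero_iff] at hr
        have h3 := half r
        refine ⟨hQ ?_, hQ ?_⟩ <;> rw [mem_ball_iff_norm] <;> dsimp only
        · have := norm_add_le (c - q) ((2:ℝ)⁻¹ • r)
          rw [add_sub_right_comm]; linarith
        · have := norm_sub_le (c - q) ((2:ℝ)⁻¹ • r)
          rw [sub_right_comm]; linarith
      · rw [Set.indicator_of_notMem hr]; exact zero_le
  · refine le_trans (le_of_eq ?_) zero_le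
    have : ∀ r : E2, (c + (2:ℝ)⁻¹ • r, c - (2:ℝ)⁻¹ • r) ∉ T ×ˢ T := by
      intro r hr
      apply hc
      have h1 := hT hr.1
      have h2 := hT hr.2
      rw [mem_ball_iff_norm] at h1 h2 ⊢
      dsimp only at h1 h2
      have h3 := norm_add_le (c + (2:ℝ)⁻¹ • r - q) (c - (2:ℝ)⁻¹ • r - q)
      have h4 : c + (2:ℝ)⁻¹ • r - q + (c - (2:ℝ)⁻¹ • r - q) = (2:ℝ) • (c - q) := by
        rw [two_smul]; abel
      rw [h4, norm_smul, Real.norm_eq_abs, abs_two] at h3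
      linarith
    simp [Set.indicator_of_notMem (this _)]
end


section
variable {K : Set E2}

theorem kint (hK : IsCompact K) {E : Type*} [NormedAddCommGroup E] {f : E2 → E} (hf : Continuous f) :
    Integrable f (volume.restrict K) := hf.continuousOn.integrableOn_compact hK

theorem kcont (hK : IsCompact K) {E Y : Type*} [NormedAddCommGroup E] [NormedSpace ℝ E] [TopologicalSpace Y]
    [FirstCountableTopology Y] [LocallyCompactSpace Y] {f : Y → E2 → E}
    (hf : Continuous fun p : Y × E2 => f p.1 p.2) :
    Continuous fun x => ∫ y in K, f x y :=
  continuous_parametric_integral_of_continuous (μ := volume) hf hK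

theorem kswap (hK : IsCompact K) {E : Type*} [NormedAddCommGroup E] [NormedSpace ℝ E] {f : E2 → E2 → E}
    (hf : Continuous fun p : E2 × E2 => f p.1 p.2) :
    ∫ x in K, ∫ y in K, f x y = ∫ y in K, ∫ x in K, f x y := by
  refine integral_integral_swap ?_
  rw [Measure.prod_restrict]
  exact hf.continuousOn.integrableOn_compact (hK.prod hK)

theorem kadd (hK : IsCompact K) {f g : E2 → E2 → ℝ} (hf : Continuous fun p : E2 × E2 => f p.1 p.2)
    (hg : Continuous fun p : E2 × E2 => g p.1 p.2) :
    ∫ x in K, ∫ y in K, (f x y + g x y) =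
      (∫ x in K, ∫ y in K, f x y) + ∫ x in K, ∫ y in K, g x y := by
  rw [← integral_add (kint hK (kcont hK hf)) (kint hK (kcont hK hg))]
  congr 1; ext x
  exact integral_add (kint hK (hf.comp (by fun_prop : Continuous fun y : E2 => (x, y))))
    (kint hK (hg.comp (by fun_prop : Continuous fun y : E2 => (x, y))))

theorem kmul (c : ℝ) (f : E2 → E2 → ℝ) :
    ∫ x in K, ∫ y in K, (c * f x y) = c * ∫ x in K, ∫ y in K, f x y := by
  simp_rw [integral_const_mul]

theorem kmono (hK : IsCompact K) {f g : E2 → E2 → ℝ} (hf : Continuous fun p : E2 × E2 => f p.1 p.2)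
    (hg : Continuous fun p : E2 × E2 => g p.1 p.2) (h : ∀ x ∈ K, ∀ y ∈ K, f x y ≤ g x y) :
    ∫ x in K, ∫ y in K, f x y ≤ ∫ x in K, ∫ y in K, g x y := by
  refine setIntegral_mono_on (kint hK (kcont hK hf)) (kint hK (kcont hK hg)) hK.measurableSet
    fun x hx => ?_
  exact setIntegral_mono_on (kint hK (hf.comp (by fun_prop : Continuous fun y : E2 => (x, y))))
    (kint hK (hg.comp (by fun_prop : Continuous fun y : E2 => (x, y)))) hK.measurableSet (h x hx)

open ComplexConjugate in
theorem exchange (hK : IsCompact K) {u : E2 → E2 → ℂ} (hu : Continuous fun p : E2 × E2 => u p.1 p.2)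
    (ha : ∀ x y, u y x = - u x y) {v : E2 → ℂ} (hv : Continuous v) :
    2 * ∫ y in K, ‖∫ x in K, conj (v x) * u x y‖ ^ 2 ≤
      (∫ x in K, ‖v x‖ ^ 2) * ∫ x in K, ∫ y in K, ‖u x y‖ ^ 2 := by
  set F : E2 → ℂ := fun y => ∫ x in K, conj (v x) * u x y with hF
  have cu1 : Continuous fun p : E2 × E2 => conj (v p.2) * u p.2 p.1 :=
    (Complex.continuous_conj.comp (hv.comp continuous_snd)).mul (hu.comp continuous_swap)
  have cF : Continuous F := kcont hK cu1
  set V := ∫ x in K, ‖v x‖ ^ 2 with hV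
  set Φ := ∫ y in K, ‖F y‖ ^ 2 with hΦ
  set M := ∫ x in K, ∫ y in K, ‖u x y‖ ^ 2 with hM
  have cv1 : Continuous fun p : E2 × E2 => v p.1 := hv.comp continuous_fst
  have cv2 : Continuous fun p : E2 × E2 => v p.2 := hv.comp continuous_snd
  have cF1 : Continuous fun p : E2 × E2 => F p.1 := cF.comp continuous_fst
  have cF2 : Continuous fun p : E2 × E2 => F p.2 := cF.comp continuous_snd
  have cc := Complex.continuous_conj
  have cr := Complex.continuous_re
  have crr : ∀ z : ℂ, (conj z * z).re = ‖z‖ ^ 2 := fun z => by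
    rw [← Complex.normSq_eq_conj_mul_self, Complex.ofReal_re, Complex.normSq_eq_norm_sq]
  -- the five functions
  have cp : Continuous fun p : E2 × E2 => (conj (F p.2) * (conj (v p.1) * u p.1 p.2)).re :=
    cr.comp ((cc.comp cF2).mul ((cc.comp cv1).mul hu))
  have cq : Continuous fun p : E2 × E2 => (conj (F p.1) * (conj (v p.2) * u p.1 p.2)).re :=
    cr.comp ((cc.comp cF1).mul ((cc.comp cv2).mul hu))
  have cn : Continuous fun p : E2 × E2 => ‖v p.1‖ ^ 2 * ‖F p.2‖ ^ 2 :=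
    (cv1.norm.pow 2).mul (cF2.norm.pow 2)
  have cn' : Continuous fun p : E2 × E2 => ‖F p.1‖ ^ 2 * ‖v p.2‖ ^ 2 :=
    (cF1.norm.pow 2).mul (cv2.norm.pow 2)
  have cz : Continuous fun p : E2 × E2 =>
      ((v p.1 * conj (F p.1)) * conj (v p.2 * conj (F p.2))).re :=
    cr.comp ((cv1.mul (cc.comp cF1)).mul (cc.comp (cv2.mul (cc.comp cF2))))
  have cu2 : Continuous fun p : E2 × E2 => ‖u p.1 p.2‖ ^ 2 := hu.norm.pow 2
  have reint : ∀ {f : E2 → ℂ}, Continuous f → ∫ x in K, (f x).re = (∫ x in K, f x).re :=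
    fun hf => integral_re (kint hK hf)
  have reint2 : ∀ {f : E2 → ℂ} (c : ℂ), Continuous f →
      ∫ x in K, (c * f x).re = (c * ∫ x in K, f x).re := by
    intro f c hf
    rw [reint (f := fun x => c * f x) (continuous_const.mul hf), integral_const_mul]
  have reint3 : ∀ {f : E2 → ℂ} (c : ℂ), Continuous f →
      ∫ x in K, (f x * c).re = ((∫ x in K, f x) * c).re := by
    intro f c hf
    rw [reint (f := fun x => f x * c) (hf.mul continuous_const), integral_mul_const]
  have ip : ∫ x in K, ∫ y in K, (conj (F y) * (conj (v x) * u x y)).re = Φ := by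
    rw [kswap hK cp, hΦ]
    congr 1; ext y
    have cu3 : Continuous fun x => conj (v x) * u x y :=
      (cc.comp hv).mul (hu.comp (by fun_prop : Continuous fun x : E2 => (x, y)))
    rw [reint2 _ cu3, ← crr]
  have iq : ∫ x in K, ∫ y in K, (conj (F x) * (conj (v y) * u x y)).re = -Φ := by
    rw [hΦ, ← integral_neg]
    congr 1; ext x
    have cu3 : Continuous fun y => conj (v y) * u y x :=
      (cc.comp hv).mul (hu.comp (by fun_prop : Continuous fun y : E2 => (y, x)))
    have e : ∀ y, (conj (F x) * (conj (v y) * u x y)).re =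
        -(conj (F x) * (conj (v y) * u y x)).re := by
      intro y; rw [ha y x]; simp only [mul_neg, Complex.neg_re]
    simp_rw [e]
    rw [integral_neg, reint2 _ cu3, ← crr]
  have inn : ∫ x in K, ∫ y in K, ‖v x‖ ^ 2 * ‖F y‖ ^ 2 = V * Φ := by
    simp_rw [integral_const_mul, integral_mul_const]; rfl
  have inn' : ∫ x in K, ∫ y in K, ‖F x‖ ^ 2 * ‖v y‖ ^ 2 = V * Φ := by
    simp_rw [integral_const_mul, integral_mul_const]; exact mul_comm _ _
  have iz : 0 ≤ ∫ x in K, ∫ y in K, ((v x * conj (F x)) * conj (v y * conj (F y))).re := by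
    have cS : Continuous fun x => v x * conj (F x) := hv.mul (cc.comp cF)
    have e : ∀ x, ∫ y in K, ((v x * conj (F x)) * conj (v y * conj (F y))).re =
        ((v x * conj (F x)) * conj (∫ y in K, v y * conj (F y))).re := by
      intro x
      have := reint2 (f := fun y => conj (v y * conj (F y))) (v x * conj (F x)) (cc.comp cS)
      rw [this, integral_conj]
    simp_rw [e]
    rw [reint3 _ cS, mul_comm, crr]
    positivity
  have key : ∀ t : ℝ, 0 ≤ M - 4 * t * Φ + 2 * t ^ 2 * (V * Φ) := by
    intro t
    have h1 : 0 ≤ ∫ x in K, ∫ y in K, ‖u x y - t * (v x * F y - F x * v y)‖ ^ 2 :=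
      integral_nonneg fun x => integral_nonneg fun y => by positivity
    have e : ∀ x y, ‖u x y - t * (v x * F y - F x * v y)‖ ^ 2 = ‖u x y‖ ^ 2 +
        ((-2 * t) * (conj (F y) * (conj (v x) * u x y)).re +
        ((2 * t) * (conj (F x) * (conj (v y) * u x y)).re +
        (t ^ 2 * (‖v x‖ ^ 2 * ‖F y‖ ^ 2) + (t ^ 2 * (‖F x‖ ^ 2 * ‖v y‖ ^ 2) +
        (-2 * t ^ 2) * ((v x * conj (F x)) * conj (v y * conj (F y))).re)))) := by
      intro x y
      generalize u x y = a
      generalize v x = b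
      generalize F y = c
      generalize F x = b'
      generalize v y = c'
      simp only [Complex.sq_norm, Complex.normSq_apply]
      simp
      ring
    simp_rw [e] at h1
    have k6 : Continuous fun p : E2 × E2 => (-2 * t ^ 2) *
        ((v p.1 * conj (F p.1)) * conj (v p.2 * conj (F p.2))).re := continuous_const.mul cz
    have k5 : Continuous fun p : E2 × E2 => t ^ 2 * (‖F p.1‖ ^ 2 * ‖v p.2‖ ^ 2) :=
      continuous_const.mul cn'
    have k4 : Continuous fun p : E2 × E2 => t ^ 2 * (‖v p.1‖ ^ 2 * ‖F p.2‖ ^ 2) :=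
      continuous_const.mul cn
    have k3 : Continuous fun p : E2 × E2 => (2 * t) * (conj (F p.1) * (conj (v p.2) *
      u p.1 p.2)).re := continuous_const.mul cq
    have k2 : Continuous fun p : E2 × E2 => (-2 * t) * (conj (F p.2) * (conj (v p.1) *
      u p.1 p.2)).re := continuous_const.mul cp
    have s5 := k5.add k6
    have s4 := k4.add s5
    have s3 := k3.add s4
    have s2 := k2.add s3
    rw [kadd hK cu2 s2, kadd hK k2 s3, kadd hK k3 s4, kadd hK k4 s5, kadd hK k5 k6] at h1
    simp only [kmul] at h1
    rw [ip, iq, inn, inn', ← hM] at h1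
    nlinarith [mul_nonneg (sq_nonneg t) iz]
  have V0 : 0 ≤ V := integral_nonneg fun x => by positivity
  have P0 : 0 ≤ Φ := integral_nonneg fun x => by positivity
  rcases V0.eq_or_lt with h | h
  · rw [← h] at key ⊢
    rw [zero_mul]
    by_contra hc
    push Not at hc
    have := key ((M + 1) / Φ)
    have hΦ0 : 0 < Φ := by linarith
    have M0 : 0 ≤ M := integral_nonneg fun x => integral_nonneg fun y => by positivity
    rw [mul_assoc 4, div_mul_cancel₀ _ hΦ0.ne'] at this
    linarith
  · have := key (1 / V)
    have e : M - 4 * (1 / V) * Φ + 2 * (1 / V) ^ 2 * (V * Φ) = (V * M - 2 * Φ) / V := by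
      field_simp; ring
    rw [e] at this
    have := (div_nonneg_iff.1 this)
    rcases this with h' | h'
    · linarith [h'.1]
    · linarith [h'.2]
end


theorem isCompact_square (p : E2) (l : ℝ) : IsCompact (square p l) := by
  have h : square p l = (WithLp.toLp 2 : (Fin 2 → ℝ) → E2) ''
      (Set.univ.pi fun i => Set.Icc (p i) (p i + l)) := by
    ext x
    simp only [square, Set.mem_ofPred_eq, Set.mem_image, Set.mem_pi, Set.mem_univ, true_imp_iff]
    constructor
    · intro h; exact ⟨x.ofLp, h, rfl⟩
    · rintro ⟨y, hy, rfl⟩; exact hy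
  rw [h]
  exact (isCompact_univ_pi fun i => isCompact_Icc).image (PiLp.continuous_toLp 2 _)

theorem kbox {f : E2 → ℝ} (hf : Continuous f) (p : E2) {l : ℝ} (hl : 0 ≤ l) :
    ∫ x in square p l, f x = ∫ s in (p 0)..(p 0 + l), ∫ t in (p 1)..(p 1 + l), f !₂[s, t] := by
  have h1 := (EuclideanSpace.volume_preserving_symm_measurableEquiv_toLp (Fin 2)).symm
  have h2 := (volume_preserving_finTwoArrow ℝ).symm
  have h3 := h1.comp h2
  have emb : MeasurableEmbedding
      ((MeasurableEquiv.toLp 2 (Fin 2 → ℝ)) ∘ (MeasurableEquiv.finTwoArrow (α := ℝ)).symm) :=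
    (MeasurableEquiv.toLp 2 (Fin 2 → ℝ)).measurableEmbedding.comp
      (MeasurableEquiv.finTwoArrow (α := ℝ)).symm.measurableEmbedding
  have := h3.setIntegral_preimage_emb emb f (square p l)
  rw [← this]
  have e : ((MeasurableEquiv.toLp 2 (Fin 2 → ℝ)) ∘ (MeasurableEquiv.finTwoArrow (α := ℝ)).symm) ⁻¹'
      square p l = Set.Icc (p 0) (p 0 + l) ×ˢ Set.Icc (p 1) (p 1 + l) := by
    ext a
    simp only [Set.mem_preimage, square, Set.mem_ofPred_eq, Fin.forall_fin_two]
    rfl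
  have e' : (⇑(MeasurableEquiv.toLp 2 (Fin 2 → ℝ)).symm.symm ∘
      ⇑(MeasurableEquiv.finTwoArrow (α := ℝ)).symm) ⁻¹' square p l =
      Set.Icc (p 0) (p 0 + l) ×ˢ Set.Icc (p 1) (p 1 + l) := e
  rw [e', Measure.volume_eq_prod]
  have cm : Continuous fun a : ℝ × ℝ => f !₂[a.1, a.2] := hf.comp continuous_mk2
  refine (setIntegral_prod (fun a : ℝ × ℝ => f !₂[a.1, a.2])
    (cm.continuousOn.integrableOn_compact (isCompact_Icc.prod isCompact_Icc))).trans ?_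
  rw [intervalIntegral.integral_of_le (by linarith), integral_Icc_eq_integral_Ioc]
  congr 1; ext s
  rw [intervalIntegral.integral_of_le (by linarith), integral_Icc_eq_integral_Ioc]

theorem kconst (p : E2) {l : ℝ} (hl : 0 ≤ l) (c : ℝ) : ∫ _ in square p l, c = l ^ 2 * c := by
  rw [kbox continuous_const p hl]; simp; ring

theorem osc_C1 {z : ℝ → ℂ} {z' : ℝ → ℂ} (hz : ∀ s, HasDerivAt z (z' s) s) (hc : Continuous z')
    {p l : ℝ} (hl : 0 ≤ l) {x y : ℝ} (hx : x ∈ Set.Icc p (p + l)) (hy : y ∈ Set.Icc p (p + l)) :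
    ‖z x - z y‖ ≤ ∫ s in p..(p + l), ‖z' s‖ := by
  rw [← intervalIntegral.integral_eq_sub_of_hasDerivAt (fun s _ => hz s)
    (hc.intervalIntegrable y x)]
  refine (intervalIntegral.norm_integral_le_integral_norm_uIoc).trans ?_
  rw [intervalIntegral.integral_of_le (by linarith)]
  refine setIntegral_mono_set (hc.norm.continuousOn.integrableOn_Icc.mono_set
    Set.Ioc_subset_Icc_self) (by filter_upwards with s using norm_nonneg _) ?_
  refine (show Set.uIoc y x ⊆ Set.Ioc p (p + l) from fun s hs => ?_).eventuallyLE
  rw [Set.uIoc, Set.mem_Ioc] at hs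
  exact ⟨(le_min hy.1 hx.1).trans_lt hs.1, hs.2.trans (max_le hy.2 hx.2)⟩

theorem poincareL1 {g : E2 → ℂ} (hg : ContDiff ℝ 1 g) (p : E2) {l : ℝ} (hl : 0 ≤ l) :
    ∫ x in square p l, ∫ y in square p l, ‖g x - g y‖ ≤
      l ^ 3 * ∫ x in square p l, ∑ c, ‖fderiv ℝ g x (basisVec c)‖ := by
  have hK := isCompact_square p l
  have gd : Differentiable ℝ g := hg.differentiable (by norm_num)
  have cD : ∀ c, Continuous fun x => ‖fderiv ℝ g x (basisVec c)‖ := fun c =>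
    ((hg.continuous_fderiv (by norm_num)).clm_apply continuous_const).norm
  have cD' : ∀ c, Continuous fun x => fderiv ℝ g x (basisVec c) := fun c =>
    ((hg.continuous_fderiv (by norm_num)).clm_apply continuous_const)
  have cm0 : ∀ t : ℝ, Continuous fun s : ℝ => (!₂[s, t] : E2) := fun t =>
    continuous_mk2.comp (by fun_prop : Continuous fun s : ℝ => (s, t))
  have cm1 : ∀ s : ℝ, Continuous fun t : ℝ => (!₂[s, t] : E2) := fun s =>
    continuous_mk2.comp (by fun_prop : Continuous fun t : ℝ => (s, t))
  set A : ℝ → ℝ := fun t => ∫ s in (p 0)..(p 0 + l), ‖fderiv ℝ g !₂[s, t] (basisVec 0)‖ with hA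
  set B : ℝ → ℝ := fun s => ∫ t in (p 1)..(p 1 + l), ‖fderiv ℝ g !₂[s, t] (basisVec 1)‖ with hB
  have cA : Continuous A := by
    refine intervalIntegral.continuous_parametric_intervalIntegral_of_continuous'
      (f := fun t s => ‖fderiv ℝ g !₂[s, t] (basisVec 0)‖) ?_ _ _
    exact (cD 0).comp (continuous_mk2.comp continuous_swap)
  have cB : Continuous B := by
    refine intervalIntegral.continuous_parametric_intervalIntegral_of_continuous'
      (f := fun s t => ‖fderiv ℝ g !₂[s, t] (basisVec 1)‖) ?_ _ _
    exact (cD 1).comp continuous_mk2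
  have hpt : ∀ x ∈ square p l, ∀ y ∈ square p l, ‖g x - g y‖ ≤ A (x 1) + B (y 0) := by
    intro x hx y hy
    have ex : x = !₂[x 0, x 1] := by ext i; fin_cases i <;> rfl
    have ey : y = !₂[y 0, y 1] := by ext i; fin_cases i <;> rfl
    have h1 := osc_C1 (z := fun s => g !₂[s, x 1])
      (fun s => hasDerivAt_mk0 gd s (x 1)) ((cD' 0).comp (cm0 _)) hl (hx 0) (hy 0)
    have h2 := osc_C1 (z := fun t => g !₂[y 0, t])
      (fun t => hasDerivAt_mk1 gd (y 0) t) ((cD' 1).comp (cm1 _)) hl (hx 1) (hy 1)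
    have h3 := norm_sub_le_norm_sub_add_norm_sub (g x) (g !₂[y 0, x 1]) (g y)
    rw [← ex] at h1
    rw [← ey] at h2
    linarith!
  have c0 : ∀ i : Fin 2, Continuous fun x : E2 => x i := fun i => by fun_prop
  have h4 := kmono hK (f := fun x y => ‖g x - g y‖) (g := fun x y => A (x 1) + B (y 0))
    ((hg.continuous.comp continuous_fst).sub (hg.continuous.comp continuous_snd)).norm
    ((cA.comp ((c0 1).comp continuous_fst)).add (cB.comp ((c0 0).comp continuous_snd))) hpt
  refine h4.trans (le_of_eq ?_)
  rw [kadd hK (f := fun x y => A (x 1)) (g := fun x y => B (y 0))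
    (cA.comp ((c0 1).comp continuous_fst)) (cB.comp ((c0 0).comp continuous_snd))]
  have cA' : Continuous fun x : E2 => A (x 1) := cA.comp (c0 1)
  have cB' : Continuous fun x : E2 => B (x 0) := cB.comp (c0 0)
  have i1 : ∫ x in square p l, A (x 1) = l * ∫ x in square p l, ‖fderiv ℝ g x (basisVec 0)‖ := by
    rw [kbox cA' p hl, kbox (cD 0) p hl,
      swap_cont (g := fun s t => ‖fderiv ℝ g !₂[s, t] (basisVec 0)‖) ((cD 0).comp continuous_mk2)]
    simp [hA]
  have i2 : ∫ x in square p l, B (x 0) = l * ∫ x in square p l, ‖fderiv ℝ g x (basisVec 1)‖ := by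
    rw [kbox cB' p hl, kbox (cD 1) p hl]
    simp [hB]
  simp_rw [kconst p hl]
  rw [integral_const_mul, i1, i2]
  simp_rw [Fin.sum_univ_two]
  rw [integral_add (kint hK (cD 0)) (kint hK (cD 1))]
  ring

/-- mean-value version -/
theorem poincare_mean {g : E2 → ℂ} (hg : ContDiff ℝ 1 g) (p : E2) {l : ℝ} (hl : 0 < l) :
    ∫ x in square p l, ‖g x‖ ≤ ‖∫ x in square p l, g x‖ +
      l * ∫ x in square p l, ∑ c, ‖fderiv ℝ g x (basisVec c)‖ := by
  have hK := isCompact_square p l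
  have h := poincareL1 hg p hl.le
  have hpt : ∀ x, l ^ 2 * ‖g x‖ ≤ ‖∫ y in square p l, g y‖ + ∫ y in square p l, ‖g x - g y‖ := by
    intro x
    have e : ∫ y in square p l, (g x - g y) = (l ^ 2 : ℝ) * g x - ∫ y in square p l, g y := by
      rw [integral_sub (kint hK continuous_const) (kint hK hg.continuous)]
      congr 1
      rw [setIntegral_const]
      have := kconst p hl.le 1
      rw [setIntegral_const, smul_eq_mul, mul_one, mul_one] at this
      rw [this, Complex.real_smul]
    have h1 := norm_integral_le_integral_norm (μ := volume.restrict (square p l))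
      (fun y => g x - g y)
    rw [e] at h1
    have h2 := norm_sub_norm_le ((l ^ 2 : ℝ) * g x) (∫ y in square p l, g y)
    rw [norm_mul, Complex.norm_real, Real.norm_eq_abs, abs_of_nonneg (by positivity)] at h2
    linarith
  have cc : Continuous fun x => ∫ y in square p l, ‖g x - g y‖ :=
    kcont hK ((hg.continuous.comp continuous_fst).sub (hg.continuous.comp continuous_snd)).norm
  have h3 := setIntegral_mono_on (kint hK (continuous_const.mul hg.continuous.norm))
    (kint hK (continuous_const.add cc)) hK.measurableSet (fun x _ => hpt x)
  have h4 : ∫ x in square p l, l ^ 2 * ‖g x‖ = l ^ 2 * ∫ x in square p l, ‖g x‖ :=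
    integral_const_mul _ _
  have h5 : ∫ x in square p l, (‖∫ y in square p l, g y‖ + ∫ y in square p l, ‖g x - g y‖) =
      l ^ 2 * ‖∫ y in square p l, g y‖ + ∫ x in square p l, ∫ y in square p l, ‖g x - g y‖ := by
    rw [integral_add (kint hK continuous_const) (kint hK cc), kconst p hl.le]
  have h6 := h4.symm.le.trans (h3.trans h5.le)
  have : 0 < l ^ 2 := by positivity
  refine le_of_mul_le_mul_left ?_ this
  calc _ ≤ _ := h6
    _ ≤ _ := by rw [mul_add]; gcongr; refine h.trans (le_of_eq ?_); ring


open ComplexConjugate in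
theorem prod_bound {z w : E2 → ℂ} {x v : E2} (hz : DifferentiableAt ℝ z x)
    (hw : DifferentiableAt ℝ w x) {dz dw : ℂ} {a a' : ℝ}
    (h1 : dz = -Complex.I * fderiv ℝ z x v + (a : ℝ) * z x)
    (h2 : dw = -Complex.I * fderiv ℝ w x v + (a' : ℝ) * w x) :
    ‖fderiv ℝ (fun x => conj (z x) * w x) x v‖ ≤
      ‖z x‖ * ‖dw‖ + ‖dz‖ * ‖w x‖ + |a - a'| * (‖z x‖ * ‖w x‖) := by
  have hzc : HasFDerivAt (fun x => conj (z x)) ((Complex.conjCLE : ℂ →L[ℝ] ℂ).comp (fderiv ℝ z x)) x :=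
    (Complex.conjCLE : ℂ →L[ℝ] ℂ).hasFDerivAt.comp x hz.hasFDerivAt
  have h3 := (hzc.mul hw.hasFDerivAt).fderiv
  have h3' : fderiv ℝ (fun x => conj (z x) * w x) x v = conj (z x) * fderiv ℝ w x v +
      w x * conj (fderiv ℝ z x v) := by
    have : (fun x => conj (z x) * w x) = (fun x => conj (z x)) * w := rfl
    rw [this, h3]
    simp
  rw [h3', fderiv_eq_of_cov h1, fderiv_eq_of_cov h2]
  have e : conj (z x) * (Complex.I * (dw - a' * w x)) + w x * conj (Complex.I * (dz - a * z x)) =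
      Complex.I * (conj (z x) * dw) + (-Complex.I) * (conj dz * w x) +
        Complex.I * (((a - a' : ℝ) : ℂ) * (conj (z x) * w x)) := by
    simp only [map_mul, map_sub, Complex.conj_I, Complex.conj_ofReal]
    push_cast
    ring
  rw [e]
  refine (norm_add₃_le).trans (le_of_eq ?_)
  simp only [norm_mul, norm_neg, Complex.norm_I, one_mul, Complex.norm_conj, Complex.norm_real,
    Real.norm_eq_abs]

section
variable {u : E2 → E2 → ℂ} {d : Fin 2 → E2 → E2 → ℂ} {a : Fin 2 → E2 → E2 → ℝ} {p : E2} {l : ℝ}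

open ComplexConjugate in
theorem regI_step1 (hl : 0 < l) (hu : Continuous fun p : E2 × E2 => u p.1 p.2)
    (hd : ∀ c, Continuous fun p : E2 × E2 => d c p.1 p.2)
    (hu1 : ∀ y, ContDiff ℝ 1 fun x => u x y)
    (h : ∀ c x y, d c x y = -Complex.I * fderiv ℝ (fun x => u x y) x (basisVec c) +
      (a c x y : ℝ) * u x y)
    (hk : ∀ c, ∀ x ∈ square p l, ∀ y ∈ square p l, ∀ y0 ∈ square p l,
      |a c x y0 - a c x y| ≤ 1 / (50 * l)) {y y0 : E2} (hy : y ∈ square p l)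
    (hy0 : y0 ∈ square p l) :
    ∫ x in square p l, ‖u x y0‖ * ‖u x y‖ ≤ ‖∫ x in square p l, conj (u x y0) * u x y‖ +
      ((9 / 200) * ((∫ x in square p l, ‖u x y‖ ^ 2) + ∫ x in square p l, ‖u x y0‖ ^ 2) +
      20 * l ^ 2 * ((∫ x in square p l, ∑ c, ‖d c x y‖ ^ 2) +
        ∫ x in square p l, ∑ c, ‖d c x y0‖ ^ 2)) := by
  have hK := isCompact_square p l
  have sc : ∀ y : E2, Continuous fun x : E2 => (x, y) := fun y => by fun_prop
  have cu : ∀ y, Continuous fun x => u x y := fun y => hu.comp (sc y)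
  have cd : ∀ c y, Continuous fun x => d c x y := fun c y => (hd c).comp (sc y)
  have hg : ContDiff ℝ 1 fun x => conj (u x y0) * u x y :=
    (Complex.conjCLE.contDiff.comp (hu1 y0)).mul (hu1 y)
  have h1 := poincare_mean hg p hl
  have e1 : ∀ x, ‖conj (u x y0) * u x y‖ = ‖u x y0‖ * ‖u x y‖ := fun x => by
    rw [norm_mul, Complex.norm_conj]
  simp_rw [e1] at h1
  refine h1.trans (add_le_add le_rfl ?_)
  have ce : ∀ y, Continuous fun x => ∑ c, ‖d c x y‖ ^ 2 := fun y =>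
    continuous_finsetSum _ fun c _ => (cd c y).norm.pow 2
  have cf : ∀ y, Continuous fun x => ‖u x y‖ ^ 2 := fun y => (cu y).norm.pow 2
  rw [← integral_add (kint hK (cf y)) (kint hK (cf y0)), ← integral_add (kint hK (ce y))
    (kint hK (ce y0)), ← integral_const_mul, ← integral_const_mul, ← integral_const_mul,
    ← integral_add]
  · refine setIntegral_mono_on (kint hK ?_) (kint hK ?_) hK.measurableSet fun x hx => ?_
    · exact continuous_const.mul (continuous_finsetSum _ fun c _ =>
        ((hg.continuous_fderiv (by norm_num)).clm_apply continuous_const).norm)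
    · exact (continuous_const.mul ((cf y).add (cf y0))).add
        (continuous_const.mul ((ce y).add (ce y0)))
    · have hc : ∀ c, l * ‖fderiv ℝ (fun x => conj (u x y0) * u x y) x (basisVec c)‖ ≤
          (9 / 400) * (‖u x y‖ ^ 2 + ‖u x y0‖ ^ 2) +
          20 * l ^ 2 * (‖d c x y‖ ^ 2 + ‖d c x y0‖ ^ 2) := by
        intro c
        have h2 := prod_bound ((hu1 y0).differentiable (by norm_num) x)
          ((hu1 y).differentiable (by norm_num) x) (h c x y0) (h c x y)
        have h3 := hk c x hx y hy y0 hy0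
        have h4 : l * (|a c x y0 - a c x y| * (‖u x y0‖ * ‖u x y‖)) ≤
            (1 / 50) * (‖u x y0‖ * ‖u x y‖) := by
          rw [← mul_assoc]
          gcongr
          calc l * |a c x y0 - a c x y| ≤ l * (1 / (50 * l)) := by gcongr
            _ = 1 / 50 := by field_simp
        refine (mul_le_mul_of_nonneg_left h2 hl.le).trans ?_
        rw [mul_add]
        refine (add_le_add le_rfl h4).trans ?_
        generalize ‖u x y0‖ = A
        generalize ‖u x y‖ = B
        generalize ‖d c x y‖ = C
        generalize ‖d c x y0‖ = D
        nlinarith [sq_nonneg (A - 40 * l * C), sq_nonneg (B - 40 * l * D), sq_nonneg (A - B),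
          sq_nonneg A, sq_nonneg B]
      rw [Finset.mul_sum]
      refine (Finset.sum_le_sum fun c _ => hc c).trans (le_of_eq ?_)
      simp only [Fin.sum_univ_two]
      ring
  · exact kint hK (continuous_const.mul ((cf y).add (cf y0)))
  · exact kint hK (continuous_const.mul ((ce y).add (ce y0)))

open ComplexConjugate in
theorem regI_step4 (hl : 0 < l) (hu : Continuous fun p : E2 × E2 => u p.1 p.2)
    (hd : ∀ c, Continuous fun p : E2 × E2 => d c p.1 p.2)
    (hu1 : ∀ y, ContDiff ℝ 1 fun x => u x y)
    (h : ∀ c x y, d c x y = -Complex.I * fderiv ℝ (fun x => u x y) x (basisVec c) +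
      (a c x y : ℝ) * u x y) (y : E2) :
    ∫ x in square p l, ∫ x' in square p l, |‖u x y‖ ^ 2 - ‖u x' y‖ ^ 2| ≤
      l ^ 2 / 20 * (∫ x in square p l, ‖u x y‖ ^ 2) +
      40 * l ^ 4 * ∫ x in square p l, ∑ c, ‖d c x y‖ ^ 2 := by
  have hK := isCompact_square p l
  have sc : ∀ y : E2, Continuous fun x : E2 => (x, y) := fun y => by fun_prop
  have cu : ∀ y, Continuous fun x => u x y := fun y => hu.comp (sc y)
  have cd : ∀ c y, Continuous fun x => d c x y := fun c y => (hd c).comp (sc y)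
  have hg : ContDiff ℝ 1 fun x => conj (u x y) * u x y :=
    (Complex.conjCLE.contDiff.comp (hu1 y)).mul (hu1 y)
  have h1 := poincareL1 hg p hl.le
  have e1 : ∀ x x', ‖conj (u x y) * u x y - conj (u x' y) * u x' y‖ =
      |‖u x y‖ ^ 2 - ‖u x' y‖ ^ 2| := fun x x' => by
    rw [← Complex.normSq_eq_conj_mul_self, ← Complex.normSq_eq_conj_mul_self,
      ← Complex.ofReal_sub, Complex.norm_real, Complex.normSq_eq_norm_sq,
      Complex.normSq_eq_norm_sq, Real.norm_eq_abs]
  simp_rw [e1] at h1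
  refine h1.trans ?_
  have ce : ∀ y, Continuous fun x => ∑ c, ‖d c x y‖ ^ 2 := fun y =>
    continuous_finsetSum _ fun c _ => (cd c y).norm.pow 2
  have cf : ∀ y, Continuous fun x => ‖u x y‖ ^ 2 := fun y => (cu y).norm.pow 2
  rw [← integral_const_mul, ← integral_const_mul, ← integral_const_mul, ← integral_add]
  · refine setIntegral_mono_on (kint hK ?_) (kint hK ?_) hK.measurableSet fun x hx => ?_
    · exact continuous_const.mul (continuous_finsetSum _ fun c _ =>
        ((hg.continuous_fderiv (by norm_num)).clm_apply continuous_const).norm)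
    · exact (continuous_const.mul (cf y)).add (continuous_const.mul (ce y))
    · have hc : ∀ c, l ^ 3 * ‖fderiv ℝ (fun x => conj (u x y) * u x y) x (basisVec c)‖ ≤
          l ^ 2 / 40 * ‖u x y‖ ^ 2 + 40 * l ^ 4 * ‖d c x y‖ ^ 2 := by
        intro c
        have h2 := prod_bound ((hu1 y).differentiable (by norm_num) x)
          ((hu1 y).differentiable (by norm_num) x) (h c x y) (h c x y)
        rw [sub_self, abs_zero, zero_mul, add_zero] at h2
        refine (mul_le_mul_of_nonneg_left h2 (by positivity)).trans ?_
        generalize ‖u x y‖ = B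
        generalize ‖d c x y‖ = C
        nlinarith [mul_nonneg (sq_nonneg l) (sq_nonneg (B - 40 * l * C))]
      rw [Finset.mul_sum]
      refine (Finset.sum_le_sum fun c _ => hc c).trans (le_of_eq ?_)
      simp only [Fin.sum_univ_two]
      ring
  · exact kint hK (continuous_const.mul (cf y))
  · exact kint hK (continuous_const.mul (ce y))
end


section
variable {u : E2 → E2 → ℂ} {d : Fin 2 → E2 → E2 → ℂ} {a : Fin 2 → E2 → E2 → ℝ} {p : E2} {l : ℝ}

theorem regI_diff (hl : 0 < l) (hu : Continuous fun p : E2 × E2 => u p.1 p.2)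
    (hA : ∀ x y, u y x = - u x y)
    (hd : ∀ c, Continuous fun p : E2 × E2 => d c p.1 p.2)
    (hu1 : ∀ y, ContDiff ℝ 1 fun x => u x y)
    (h : ∀ c x y, d c x y = -Complex.I * fderiv ℝ (fun x => u x y) x (basisVec c) +
      (a c x y : ℝ) * u x y) :
    ∫ y0 in square p l, ∫ y in square p l, ∫ x in square p l, |‖u x y‖ ^ 2 - ‖u x y0‖ ^ 2| ≤
      l ^ 2 / 20 * (∫ y in square p l, ∫ x in square p l, ‖u x y‖ ^ 2) +
      40 * l ^ 4 * ∫ y in square p l, ∫ x in square p l, ∑ c, ‖d c x y‖ ^ 2 := by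
  have hK := isCompact_square p l
  have hn : ∀ x y, ‖u x y‖ = ‖u y x‖ := fun x y => by rw [hA y x, norm_neg]
  have cf : Continuous fun p : E2 × E2 => ‖u p.1 p.2‖ ^ 2 := hu.norm.pow 2
  have ce : Continuous fun p : E2 × E2 => ∑ c, ‖d c p.1 p.2‖ ^ 2 :=
    continuous_finsetSum _ fun c _ => (hd c).norm.pow 2
  have c3 : Continuous fun q : (E2 × E2) × E2 => |‖u q.2 q.1.2‖ ^ 2 - ‖u q.1.1 q.1.2‖ ^ 2| :=
    ((cf.comp (by fun_prop : Continuous fun q : (E2 × E2) × E2 => (q.2, q.1.2))).sub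
      (cf.comp (by fun_prop : Continuous fun q : (E2 × E2) × E2 => (q.1.1, q.1.2)))).abs
  have c2 : ∀ y0 : E2, Continuous fun q : E2 × E2 => |‖u q.1 q.2‖ ^ 2 - ‖u y0 q.2‖ ^ 2| :=
    fun y0 => (cf.sub (cf.comp (by fun_prop : Continuous fun q : E2 × E2 => (y0, q.2)))).abs
  have c2' : Continuous fun q : E2 × E2 => ∫ y in square p l, |‖u y q.2‖ ^ 2 - ‖u q.1 q.2‖ ^ 2| :=
    kcont (Y := E2 × E2) hK (f := fun q y => |‖u y q.2‖ ^ 2 - ‖u q.1 q.2‖ ^ 2|) c3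
  have e1 : ∫ y0 in square p l, ∫ y in square p l, ∫ x in square p l, |‖u x y‖ ^ 2 - ‖u x y0‖ ^ 2|
      = ∫ x in square p l, ∫ y0 in square p l, ∫ y in square p l,
        |‖u y0 x‖ ^ 2 - ‖u y x‖ ^ 2| := by
    have : ∀ y0, ∫ y in square p l, ∫ x in square p l, |‖u x y‖ ^ 2 - ‖u x y0‖ ^ 2| =
        ∫ x in square p l, ∫ y in square p l, |‖u y x‖ ^ 2 - ‖u y0 x‖ ^ 2| := fun y0 => by
      rw [kswap hK (f := fun x y => |‖u y x‖ ^ 2 - ‖u y0 x‖ ^ 2|)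
        ((c2 y0).comp continuous_swap)]
      congr 1; ext y; congr 1; ext x; rw [hn x y, hn x y0]
    simp_rw [this]
    rw [kswap hK (f := fun y0 x => ∫ y in square p l, |‖u y x‖ ^ 2 - ‖u y0 x‖ ^ 2|) c2']
    congr 1; ext x; congr 1; ext y0; congr 1; ext y; rw [abs_sub_comm]
  rw [e1, ← integral_const_mul, ← integral_const_mul, ← integral_add]
  · refine setIntegral_mono_on (kint hK ?_) (kint hK ?_) hK.measurableSet fun x hx =>
      regI_step4 hl hu hd hu1 h x
    · have c2'' : Continuous fun q : E2 × E2 => ∫ y in square p l,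
          |‖u q.2 q.1‖ ^ 2 - ‖u y q.1‖ ^ 2| := by
        have := c2'.comp continuous_swap
        refine this.congr fun q => ?_
        simp [abs_sub_comm]
      exact kcont hK (f := fun x y0 => ∫ y in square p l, |‖u y0 x‖ ^ 2 - ‖u y x‖ ^ 2|) c2''
    · exact (continuous_const.mul (kcont hK (f := fun y x => ‖u x y‖ ^ 2)
        (cf.comp continuous_swap))).add (continuous_const.mul
          (kcont hK (f := fun y x => ∑ c, ‖d c x y‖ ^ 2) (ce.comp continuous_swap)))
  · exact kint hK (continuous_const.mul (kcont hK (f := fun y x => ‖u x y‖ ^ 2)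
        (cf.comp continuous_swap)))
  · exact kint hK (continuous_const.mul
          (kcont hK (f := fun y x => ∑ c, ‖d c x y‖ ^ 2) (ce.comp continuous_swap)))

open ComplexConjugate in
theorem regI_F (hl : 0 < l) (hu : Continuous fun p : E2 × E2 => u p.1 p.2)
    (hA : ∀ x y, u y x = - u x y) {M : ℝ} (hM : M = ∫ y in square p l, ∫ x in square p l, ‖u x y‖ ^ 2)
    (hM0 : 0 < M) :
    ∫ y0 in square p l, ∫ y in square p l, ‖∫ x in square p l, conj (u x y0) * u x y‖ ≤
      17 / 24 * l ^ 2 * M := by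
  have hK := isCompact_square p l
  have cf : Continuous fun p : E2 × E2 => ‖u p.1 p.2‖ ^ 2 := hu.norm.pow 2
  have c3 : Continuous fun q : (E2 × E2) × E2 => conj (u q.2 q.1.1) * u q.2 q.1.2 :=
    (Complex.continuous_conj.comp
      (hu.comp (by fun_prop : Continuous fun q : (E2 × E2) × E2 => (q.2, q.1.1)))).mul
      (hu.comp (by fun_prop : Continuous fun q : (E2 × E2) × E2 => (q.2, q.1.2)))
  set F : E2 → E2 → ℂ := fun y0 y => ∫ x in square p l, conj (u x y0) * u x y with hF
  have cF : Continuous fun q : E2 × E2 => F q.1 q.2 :=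
    kcont (Y := E2 × E2) hK (f := fun q x => conj (u x q.1) * u x q.2) c3
  have cF2 : Continuous fun q : E2 × E2 => ‖F q.1 q.2‖ ^ 2 := cF.norm.pow 2
  have h1 : 2 * ∫ y0 in square p l, ∫ y in square p l, ‖F y0 y‖ ^ 2 ≤ M * M := by
    rw [← integral_const_mul]
    have hM' : M = ∫ x in square p l, ∫ y in square p l, ‖u x y‖ ^ 2 := by
      exact hM.trans (kswap hK (f := fun x y => ‖u x y‖ ^ 2) cf).symm
    nth_rewrite 1 [hM]
    rw [← integral_mul_const]
    refine setIntegral_mono_on (kint hK ?_) (kint hK ?_) hK.measurableSet fun y0 hy0 => ?_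
    · exact continuous_const.mul (kcont hK cF2)
    · exact (kcont hK (f := fun y x => ‖u x y‖ ^ 2)
        (cf.comp continuous_swap)).mul continuous_const
    · have := exchange hK hu hA (v := fun x => u x y0)
        (hu.comp (by fun_prop : Continuous fun x : E2 => (x, y0)))
      rw [← hM'] at this
      exact this
  have h2 : ∫ y0 in square p l, ∫ y in square p l, ‖F y0 y‖ ≤
      ∫ y0 in square p l, ∫ y in square p l,
        ((2 * l ^ 2 / (3 * M)) * ‖F y0 y‖ ^ 2 + 3 * M / (8 * l ^ 2)) := by
    refine kmono hK cF.norm ((continuous_const.mul cF2).add continuous_const) fun y0 _ y _ => ?_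
    generalize ‖F y0 y‖ = t
    have : 0 ≤ (2 * l ^ 2 / (3 * M)) * (t - 3 * M / (4 * l ^ 2)) ^ 2 := by positivity
    have e : (2 * l ^ 2 / (3 * M)) * (t - 3 * M / (4 * l ^ 2)) ^ 2 =
      (2 * l ^ 2 / (3 * M)) * t ^ 2 + 3 * M / (8 * l ^ 2) - t := by field_simp; ring
    linarith
  refine h2.trans ?_
  have k1 : Continuous fun q : E2 × E2 => (2 * l ^ 2 / (3 * M)) * ‖F q.1 q.2‖ ^ 2 :=
    continuous_const.mul cF2
  rw [kadd hK k1 (g := fun _ _ => 3 * M / (8 * l ^ 2)) continuous_const, kmul]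
  simp_rw [kconst p hl.le]
  have h3 : (2 * l ^ 2 / (3 * M)) * ∫ y0 in square p l, ∫ y in square p l, ‖F y0 y‖ ^ 2 ≤
      (2 * l ^ 2 / (3 * M)) * (M * M / 2) := by
    gcongr; linarith
  have e1 : (2 * l ^ 2 / (3 * M)) * (M * M / 2) = l ^ 2 * M / 3 := by field_simp
  have e2 : l ^ 2 * (l ^ 2 * (3 * M / (8 * l ^ 2))) = 3 / 8 * (l ^ 2 * M) := by field_simp
  rw [e2]
  linarith

open ComplexConjugate in
theorem regI (hl : 0 < l) (hu : Continuous fun p : E2 × E2 => u p.1 p.2)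
    (hA : ∀ x y, u y x = - u x y)
    (hd : ∀ c, Continuous fun p : E2 × E2 => d c p.1 p.2)
    (hu1 : ∀ y, ContDiff ℝ 1 fun x => u x y)
    (h : ∀ c x y, d c x y = -Complex.I * fderiv ℝ (fun x => u x y) x (basisVec c) +
      (a c x y : ℝ) * u x y)
    (hk : ∀ c, ∀ x ∈ square p l, ∀ y ∈ square p l, ∀ y0 ∈ square p l,
      |a c x y0 - a c x y| ≤ 1 / (50 * l)) :
    ∫ x in square p l, ∫ y in square p l, ‖u x y‖ ^ 2 ≤
      600 * l ^ 2 * ∫ x in square p l, ∫ y in square p l, ∑ c, ‖d c x y‖ ^ 2 := by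
  have hK := isCompact_square p l
  have cf : Continuous fun p : E2 × E2 => ‖u p.1 p.2‖ ^ 2 := hu.norm.pow 2
  have ce : Continuous fun p : E2 × E2 => ∑ c, ‖d c p.1 p.2‖ ^ 2 :=
    continuous_finsetSum _ fun c _ => (hd c).norm.pow 2
  rw [kswap hK (f := fun x y => ‖u x y‖ ^ 2) cf, kswap hK (f := fun x y => ∑ c, ‖d c x y‖ ^ 2) ce]
  have hdiff := regI_diff (p := p) hl hu hA hd hu1 h
  have hF := regI_F (p := p) hl hu hA rfl
  set m : E2 → ℝ := fun y => ∫ x in square p l, ‖u x y‖ ^ 2 with hm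
  set e : E2 → ℝ := fun y => ∫ x in square p l, ∑ c, ‖d c x y‖ ^ 2 with he
  have cm : Continuous m := kcont hK (f := fun y x => ‖u x y‖ ^ 2) (cf.comp continuous_swap)
  have cee : Continuous e := kcont hK (f := fun y x => ∑ c, ‖d c x y‖ ^ 2) (ce.comp continuous_swap)
  have cm1 : Continuous fun q : E2 × E2 => m q.1 := cm.comp continuous_fst
  have cm2 : Continuous fun q : E2 × E2 => m q.2 := cm.comp continuous_snd
  have ce1 : Continuous fun q : E2 × E2 => e q.1 := cee.comp continuous_fst
  have ce2 : Continuous fun q : E2 × E2 => e q.2 := cee.comp continuous_snd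
  set M := ∫ y in square p l, m y with hM
  set E := ∫ y in square p l, e y with hE
  have hE0 : 0 ≤ E := integral_nonneg fun y => integral_nonneg fun x =>
    Finset.sum_nonneg fun c _ => by positivity
  rcases le_or_gt M 0 with h0 | h0
  · exact h0.trans (by positivity)
  have hF := hF h0
  have c3 : Continuous fun q : (E2 × E2) × E2 => conj (u q.2 q.1.1) * u q.2 q.1.2 :=
    (Complex.continuous_conj.comp
      (hu.comp (by fun_prop : Continuous fun q : (E2 × E2) × E2 => (q.2, q.1.1)))).mul
      (hu.comp (by fun_prop : Continuous fun q : (E2 × E2) × E2 => (q.2, q.1.2)))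
  have c31 : Continuous fun q : (E2 × E2) × E2 => ‖u q.2 q.1.1‖ ^ 2 :=
      (cf.comp (by fun_prop : Continuous fun q : (E2 × E2) × E2 => (q.2, q.1.1)))
  have c32 : Continuous fun q : (E2 × E2) × E2 => ‖u q.2 q.1.2‖ ^ 2 :=
      (cf.comp (by fun_prop : Continuous fun q : (E2 × E2) × E2 => (q.2, q.1.2)))
  have c33 : Continuous fun q : (E2 × E2) × E2 => |‖u q.2 q.1.2‖ ^ 2 - ‖u q.2 q.1.1‖ ^ 2| :=
    (c32.sub c31).abs
  have c34 : Continuous fun q : (E2 × E2) × E2 => ‖u q.2 q.1.1‖ * ‖u q.2 q.1.2‖ :=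
    c3.norm.congr fun q => by rw [norm_mul, Complex.norm_conj]
  set F : E2 → E2 → ℂ := fun y0 y => ∫ x in square p l, conj (u x y0) * u x y with hFd
  set D : E2 → E2 → ℝ := fun y0 y => ∫ x in square p l, |‖u x y‖ ^ 2 - ‖u x y0‖ ^ 2| with hD
  have cF : Continuous fun q : E2 × E2 => ‖F q.1 q.2‖ :=
    (kcont (Y := E2 × E2) hK (f := fun q x => conj (u x q.1) * u x q.2) c3).norm
  have cD : Continuous fun q : E2 × E2 => D q.1 q.2 :=
    kcont (Y := E2 × E2) hK (f := fun q x => |‖u x q.2‖ ^ 2 - ‖u x q.1‖ ^ 2|) c33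
  have cR : Continuous fun q : E2 × E2 => (9 / 200) * (m q.2 + m q.1) + 20 * l ^ 2 * (e q.2 + e q.1) :=
    (continuous_const.mul (cm2.add cm1)).add (continuous_const.mul (ce2.add ce1))
  have main : ∫ y0 in square p l, ∫ y in square p l, m y ≤
      ∫ y0 in square p l, ∫ y in square p l, (D y0 y + (‖F y0 y‖ +
        ((9 / 200) * (m y + m y0) + 20 * l ^ 2 * (e y + e y0)))) := by
    refine kmono hK (f := fun _ y => m y) cm2 (cD.add (cF.add cR)) fun y0 hy0 y hy => ?_
    have s1 := regI_step1 hl hu hd hu1 h hk hy hy0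
    refine le_trans ?_ (add_le_add le_rfl s1)
    rw [hD, hm]
    dsimp only
    have sc : Continuous fun x : E2 => ((y0, y), x) := by fun_prop
    have k33 : Continuous fun x => |‖u x y‖ ^ 2 - ‖u x y0‖ ^ 2| := c33.comp sc
    have k34 : Continuous fun x => ‖u x y0‖ * ‖u x y‖ := c34.comp sc
    rw [← integral_add (kint hK k33) (kint hK k34)]
    refine setIntegral_mono_on (kint hK (c32.comp sc)) (kint hK ((c33.add c34).comp sc))
      hK.measurableSet fun x _ => ?_
    show ‖u x y‖ ^ 2 ≤ |‖u x y‖ ^ 2 - ‖u x y0‖ ^ 2| + ‖u x y0‖ * ‖u x y‖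
    have n1 := norm_nonneg (u x y)
    have n2 := norm_nonneg (u x y0)
    rcases le_total ‖u x y‖ ‖u x y0‖ with g | g
    · have := abs_nonneg (‖u x y‖ ^ 2 - ‖u x y0‖ ^ 2)
      nlinarith
    · have := le_abs_self (‖u x y‖ ^ 2 - ‖u x y0‖ ^ 2)
      nlinarith
  have k1 : Continuous fun q : E2 × E2 => (9 / 200) * (m q.2 + m q.1) :=
    continuous_const.mul (cm2.add cm1)
  have k2 : Continuous fun q : E2 × E2 => 20 * l ^ 2 * (e q.2 + e q.1) :=
    continuous_const.mul (ce2.add ce1)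
  rw [kadd hK cD (cF.add cR), kadd hK cF cR, kadd hK k1 k2, kmul, kmul,
    kadd hK (f := fun _ y => m y) (g := fun y0 _ => m y0) cm2 cm1,
    kadd hK (f := fun _ y => e y) (g := fun y0 _ => e y0) ce2 ce1] at main
  simp_rw [kconst p hl.le, integral_const_mul] at main
  rw [← hM, ← hE] at main
  have hl2 : 0 < l ^ 2 := by positivity
  have : l ^ 2 * M ≤ l ^ 2 * (600 * l ^ 2 * E) := by
    nlinarith [mul_nonneg hl2.le (mul_nonneg hl2.le hE0)]
  exact le_of_mul_le_mul_left this hl2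
end


theorem klint {K : Set E2} (hK : IsCompact K) {g : E2 → E2 → ℝ}
    (hg : Continuous fun p : E2 × E2 => g p.1 p.2) (h0 : ∀ x y, 0 ≤ g x y) :
    ∫⁻ x in K, ∫⁻ y in K, ENNReal.ofReal (g x y) = ENNReal.ofReal (∫ x in K, ∫ y in K, g x y) := by
  rw [ofReal_integral_eq_lintegral_ofReal (kint hK (kcont hK hg))
    (Filter.Eventually.of_forall fun x => integral_nonneg fun y => h0 x y)]
  congr 1; ext x
  have k : Continuous fun y => g x y := hg.comp (by fun_prop : Continuous fun y : E2 => (x, y))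
  rw [ofReal_integral_eq_lintegral_ofReal (kint hK k)
    (Filter.Eventually.of_forall fun y => h0 x y)]

section
variable {N : ℕ} {X : Fin N → E2} {j k : Fin N}

theorem bR_lin {R : ℝ} {p x y y0 : E2} {l : ℝ} (hl : 0 < l) (hRl : 10 * l ≤ R)
    (hx : x ∈ square p l) (hy : y ∈ square p l) (hy0 : y0 ∈ square p l) (c : Fin 2) :
    |bR R (x - y0) c - bR R (x - y) c| ≤ l / R ^ 2 := by
  have near : ∀ y ∈ square p l, regNorm R (x - y) = R := by
    intro y hy
    unfold regNorm
    refine max_eq_right ?_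
    have h0 := hx 0; have h1 := hx 1; have g0 := hy 0; have g1 := hy 1
    have e := normsq2 (x - y)
    have n := norm_nonneg (x - y)
    simp only [PiLp.sub_apply] at e
    have a0 : (x 0 - y 0) ^ 2 ≤ l ^ 2 := by
      apply sq_le_sq'; linarith [h0.1, g0.2]; linarith [h0.2, g0.1]
    have a1 : (x 1 - y 1) ^ 2 ≤ l ^ 2 := by
      apply sq_le_sq'; linarith [h1.1, g1.2]; linarith [h1.2, g1.1]
    nlinarith
  have hR : 0 < R := by linarith
  unfold bR
  rw [near y hy, near y0 hy0]
  have h0 := hy 0; have h1 := hy 1; have g0 := hy0 0; have g1 := hy0 1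
  simp only [PiLp.smul_apply, smul_eq_mul]
  rw [← mul_sub, abs_mul, abs_of_pos (by positivity), div_eq_mul_inv, mul_comm]
  gcongr
  fin_cases c
  · simp only [Fin.zero_eta, perp_0, PiLp.sub_apply]
    rw [abs_le]; constructor <;> linarith [h1.1, h1.2, g1.1, g1.2]
  · simp only [Fin.mk_one, perp_1, PiLp.sub_apply]
    rw [abs_le]; constructor <;> linarith [h0.1, h0.2, g0.1, g0.2]

/-- Two-body leaf, large radius. -/
theorem leafI {R α : ℝ} (h0 : 0 ≤ α) (h2 : α ≤ 2) {Ψ : (Fin N → E2) → ℂ}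
    (hΨ : ContDiff ℝ 1 Ψ) (hA : Antisym N Ψ) (hjk : j ≠ k) {p : E2} {l : ℝ} (hl : 0 < l)
    (hRl : 10 * l ≤ R) :
    ∫⁻ x in square p l, ∫⁻ y in square p l, fE Ψ (up2 X j k x y) ≤
      ENNReal.ofReal (600 * l ^ 2) * ∫⁻ x in square p l, ∫⁻ y in square p l,
        eE R α Ψ j (up2 X j k x y) := by
  have hR : 0 < R := by linarith
  have hK := isCompact_square p l
  have hu : Continuous fun p : E2 × E2 => Ψ (up2 X j k p.1 p.2) :=
    hΨ.continuous.comp continuous_up2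
  have hd : ∀ c, Continuous fun p : E2 × E2 => covD R α Ψ j (up2 X j k p.1 p.2) c := fun c =>
    (continuous_covD hR hΨ j c).comp continuous_up2
  have hup : ∀ x y, up2 X j k x y = Function.update (Function.update X k y) j x := fun x y => by
    rw [up2_comm hjk]; rfl
  have key := regI (u := fun x y => Ψ (up2 X j k x y)) (p := p)
    (d := fun c x y => covD R α Ψ j (up2 X j k x y) c)
    (a := fun c x y => α * Avec R (up2 X j k x y) j c) hl hu
    (fun x y => antisym_up2 hA hjk x y) hd (fun y => by
      simp_rw [hup]
      exact hΨ.comp (contDiff_update 1 _ _)) (fun c x y => by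
        simp_rw [hup]
        exact covD_update R α hΨ _ j x c) (fun c x hx y hy y0 hy0 => by
        simp only [Avec_up2_j R hjk, PiLp.add_apply]
        rw [← mul_sub, abs_mul, abs_of_nonneg h0, add_sub_add_right_eq_sub]
        have := bR_lin hl hRl hx hy hy0 c
        calc α * |bR R (x - y0) c - bR R (x - y) c| ≤ 2 * (l / R ^ 2) := by gcongr
          _ ≤ 2 * (l / (10 * l) ^ 2) := by gcongr
          _ = 1 / (50 * l) := by field_simp; norm_num)
  unfold fE eE
  rw [klint hK (g := fun x y => ‖Ψ (up2 X j k x y)‖ ^ 2) (hu.norm.pow 2) (fun x y => by positivity),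
    klint hK (g := fun x y => ∑ c, ‖covD R α Ψ j (up2 X j k x y) c‖ ^ 2)
      (continuous_finsetSum _ fun c _ => (hd c).norm.pow 2)
      (fun x y => Finset.sum_nonneg fun c _ => by positivity),
    ← ENNReal.ofReal_mul (by positivity)]
  exact ENNReal.ofReal_le_ofReal key

/-- shift of a corner by `t` in both directions -/
def sh (p : E2) (t : ℝ) : E2 := !₂[p 0 + t, p 1 + t]

theorem sh_apply (p : E2) (t : ℝ) (i : Fin 2) : sh p t i = p i + t := by
  fin_cases i <;> simp [sh]

theorem lint2_mono {S T : Set E2} (hS : S ⊆ T) {F G : E2 → E2 → ENNReal} (h : ∀ x y, F x y ≤ G x y) :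
    ∫⁻ x in S, ∫⁻ y in S, F x y ≤ ∫⁻ x in T, ∫⁻ y in T, G x y :=
  (lintegral_mono_set hS).trans (lintegral_mono fun x =>
    (lintegral_mono_set hS).trans (lintegral_mono fun y => h x y))

theorem pairLeaf {R α : ℝ} (hR : 0 < R) (h0 : 0 ≤ α) (h2 : α ≤ 2) {Ψ : (Fin N → E2) → ℂ}
    (hΨ : ContDiff ℝ 1 Ψ) (hA : Antisym N Ψ) (hjk : j ≠ k) {p : E2} {l : ℝ} (hl : 0 < l)
    (hfar : ∀ m, m ≠ j → m ≠ k → X m ∉ box p (32 * l) ∨ X m ∈ box p l) :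
    ENNReal.ofReal |α - 1| * ∫⁻ x in box (sh p (31 / 2 * l)) l, ∫⁻ y in box (sh p (31 / 2 * l)) l,
        fE Ψ (up2 X j k x y) ≤
      ENNReal.ofReal (600 * l ^ 2) * ∫⁻ x in box p (32 * l), ∫⁻ y in box p (32 * l),
        (eE R α Ψ j (up2 X j k x y) + eE R α Ψ k (up2 X j k x y)) := by
  rcases le_total R (10 * l) with hRl | hRl
  · refine (leafII hR h0 h2 hΨ hA hjk (q := sh p (16 * l)) hl hRl ?_ (measurableSet_box _ _)
      (measurableSet_box _ _) ?_ ?_).trans (mul_le_mul_left (ENNReal.ofReal_le_ofReal (by nlinarith)) _)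
    · intro m hm hm'
      have e := normsq2 (X m - sh p (16 * l))
      have n := norm_nonneg (X m - sh p (16 * l))
      simp only [PiLp.sub_apply, sh_apply] at e
      rcases hfar m hm hm' with h | h
      · have : ∃ i, ¬ (X m i ∈ Set.Ico (p i) (p i + 32 * l)) := by
          by_contra hc; push Not at hc; exact h hc
        obtain ⟨i, hi⟩ := this
        have h3 : (16 * l) ^ 2 ≤ (X m i - (p i + 16 * l)) ^ 2 := by
          rw [Set.mem_Ico, not_and_or] at hi
          rcases hi with hi | hi
          · push Not at hi; nlinarith
          · push Not at hi; nlinarith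
        have h4 : (16 * l) ^ 2 ≤ ‖X m - sh p (16 * l)‖ ^ 2 := by
          rw [e]
          fin_cases i
          · exact h3.trans (le_add_of_nonneg_right (sq_nonneg _))
          · exact h3.trans (le_add_of_nonneg_left (sq_nonneg _))
        exact le_of_sq_le_sq h4 n
      · have g0 := (h 0).2; have g1 := (h 1).2
        have h3 : (15 * l) ^ 2 ≤ (X m 0 - (p 0 + 16 * l)) ^ 2 := by nlinarith
        have h4 : (15 * l) ^ 2 ≤ (X m 1 - (p 1 + 16 * l)) ^ 2 := by nlinarith
        refine le_of_sq_le_sq (a := 16 * l) ?_ n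
        nlinarith
    · intro x hx
      have e := normsq2 (x - sh p (16 * l))
      have n := norm_nonneg (x - sh p (16 * l))
      simp only [PiLp.sub_apply, sh_apply] at e
      have g0 := hx 0; have g1 := hx 1
      rw [Set.mem_Ico, sh_apply] at g0 g1
      rw [mem_ball_iff_norm]
      have h3 : (x 0 - (p 0 + 16 * l)) ^ 2 ≤ (l / 2) ^ 2 := by
        apply sq_le_sq' <;> linarith
      have h4 : (x 1 - (p 1 + 16 * l)) ^ 2 ≤ (l / 2) ^ 2 := by
        apply sq_le_sq' <;> linarith
      nlinarith
    · intro x hx i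
      rw [mem_ball_iff_norm] at hx
      have e := normsq2 (x - sh p (16 * l))
      have n := norm_nonneg (x - sh p (16 * l))
      simp only [PiLp.sub_apply, sh_apply] at e
      have h3 : (x i - (p i + 16 * l)) ^ 2 ≤ (2 * l) ^ 2 := by
        have : (x i - (p i + 16 * l)) ^ 2 ≤ ‖x - sh p (16 * l)‖ ^ 2 := by
          rw [e]
          fin_cases i
          · exact (le_add_of_nonneg_right (sq_nonneg _))
          · exact (le_add_of_nonneg_left (sq_nonneg _))
        nlinarith
      have h4 := abs_le_of_sq_le_sq' h3 (by positivity)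
      constructor <;> linarith [h4.1, h4.2]
  · have hα : ENNReal.ofReal |α - 1| ≤ 1 := by
      rw [ENNReal.ofReal_le_one, abs_le]; constructor <;> linarith
    refine (mul_le_mul_left hα _).trans ?_
    rw [one_mul]
    have hs : box (sh p (31 / 2 * l)) l ⊆ square (sh p (31 / 2 * l)) l := fun x hx i =>
      ⟨(hx i).1, (hx i).2.le⟩
    refine (lint2_mono hs fun x y => le_rfl).trans
      ((leafI h0 h2 hΨ hA hjk hl hRl).trans (mul_le_mul_right ?_ _))
    refine lint2_mono ?_ fun x y => le_self_add
    intro x hx i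
    have := hx i
    rw [Set.mem_Icc, sh_apply] at this
    constructor <;> linarith [this.1, this.2]
end


section
variable {N : ℕ} {R α : ℝ} {Ψ : (Fin N → E2) → ℂ}

theorem meas_mem (i : Fin N) {Q : Set E2} (hQ : MeasurableSet Q) :
    MeasurableSet {X : Fin N → E2 | X i ∈ Q} := hQ.preimage (measurable_pi_apply i)

theorem iterTransport (hR : 0 < R) (hΨ : ContDiff ℝ 1 Ψ) {p : E2} {L l : ℝ} (hl : 0 < l)
    (hL : L = 32 * l) (t : Fin N → E2) (hq : ∀ m i, p i ≤ t m i)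
    (hql : ∀ m i, t m i + l ≤ p i + L) {Γ : Set (Fin N → E2)}
    (hΓ : MeasurableSet Γ) (S : Finset (Fin N)) (h1 : ∀ j ∈ S, ∀ X ∈ Γ, X j ∈ box p L)
    (h2 : ∀ j ∈ S, ∀ X ∈ Γ, ∀ x ∈ box p L, Function.update X j x ∈ Γ) :
    (∫⁻ X in Γ, fE Ψ X) ≤ 5000 ^ S.card *
      ((∫⁻ X in Γ ∩ {X | ∀ i ∈ S, X i ∈ box (t i) l}, fE Ψ X) +
      ENNReal.ofReal (L ^ 2) * ∑ i ∈ S, ∫⁻ X in Γ, eE R α Ψ i X) := by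
  classical
  induction S using Finset.induction_on with
  | empty => simp
  | insert a S ha ih =>
    have ih := ih (fun j hj => h1 j (Finset.mem_insert_of_mem hj))
      (fun j hj => h2 j (Finset.mem_insert_of_mem hj))
    have hm : MeasurableSet {X : Fin N → E2 | ∀ i ∈ S, X i ∈ box (t i) l} := by
      have : {X : Fin N → E2 | ∀ i ∈ S, X i ∈ box (t i) l} =
        ⋂ i ∈ S, {X : Fin N → E2 | X i ∈ box (t i) l} := by ext; simp
      rw [this]
      exact Finset.measurableSet_biInter _ fun i _ => meas_mem i (measurableSet_box _ _)
    have tr := transportN (R := R) (α := α) hR hΨ a hl hL (hq a) (hql a) (hΓ.inter hm)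
      (fun X hX => h1 a (Finset.mem_insert_self _ _) X hX.1) (by
        intro X hX x hx
        refine ⟨h2 a (Finset.mem_insert_self _ _) X hX.1 x hx, ?_⟩
        intro i hi
        have : i ≠ a := fun h => ha (h ▸ hi)
        rw [Function.update_of_ne this]
        exact hX.2 i hi)
    have es : Γ ∩ {X | ∀ i ∈ S, X i ∈ box (t i) l} ∩ {X | X a ∈ box (t a) l} =
        Γ ∩ {X | ∀ i ∈ insert a S, X i ∈ box (t i) l} := by
      ext X; simp only [Set.mem_inter_iff, Set.mem_ofPred_eq, Finset.forall_mem_insert]; tauto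
    rw [es] at tr
    have m1 : ∫⁻ X in Γ ∩ {X | ∀ i ∈ S, X i ∈ box (t i) l}, eE R α Ψ a X ≤
      ∫⁻ X in Γ, eE R α Ψ a X := lintegral_mono_set Set.inter_subset_left
    rw [Finset.sum_insert ha, Finset.card_insert_of_notMem ha]
    generalize (∫⁻ X in Γ ∩ {X | ∀ i ∈ S, X i ∈ box (t i) l}, fE Ψ X) = A at *
    generalize (∫⁻ X in Γ ∩ {X | ∀ i ∈ insert a S, X i ∈ box (t i) l}, fE Ψ X) = B at *
    generalize ∫⁻ X in Γ ∩ {X | ∀ i ∈ S, X i ∈ box (t i) l}, eE R α Ψ a X = D at *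
    generalize ∫⁻ X in Γ, eE R α Ψ a X = D' at *
    generalize ∑ i ∈ S, ∫⁻ X in Γ, eE R α Ψ i X = E at *
    generalize ENNReal.ofReal (L ^ 2) = K at *
    calc (∫⁻ X in Γ, fE Ψ X) ≤ 5000 ^ S.card * (A + K * E) := ih
      _ ≤ 5000 ^ S.card * (5000 * (B + K * D') + 5000 * (K * E)) := by
        refine mul_le_mul_right (add_le_add (tr.trans (mul_le_mul_right
          (add_le_add le_rfl (mul_le_mul_right m1 _)) _)) ?_) _
        exact le_mul_of_one_le_left (zero_le) (by norm_num)
      _ = _ := by ring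

/-- invariance under moving one particle inside `Q` -/
def QInv (Q : Set E2) (Ω : Set (Fin N → E2)) : Prop :=
  ∀ X ∈ Ω, ∀ j, X j ∈ Q → ∀ x ∈ Q, Function.update X j x ∈ Ω

open Classical in
/-- the set of particles in `Q` -/
def pat (Q : Set E2) (X : Fin N → E2) : Finset (Fin N) := Finset.univ.filter fun i => X i ∈ Q

theorem mem_pat {Q : Set E2} {X : Fin N → E2} {i : Fin N} : i ∈ pat Q X ↔ X i ∈ Q := by
  simp [pat]

theorem measurable_pat {Q : Set E2} (hQ : MeasurableSet Q) (A : Finset (Fin N)) :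
    MeasurableSet {X : Fin N → E2 | pat Q X = A} := by
  have : {X : Fin N → E2 | pat Q X = A} =
      ⋂ i, {X : Fin N → E2 | X i ∈ Q ↔ i ∈ A} := by
    ext X; simp [Finset.ext_iff, mem_pat]
  rw [this]
  refine MeasurableSet.iInter fun i => ?_
  by_cases h : i ∈ A
  · simp only [h, iff_true]; exact meas_mem i hQ
  · simp only [h, iff_false]; exact (meas_mem i hQ).compl

theorem pat_update {Q : Set E2} {X : Fin N → E2} {j : Fin N} (hj : X j ∈ Q) {x : E2} (hx : x ∈ Q) :
    pat Q (Function.update X j x) = pat Q X := by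
  ext i
  rw [mem_pat, mem_pat]
  by_cases h : i = j
  · subst h; simp [hx, hj]
  · rw [Function.update_of_ne h]

theorem lint_pat {Q : Set E2} (hQ : MeasurableSet Q) (Ω : Set (Fin N → E2))
    (h : (Fin N → E2) → ENNReal) :
    ∫⁻ X in Ω, h X = ∑ A : Finset (Fin N), ∫⁻ X in Ω ∩ {X | pat Q X = A}, h X := by
  have e : Ω = ⋃ A ∈ (Finset.univ : Finset (Finset (Fin N))), (Ω ∩ {X | pat Q X = A}) := by
    ext X; simp
  have : ∀ A : Finset (Fin N), ∫⁻ X in Ω ∩ {X | pat Q X = A}, h X =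
      ∫⁻ X in {X | pat Q X = A}, h X ∂(volume.restrict Ω) := fun A => by
    rw [Measure.restrict_restrict (measurable_pat hQ A), Set.inter_comm]
  simp_rw [this]
  rw [← lintegral_biUnion_finset]
  · have : (⋃ A ∈ (Finset.univ : Finset (Finset (Fin N))), {X : Fin N → E2 | pat Q X = A}) =
      Set.univ := by ext X; simp
    rw [this, Measure.restrict_univ]
  · intro A _ B _ hAB
    refine Set.disjoint_left.2 fun X h1 h2 => hAB ?_
    exact h1.symm.trans h2
  · intro A _; exact measurable_pat hQ A

open Classical in
theorem pairStep (hR : 0 < R) (h0 : 0 ≤ α) (h2 : α ≤ 2)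
    (hΨ : ContDiff ℝ 1 Ψ) (hA : Antisym N Ψ) {p : E2} {l : ℝ} (hl : 0 < l)
    {Ω : Set (Fin N → E2)} (hΩ : MeasurableSet Ω) (hI : QInv (box p (32 * l)) Ω)
    {A : Finset (Fin N)} {j k : Fin N} (hj : j ∈ A) (hk : k ∈ A) (hjk : j ≠ k)
    {Γ : Set (Fin N → E2)} (hΓ : Γ = Ω ∩ {X | pat (box p (32 * l)) X = A})
    (t : Fin N → E2) (ht : ∀ m, t m = if m = j ∨ m = k then sh p (31 / 2 * l) else p) :
    ENNReal.ofReal |α - 1| * ∫⁻ X in Γ ∩ {X | ∀ i ∈ A, X i ∈ box (t i) l}, fE Ψ X ≤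
      ENNReal.ofReal (600 * l ^ 2) * ((∫⁻ X in Γ, eE R α Ψ j X) + ∫⁻ X in Γ, eE R α Ψ k X) := by
  have hΓm : MeasurableSet Γ := by
    rw [hΓ]; exact hΩ.inter (measurable_pat (measurableSet_box _ _) _)
  have hTm : MeasurableSet {X : Fin N → E2 | ∀ i ∈ A, X i ∈ box (t i) l} := by
    have : {X : Fin N → E2 | ∀ i ∈ A, X i ∈ box (t i) l} =
      ⋂ i ∈ A, {X : Fin N → E2 | X i ∈ box (t i) l} := by ext; simp
    rw [this]
    exact Finset.measurableSet_biInter _ fun i _ => meas_mem i (measurableSet_box _ _)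
  have hGm := hΓm.inter hTm
  have me : Measurable fun X => eE R α Ψ j X + eE R α Ψ k X :=
    (measurable_eE hR hΨ j).add (measurable_eE hR hΨ k)
  rw [← lintegral_add_left (measurable_eE hR hΨ j), ← lintegral_indicator hGm,
    ← lintegral_indicator hΓm, ← lintegral_const_mul' _ _ ENNReal.ofReal_ne_top,
    ← lintegral_const_mul' _ _ ENNReal.ofReal_ne_top]
  have mF : Measurable fun X => ENNReal.ofReal |α - 1| *
      (Γ ∩ {X | ∀ i ∈ A, X i ∈ box (t i) l}).indicator (fE Ψ) X :=
    ((measurable_fE hΨ).indicator hGm).const_mul _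
  have mG : Measurable fun X => ENNReal.ofReal (600 * l ^ 2) *
      Γ.indicator (fun X => eE R α Ψ j X + eE R α Ψ k X) X := (me.indicator hΓm).const_mul _
  refine lintegral_le_of_lmarginal_le {j, k} mF mG fun X => ?_
  have hjk' : j ∉ ({k} : Finset (Fin N)) := by simpa using hjk
  rw [lmarginal_insert _ mF hjk', lmarginal_insert _ mG hjk']
  simp_rw [lmarginal_singleton]
  change ∫⁻ x, ∫⁻ y, ENNReal.ofReal |α - 1| * (Γ ∩ {X | ∀ i ∈ A, X i ∈ box (t i) l}).indicator
      (fE Ψ) (up2 X j k x y) ≤ ∫⁻ x, ∫⁻ y, ENNReal.ofReal (600 * l ^ 2) *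
      Γ.indicator (fun X => eE R α Ψ j X + eE R α Ψ k X) (up2 X j k x y)
  simp_rw [lintegral_const_mul' _ _ ENNReal.ofReal_ne_top]
  by_cases hex : ∃ x y, up2 X j k x y ∈ Γ ∩ {X | ∀ i ∈ A, X i ∈ box (t i) l}
  · obtain ⟨x0, y0, hY⟩ := hex
    have hYΓ := hY.1
    rw [hΓ] at hYΓ
    have hfar : ∀ m, m ≠ j → m ≠ k → X m ∉ box p (32 * l) ∨ X m ∈ box p l := by
      intro m hm hm'
      have e : up2 X j k x0 y0 m = X m := up2_o hm hm' _ _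
      by_cases hmA : m ∈ A
      · right
        have := hY.2 m hmA
        rw [ht, e] at this
        simpa [hm, hm'] using this
      · left
        have h3 : pat (box p (32 * l)) (up2 X j k x0 y0) = A := hYΓ.2
        rw [← h3, mem_pat, e] at hmA
        exact hmA
    refine le_trans ?_ ((pairLeaf (X := X) hR h0 h2 hΨ hA hjk hl hfar).trans ?_)
    · refine mul_le_mul_right ?_ _
      rw [← lintegral_indicator (measurableSet_box _ _)]
      refine lintegral_mono fun x => ?_
      by_cases hx : x ∈ box (sh p (31 / 2 * l)) l
      · rw [Set.indicator_of_mem hx, ← lintegral_indicator (measurableSet_box _ _)]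
        refine lintegral_mono fun y => ?_
        by_cases hy : up2 X j k x y ∈ Γ ∩ {X | ∀ i ∈ A, X i ∈ box (t i) l}
        · rw [Set.indicator_of_mem hy, Set.indicator_of_mem]
          have := hy.2 k hk
          rw [up2_k, ht] at this
          simpa using this
        · rw [Set.indicator_of_notMem hy]; exact zero_le
      · refine le_of_eq_of_le ?_ zero_le
        have : ∀ y, (Γ ∩ {X | ∀ i ∈ A, X i ∈ box (t i) l}).indicator
            (fE Ψ) (up2 X j k x y) = 0 := by
          intro y
          refine Set.indicator_of_notMem (fun hy => hx ?_) _
          have := hy.2 j hj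
          rw [up2_j hjk, ht] at this
          simpa using this
        simp_rw [this]; simp
    · refine mul_le_mul_right ?_ _
      have hin : ∀ x ∈ box p (32 * l), ∀ y ∈ box p (32 * l), up2 X j k x y ∈ Γ := by
        intro x hx y hy
        have hYj : up2 X j k x0 y0 j ∈ box p (32 * l) := by
          rw [← mem_pat, hYΓ.2]; exact hj
        have hYk : up2 X j k x0 y0 k ∈ box p (32 * l) := by
          rw [← mem_pat, hYΓ.2]; exact hk
        have e : up2 X j k x y = Function.update (Function.update (up2 X j k x0 y0) j x) k y := by
          ext1 m
          by_cases h1 : m = k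
          · subst h1; simp [up2]
          · by_cases h2 : m = j
            · subst h2; simp [up2, h1]
            · simp [up2, h1, h2]
        have hYk' : Function.update (up2 X j k x0 y0) j x k ∈ box p (32 * l) := by
          rw [Function.update_of_ne hjk.symm]; exact hYk
        rw [e, hΓ]
        refine ⟨hI _ (hI _ hYΓ.1 j hYj x hx) k hYk' y hy, ?_⟩
        show pat _ _ = A
        rw [pat_update hYk' hy, pat_update hYj hx]
        exact hYΓ.2
      rw [← lintegral_indicator (measurableSet_box _ _)]
      refine lintegral_mono fun x => ?_
      by_cases hx : x ∈ box p (32 * l)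
      · rw [Set.indicator_of_mem hx, ← lintegral_indicator (measurableSet_box _ _)]
        refine lintegral_mono fun y => ?_
        by_cases hy : y ∈ box p (32 * l)
        · rw [Set.indicator_of_mem hy, Set.indicator_of_mem (hin x hx y hy)]
        · rw [Set.indicator_of_notMem hy]; exact zero_le
      · rw [Set.indicator_of_notMem hx]; exact zero_le
  · push Not at hex
    refine le_of_eq_of_le ?_ zero_le
    have : ∀ x y, (Γ ∩ {X | ∀ i ∈ A, X i ∈ box (t i) l}).indicator
        (fE Ψ) (up2 X j k x y) = 0 := fun x y => Set.indicator_of_notMem (hex x y) _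
    simp_rw [this]; simp
end


section
variable {N : ℕ} {R α : ℝ} {Ψ : (Fin N → E2) → ℂ}

/-- local kinetic energy density of the particles in `Q` -/
def eQ (R α : ℝ) (Ψ : (Fin N → E2) → ℂ) (Q : Set E2) (X : Fin N → E2) : ENNReal :=
  ∑ j, {X : Fin N → E2 | X j ∈ Q}.indicator (eE R α Ψ j) X

/-- the constant of the local exclusion principle -/
def KB : ENNReal := 6 * 5000 ^ 4

theorem basePat (hR : 0 < R) (h0 : 0 ≤ α) (h2 : α ≤ 2)
    (hΨ : ContDiff ℝ 1 Ψ) (hA : Antisym N Ψ) {p : E2} {L : ℝ} (hL : 0 < L)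
    {Ω : Set (Fin N → E2)} (hΩ : MeasurableSet Ω) (hI : QInv (box p L) Ω)
    {A : Finset (Fin N)} (hA2 : 2 ≤ A.card) (hA4 : A.card ≤ 4) :
    ENNReal.ofReal |α - 1| * ∫⁻ X in Ω ∩ {X | pat (box p L) X = A}, fE Ψ X ≤
      2 * 5000 ^ 4 * ENNReal.ofReal (L ^ 2) *
        ∫⁻ X in Ω ∩ {X | pat (box p L) X = A}, eQ R α Ψ (box p L) X := by
  classical
  obtain ⟨l, rfl⟩ : ∃ l, L = 32 * l := ⟨L / 32, by ring⟩
  have hl : 0 < l := by linarith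
  obtain ⟨j, hj, k, hk, hjk⟩ := Finset.one_lt_card.1 (show 1 < A.card by omega)
  set Γ := Ω ∩ {X | pat (box p (32 * l)) X = A} with hΓ
  have hΓm : MeasurableSet Γ := hΩ.inter (measurable_pat (measurableSet_box _ _) _)
  set t : Fin N → E2 := fun m => if m = j ∨ m = k then sh p (31 / 2 * l) else p with ht
  have hps := pairStep hR h0 h2 hΨ hA hl hΩ hI hj hk hjk hΓ t (fun m => rfl)
  have hin : ∀ i ∈ A, ∀ X ∈ Γ, X i ∈ box p (32 * l) := fun i hi X hX => by
    rw [← mem_pat, hX.2]; exact hi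
  have htr := iterTransport (α := α) hR hΨ hl rfl t (p := p) (fun m i => by
      rw [ht]; dsimp only; split_ifs
      · rw [sh_apply]; linarith
      · exact le_rfl) (fun m i => by
      rw [ht]; dsimp only; split_ifs
      · rw [sh_apply]; linarith
      · linarith) hΓm A hin (fun i hi X hX x hx => ⟨hI X hX.1 i (hin i hi X hX) x hx, by
        show pat _ _ = A
        rw [pat_update (hin i hi X hX) hx]; exact hX.2⟩)
  have hsum : ∑ i ∈ A, ∫⁻ X in Γ, eE R α Ψ i X ≤ ∫⁻ X in Γ, eQ R α Ψ (box p (32 * l)) X := by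
    rw [← lintegral_finsetSum _ fun i _ => measurable_eE hR hΨ i]
    refine setLIntegral_mono' hΓm fun X hX => ?_
    unfold eQ
    refine le_trans (Finset.sum_le_sum fun i hi => ?_)
      (Finset.sum_le_univ_sum_of_nonneg fun i => zero_le)
    rw [Set.indicator_of_mem]
    exact hin i hi X hX
  have hpair : (∫⁻ X in Γ, eE R α Ψ j X) + ∫⁻ X in Γ, eE R α Ψ k X ≤
      ∑ i ∈ A, ∫⁻ X in Γ, eE R α Ψ i X := by
    rw [← Finset.sum_pair hjk (f := fun i => ∫⁻ X in Γ, eE R α Ψ i X)]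
    exact Finset.sum_le_sum_of_subset (by
      intro i hi; simp only [Finset.mem_insert, Finset.mem_singleton] at hi
      rcases hi with rfl | rfl <;> assumption)
  have hν : ENNReal.ofReal |α - 1| ≤ 1 := by
    rw [ENNReal.ofReal_le_one, abs_le]; constructor <;> linarith
  have hc : (5000:ENNReal) ^ A.card ≤ 5000 ^ 4 := pow_le_pow_right₀ (by norm_num) hA4
  have hll : ENNReal.ofReal (600 * l ^ 2) ≤ ENNReal.ofReal ((32 * l) ^ 2) :=
    ENNReal.ofReal_le_ofReal (by nlinarith)
  generalize (∫⁻ X in Γ, eE R α Ψ j X) + ∫⁻ X in Γ, eE R α Ψ k X = a at *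
  generalize ∑ i ∈ A, ∫⁻ X in Γ, eE R α Ψ i X = b at *
  generalize ∫⁻ X in Γ, eQ R α Ψ (box p (32 * l)) X = e at *
  generalize ∫⁻ X in Γ ∩ {X | ∀ i ∈ A, X i ∈ box (t i) l}, fE Ψ X = g at *
  generalize ENNReal.ofReal ((32 * l) ^ 2) = K at *
  generalize ENNReal.ofReal (600 * l ^ 2) = K' at *
  generalize ENNReal.ofReal |α - 1| = ν at *
  have hae := hpair.trans hsum
  calc ν * ∫⁻ X in Γ, fE Ψ X ≤ ν * (5000 ^ A.card * (g + K * b)) := mul_le_mul_right htr _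
    _ = 5000 ^ A.card * (ν * g + ν * (K * b)) := by ring
    _ ≤ 5000 ^ 4 * (K * e + 1 * (K * e)) :=
      mul_le_mul' hc (add_le_add (hps.trans (mul_le_mul' hll hae))
        (mul_le_mul' hν (mul_le_mul' le_rfl hsum)))
    _ = 2 * 5000 ^ 4 * K * e := by ring

theorem baseB (hR : 0 < R) (h0 : 0 ≤ α) (h2 : α ≤ 2)
    (hΨ : ContDiff ℝ 1 Ψ) (hA : Antisym N Ψ) {p : E2} {L : ℝ} (hL : 0 < L)
    {Ω : Set (Fin N → E2)} (hΩ : MeasurableSet Ω) (hI : QInv (box p L) Ω)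
    (h4 : ∀ X ∈ Ω, (pat (box p L) X).card ≤ 4) :
    ENNReal.ofReal |α - 1| * ∫⁻ X in Ω, ((pat (box p L) X).card - 1 : ℕ) * fE Ψ X ≤
      KB * ENNReal.ofReal (L ^ 2) * ∫⁻ X in Ω, eQ R α Ψ (box p L) X := by
  have hQ := measurableSet_box p L
  rw [lint_pat hQ, lint_pat hQ, Finset.mul_sum, Finset.mul_sum]
  refine Finset.sum_le_sum fun A _ => ?_
  have hΓm : MeasurableSet (Ω ∩ {X | pat (box p L) X = A}) := hΩ.inter (measurable_pat hQ _)
  have e1 : ∫⁻ X in Ω ∩ {X | pat (box p L) X = A}, ((pat (box p L) X).card - 1 : ℕ) * fE Ψ X =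
      (A.card - 1 : ℕ) * ∫⁻ X in Ω ∩ {X | pat (box p L) X = A}, fE Ψ X := by
    rw [← lintegral_const_mul' _ _ (ENNReal.natCast_ne_top _)]
    refine setLIntegral_congr_fun hΓm fun X hX => ?_
    show ((pat (box p L) X).card - 1 : ℕ) * fE Ψ X = _
    rw [hX.2]
  rw [e1]
  rcases (Ω ∩ {X | pat (box p L) X = A}).eq_empty_or_nonempty with he | ⟨X0, hX0⟩
  · rw [he]; simp
  have hA4 : A.card ≤ 4 := by
    have := h4 X0 hX0.1
    rwa [hX0.2] at this
  by_cases hA2 : 2 ≤ A.card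
  · have := basePat hR h0 h2 hΨ hA hL hΩ hI hA2 hA4
    have h3 : ((A.card - 1 : ℕ) : ENNReal) ≤ 3 := by
      have : A.card - 1 ≤ 3 := by omega
      exact_mod_cast this
    unfold KB
    calc _ = ((A.card - 1 : ℕ) : ENNReal) * (ENNReal.ofReal |α - 1| *
            ∫⁻ X in Ω ∩ {X | pat (box p L) X = A}, fE Ψ X) := by ring
      _ ≤ 3 * (2 * 5000 ^ 4 * ENNReal.ofReal (L ^ 2) *
        ∫⁻ X in Ω ∩ {X | pat (box p L) X = A}, eQ R α Ψ (box p L) X) := mul_le_mul' h3 this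
      _ = _ := by ring
  · have : A.card - 1 = 0 := by omega
    rw [this]; simp

/-- corners of the four children -/
def ch (p : E2) (L : ℝ) (b : Fin 2 → Bool) : E2 :=
  WithLp.toLp 2 fun i => p i + if b i then L / 2 else 0

theorem ch_apply (p : E2) (L : ℝ) (b : Fin 2 → Bool) (i : Fin 2) :
    ch p L b i = p i + if b i then L / 2 else 0 := rfl

theorem box_split {p : E2} {L : ℝ} (hL : 0 < L) (x : E2) (b : Fin 2 → Bool) :
    x ∈ box (ch p L b) (L / 2) ↔ x ∈ box p L ∧ b = fun i => decide (p i + L / 2 ≤ x i) := by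
  constructor
  · intro h
    refine ⟨fun i => ?_, ?_⟩
    · have := h i
      rw [ch_apply, Set.mem_Ico] at this
      split_ifs at this <;> constructor <;> linarith [this.1, this.2]
    · ext i
      have := h i
      rw [ch_apply, Set.mem_Ico] at this
      rcases hb : b i
      · rw [hb] at this; simp at this; symm; simpa using (by linarith [this.2])
      · rw [hb] at this; simp at this; symm; simpa using (by linarith [this.1])
  · rintro ⟨h, rfl⟩ i
    have := h i
    rw [Set.mem_Ico] at this
    rw [ch_apply, Set.mem_Ico]
    by_cases hh : p i + L / 2 ≤ x i
    · simp only [hh, decide_true, if_true, true_and]; linarith [this.2]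
    · simp only [hh, decide_false, Bool.false_eq_true, if_false]
      push Not at hh
      constructor <;> linarith [this.1]

theorem box_ch_sub {p : E2} {L : ℝ} (hL : 0 < L) (b : Fin 2 → Bool) :
    box (ch p L b) (L / 2) ⊆ box p L := fun x hx => ((box_split hL x b).1 hx).1

open Classical in
theorem box_sum {M : Type*} [AddCommMonoid M] {p : E2} {L : ℝ} (hL : 0 < L) (x : E2) (v : M) :
    (if x ∈ box p L then v else 0) = ∑ b, if x ∈ box (ch p L b) (L / 2) then v else 0 := by
  simp_rw [box_split hL]
  by_cases h : x ∈ box p L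
  · simp [h]
  · simp [h]

theorem card_split {p : E2} {L : ℝ} (hL : 0 < L) (X : Fin N → E2) :
    (pat (box p L) X).card = ∑ b, (pat (box (ch p L b) (L / 2)) X).card := by
  classical
  simp only [pat, Finset.card_filter]
  rw [Finset.sum_comm]
  exact Finset.sum_congr rfl fun j _ => box_sum hL (X j) 1

theorem eQ_split {p : E2} {L : ℝ} (hL : 0 < L) (X : Fin N → E2) :
    eQ R α Ψ (box p L) X = ∑ b, eQ R α Ψ (box (ch p L b) (L / 2)) X := by
  classical
  simp only [eQ, Set.indicator_apply, Set.mem_ofPred_eq]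
  rw [Finset.sum_comm]
  exact Finset.sum_congr rfl fun j _ => box_sum hL (X j) (eE R α Ψ j X)

theorem measurable_eQ (hR : 0 < R) (hΨ : ContDiff ℝ 1 Ψ) {Q : Set E2} (hQ : MeasurableSet Q) :
    Measurable (eQ R α Ψ Q) := by
  unfold eQ
  exact Finset.measurable_fun_sum _ fun j _ => (measurable_eE hR hΨ j).indicator (meas_mem j hQ)

theorem measurable_card {Q : Set E2} (hQ : MeasurableSet Q) (g : ℕ → ENNReal) :
    Measurable fun X : Fin N → E2 => g (pat Q X).card := by
  classical
  have : (fun X : Fin N → E2 => g (pat Q X).card) = fun X =>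
      ∑ A : Finset (Fin N), {X : Fin N → E2 | pat Q X = A}.indicator (fun _ => g A.card) X := by
    ext X; simp [Set.indicator_apply]
  rw [this]
  exact Finset.measurable_fun_sum _ fun A _ => measurable_const.indicator (measurable_pat hQ A)

/-- separated configurations -/
def Gsep (N : ℕ) (δ : ℝ) : Set (Fin N → E2) :=
  {X | ∀ j k, j ≠ k → ∃ i, δ ≤ |X j i - X k i|}

theorem measurable_Gsep (δ : ℝ) : MeasurableSet (Gsep N δ) := by
  have : Gsep N δ = ⋂ j, ⋂ k, ⋂ (_ : j ≠ k), ⋃ i, {X : Fin N → E2 | δ ≤ |X j i - X k i|} := by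
    ext X; simp [Gsep]
  rw [this]
  refine MeasurableSet.iInter fun j => MeasurableSet.iInter fun k => MeasurableSet.iInter fun _ =>
    MeasurableSet.iUnion fun i => ?_
  refine measurableSet_le measurable_const (Continuous.measurable ?_)
  fun_prop

theorem sep_card {p : E2} {δ L : ℝ} (h : L ≤ δ) {X : Fin N → E2} (hX : X ∈ Gsep N δ) :
    (pat (box p L) X).card ≤ 1 := by
  by_contra hc
  push Not at hc
  obtain ⟨j, hj, k, hk, hjk⟩ := Finset.one_lt_card.1 hc
  obtain ⟨i, hi⟩ := hX j k hjk
  rw [mem_pat] at hj hk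
  have h1 := hj i; have h2 := hk i
  have : |X j i - X k i| < L := by
    rw [abs_lt]; constructor <;> linarith [h1.1, h1.2, h2.1, h2.2]
  linarith

theorem card_ineq {p : E2} {L : ℝ} (hL : 0 < L) {X : Fin N → E2} (h5 : 5 ≤ (pat (box p L) X).card) :
    (pat (box p L) X).card - 1 ≤ 4 * ∑ b, ((pat (box (ch p L b) (L / 2)) X).card - 1) := by
  have h1 := card_split (p := p) hL X
  have h2 : ∑ b : Fin 2 → Bool, (pat (box (ch p L b) (L / 2)) X).card ≤
      ∑ b, (((pat (box (ch p L b) (L / 2)) X).card - 1) + 1) :=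
    Finset.sum_le_sum fun b _ => by omega
  rw [Finset.sum_add_distrib] at h2
  have h3 : ∑ b : Fin 2 → Bool, 1 = 4 := by simp
  omega

theorem QInv.mono {Q Q' : Set E2} {Ω : Set (Fin N → E2)} (h : QInv Q Ω) (hs : Q' ⊆ Q) :
    QInv Q' Ω := fun X hX j hj x hx => h X hX j (hs hj) x (hs hx)

theorem rec1 (hR : 0 < R) (h0 : 0 ≤ α) (h2 : α ≤ 2)
    (hΨ : ContDiff ℝ 1 Ψ) (hA : Antisym N Ψ) {δ : ℝ} (d : ℕ) :
    ∀ (p : E2) (L : ℝ), 0 < L → L ≤ 2 ^ d * δ → ∀ Ω : Set (Fin N → E2), MeasurableSet Ω →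
      QInv (box p L) Ω →
    ENNReal.ofReal |α - 1| * ∫⁻ X in Ω ∩ Gsep N δ, ((pat (box p L) X).card - 1 : ℕ) * fE Ψ X ≤
      KB * ENNReal.ofReal (L ^ 2) * ∫⁻ X in Ω, eQ R α Ψ (box p L) X := by
  induction d with
  | zero =>
    intro p L hL hLd Ω hΩ hI
    refine le_of_eq_of_le ?_ zero_le
    rw [mul_eq_zero]; right
    refine le_antisymm ?_ zero_le
    refine (setLIntegral_mono' (g := fun _ => 0) (hΩ.inter (measurable_Gsep δ)) fun X hX => ?_).trans (by simp)
    have := sep_card (p := p) (L := L) (by linarith) hX.2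
    have : (pat (box p L) X).card - 1 = 0 := by omega
    rw [this]; simp
  | succ d ih =>
    intro p L hL hLd Ω hΩ hI
    have hQ := measurableSet_box p L
    set S := {X : Fin N → E2 | (pat (box p L) X).card ≤ 4} with hS
    have hSm : MeasurableSet S := by
      have := measurable_card (N := N) hQ (fun n => (n : ENNReal))
      have e : S = {X : Fin N → E2 | ((pat (box p L) X).card : ENNReal) ≤ (4 : ℕ)} := by
        ext X; simp only [hS, Set.mem_ofPred_eq, Nat.cast_le]
      rw [e]
      exact measurableSet_le this measurable_const
    have inv4 : QInv (box p L) (Ω ∩ S) := by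
      intro X hX j hj x hx
      refine ⟨hI X hX.1 j hj x hx, ?_⟩
      show (pat _ _).card ≤ 4
      rw [pat_update hj hx]; exact hX.2
    have inv5 : QInv (box p L) (Ω \ S) := by
      intro X hX j hj x hx
      refine ⟨hI X hX.1 j hj x hx, fun h => hX.2 ?_⟩
      have h : (pat _ _).card ≤ 4 := h
      rw [pat_update hj hx] at h; exact h
    rw [← lintegral_inter_add_sdiff _ (Ω ∩ Gsep N δ) hSm, ← lintegral_inter_add_sdiff _ Ω hSm,
      mul_add, mul_add]
    refine add_le_add ?_ ?_
    · refine le_trans (mul_le_mul_right (lintegral_mono_set ?_) _)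
        (baseB hR h0 h2 hΨ hA hL (hΩ.inter hSm) inv4 fun X hX => hX.2)
      exact fun X hX => ⟨hX.1.1, hX.2⟩
    · have hm5 := hΩ.diff hSm
      have hmG := (hΩ.inter (measurable_Gsep (N := N) δ)).diff hSm
      have hchm : ∀ b : Fin 2 → Bool, Measurable fun X : Fin N → E2 =>
          ((pat (box (ch p L b) (L / 2)) X).card - 1 : ℕ) * fE Ψ X := fun b =>
        (measurable_card (measurableSet_box _ _) fun n => ((n - 1 : ℕ) : ENNReal)).mul
          (measurable_fE hΨ)
      have s1 : ∫⁻ X in (Ω ∩ Gsep N δ) \ S, ((pat (box p L) X).card - 1 : ℕ) * fE Ψ X ≤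
          4 * ∑ b, ∫⁻ X in (Ω \ S) ∩ Gsep N δ,
            ((pat (box (ch p L b) (L / 2)) X).card - 1 : ℕ) * fE Ψ X := by
        rw [← lintegral_finsetSum _ fun b _ => hchm b,
          ← lintegral_const_mul' _ _ (by norm_num)]
        have : (Ω ∩ Gsep N δ) \ S = (Ω \ S) ∩ Gsep N δ := by
          ext X; simp only [Set.mem_sdiff, Set.mem_inter_iff]; tauto
        rw [this]
        refine setLIntegral_mono' (hm5.inter (measurable_Gsep δ)) fun X hX => ?_
        have h5 : 5 ≤ (pat (box p L) X).card := by
          have := hX.1.2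
          simp only [hS, Set.mem_ofPred_eq] at this
          omega
        have := card_ineq hL h5
        rw [← Finset.sum_mul, ← mul_assoc]
        refine mul_le_mul_left ?_ _
        exact_mod_cast this
      have s2 : ∀ b : Fin 2 → Bool, ENNReal.ofReal |α - 1| * ∫⁻ X in (Ω \ S) ∩ Gsep N δ,
            ((pat (box (ch p L b) (L / 2)) X).card - 1 : ℕ) * fE Ψ X ≤
          KB * ENNReal.ofReal ((L / 2) ^ 2) *
            ∫⁻ X in Ω \ S, eQ R α Ψ (box (ch p L b) (L / 2)) X := fun b =>
        ih (ch p L b) (L / 2) (by linarith) (by rw [pow_succ] at hLd; linarith) _ hm5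
          (inv5.mono (box_ch_sub hL b))
      have s3 : ∫⁻ X in Ω \ S, eQ R α Ψ (box p L) X =
          ∑ b, ∫⁻ X in Ω \ S, eQ R α Ψ (box (ch p L b) (L / 2)) X := by
        simp_rw [eQ_split hL]
        exact lintegral_finsetSum _ fun b _ => measurable_eQ hR hΨ (measurableSet_box _ _)
      have s4 : 4 * ENNReal.ofReal ((L / 2) ^ 2) = ENNReal.ofReal (L ^ 2) := by
        rw [show (4 : ENNReal) = ENNReal.ofReal 4 by simp, ← ENNReal.ofReal_mul (by norm_num)]
        congr 1; ring
      rw [s3]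
      refine (mul_le_mul_right s1 _).trans ?_
      calc _ = 4 * ∑ b, ENNReal.ofReal |α - 1| * ∫⁻ X in (Ω \ S) ∩ Gsep N δ,
            ((pat (box (ch p L b) (L / 2)) X).card - 1 : ℕ) * fE Ψ X := by
              rw [← Finset.mul_sum]; ring
        _ ≤ 4 * ∑ b, KB * ENNReal.ofReal ((L / 2) ^ 2) *
            ∫⁻ X in Ω \ S, eQ R α Ψ (box (ch p L b) (L / 2)) X :=
          mul_le_mul_right (Finset.sum_le_sum fun b _ => s2 b) _
        _ = _ := by rw [← Finset.mul_sum, ← s4]; ring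

theorem antisym_zero (hA : Antisym N Ψ) {X : Fin N → E2} {j k : Fin N} (hjk : j ≠ k)
    (h : X j = X k) : Ψ X = 0 := by
  have h1 := antisym_up2 (X := X) hA hjk (X j) (X k)
  have h2 : up2 X j k (X j) (X k) = X := by simp [up2]
  rw [← h, ] at h1
  rw [← h] at h2
  rw [h2] at h1
  have : (2:ℂ) * Ψ X = 0 := by linear_combination h1
  simpa using this

/-- Local exclusion principle. -/
theorem localExclusion (hR : 0 < R) (h0 : 0 ≤ α) (h2 : α ≤ 2)
    (hΨ : ContDiff ℝ 1 Ψ) (hA : Antisym N Ψ) (p : E2) {L : ℝ} (hL : 0 < L) :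
    ENNReal.ofReal |α - 1| * ∫⁻ X, ((pat (box p L) X).card - 1 : ℕ) * fE Ψ X ≤
      KB * ENNReal.ofReal (L ^ 2) * ∫⁻ X, eQ R α Ψ (box p L) X := by
  have key : ∀ n : ℕ, ENNReal.ofReal |α - 1| *
      ∫⁻ X in Gsep N (1 / 2 ^ n), ((pat (box p L) X).card - 1 : ℕ) * fE Ψ X ≤
      KB * ENNReal.ofReal (L ^ 2) * ∫⁻ X, eQ R α Ψ (box p L) X := by
    intro n
    obtain ⟨d, hd⟩ := pow_unbounded_of_one_lt (L * 2 ^ n) (one_lt_two : (1:ℝ) < 2)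
    have := rec1 (Ψ := Ψ) (α := α) hR h0 h2 hΨ hA (δ := 1 / 2 ^ n) d p L hL (by
      rw [mul_one_div, le_div_iff₀ (by positivity)]; exact hd.le) Set.univ MeasurableSet.univ
      (fun X _ j _ x _ => Set.mem_univ _)
    simpa using this
  have hU : ∫⁻ X, ((pat (box p L) X).card - 1 : ℕ) * fE Ψ X =
      ∫⁻ X in ⋃ n : ℕ, Gsep N (1 / 2 ^ n), ((pat (box p L) X).card - 1 : ℕ) * fE Ψ X := by
    rw [← lintegral_indicator (MeasurableSet.iUnion fun n => measurable_Gsep _)]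
    congr 1; ext X
    by_cases hX : X ∈ ⋃ n : ℕ, Gsep N (1 / 2 ^ n)
    · rw [Set.indicator_of_mem hX]
    · rw [Set.indicator_of_notMem hX]
      suffices Ψ X = 0 by simp [fE, this]
      by_contra hne
      refine hX ?_
      have hd : ∀ j k, j ≠ k → X j ≠ X k := fun j k hjk h => hne (antisym_zero hA hjk h)
      have h1 : ∀ j k, ∃ n : ℕ, j ≠ k → ∃ i, (1:ℝ) / 2 ^ n ≤ |X j i - X k i| := by
        intro j k
        by_cases hjk : j = k
        · exact ⟨0, fun h => (h hjk).elim⟩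
        have : ∃ i, X j i ≠ X k i := by
          by_contra hc; push Not at hc
          exact hd j k hjk (by ext i; exact hc i)
        obtain ⟨i, hi⟩ := this
        have hpos : 0 < |X j i - X k i| := abs_pos.2 (sub_ne_zero.2 hi)
        obtain ⟨n, hn⟩ := exists_pow_lt_of_lt_one hpos (by norm_num : (1/2:ℝ) < 1)
        refine ⟨n, fun _ => ⟨i, ?_⟩⟩
        rw [one_div, ← inv_pow, ← one_div]; exact hn.le
      choose n hn using h1
      refine Set.mem_iUnion.2 ⟨∑ j, ∑ k, n j k, ?_⟩
      intro j k hjk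
      obtain ⟨i, hi⟩ := hn j k hjk
      refine ⟨i, le_trans ?_ hi⟩
      have : n j k ≤ ∑ j, ∑ k, n j k :=
        (Finset.single_le_sum (f := fun k => n j k) (fun _ _ => Nat.zero_le _)
          (Finset.mem_univ k)).trans (Finset.single_le_sum (f := fun j => ∑ k, n j k)
          (fun _ _ => Nat.zero_le _) (Finset.mem_univ j))
      gcongr
      norm_num
  have hmon : Monotone fun n : ℕ => Gsep N (1 / 2 ^ n) := by
    intro n m hnm X hX j k hjk
    obtain ⟨i, hi⟩ := hX j k hjk
    refine ⟨i, le_trans ?_ hi⟩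
    gcongr
    norm_num
  rw [hU, setLIntegral_iUnion_of_directed _ hmon.directed_le, ENNReal.mul_iSup]
  exact iSup_le key
end


theorem line1 {z d : ℝ → ℂ} {a : ℝ → ℝ}
    (hz : ∀ s, HasDerivAt z (Complex.I * (d s - a s * z s)) s) (hd : Continuous d)
    {p L θ x : ℝ} (hL : 0 < L) (hθ : 0 < θ) (hx : x ∈ Set.Ico p (p + L)) :
    ENNReal.ofReal (‖z x‖ ^ 2) ≤
      ∫⁻ s in Set.Ico p (p + L), ENNReal.ofReal ((1 / L + θ) * ‖z s‖ ^ 2 + (1 / θ) * ‖d s‖ ^ 2) := by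
  have hzc : Continuous z := continuous_iff_continuousAt.2 fun s => (hz s).continuousAt
  have c1 : Continuous fun s => ‖z s‖ ^ 2 := by fun_prop
  have c2 : Continuous fun s => 2 * ‖z s‖ * ‖d s‖ := by fun_prop
  have c3 : Continuous fun s => (1 / L + θ) * ‖z s‖ ^ 2 + (1 / θ) * ‖d s‖ ^ 2 := by fun_prop
  rw [lint_Ico c3 (fun s => by positivity) (by linarith)]
  apply ENNReal.ofReal_le_ofReal
  have h := sup_sq hz hd (Set.Ico_subset_Icc_self hx) hL le_rfl le_rfl
  refine h.trans ?_
  have c4 : Continuous fun s => 1 / L * ‖z s‖ ^ 2 := by fun_prop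
  rw [← intervalIntegral.integral_const_mul, ← intervalIntegral.integral_add
    (c4.intervalIntegrable _ _) (c2.intervalIntegrable _ _)]
  apply intervalIntegral.integral_mono_on (by linarith)
  · exact (c4.add c2).intervalIntegrable _ _
  · exact c3.intervalIntegrable _ _
  · intro s _
    have h1 : 2 * ‖z s‖ * ‖d s‖ ≤ θ * ‖z s‖ ^ 2 + (1 / θ) * ‖d s‖ ^ 2 := by
      have : θ * ‖z s‖ ^ 2 + (1 / θ) * ‖d s‖ ^ 2 - 2 * ‖z s‖ * ‖d s‖
        = (1 / θ) * (θ * ‖z s‖ - ‖d s‖) ^ 2 := by field_simp; ring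
      have h0 : 0 ≤ (1 / θ) * (θ * ‖z s‖ - ‖d s‖) ^ 2 := by positivity
      linarith
    linarith

/-- Insert `x` as the position of particle `j`. -/
def ins {N : ℕ} (j : Fin N) (x : E2) (Y : {k : Fin N // k ≠ j} → E2) : Fin N → E2 :=
  fun k => if h : k = j then x else Y ⟨k, h⟩

theorem ins_self {N : ℕ} (j : Fin N) (x : E2) (Y : {k : Fin N // k ≠ j} → E2) :
    ins j x Y j = x := by simp [ins]

theorem ins_update {N : ℕ} (j : Fin N) (x : E2) (Y : {k : Fin N // k ≠ j} → E2) :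
    ins j x Y = Function.update (ins j 0 Y) j x := by
  ext k : 1
  by_cases h : k = j
  · subst h; simp [ins]
  · simp [ins, h]

theorem continuous_ins {N : ℕ} (j : Fin N) :
    Continuous fun a : E2 × ({k : Fin N // k ≠ j} → E2) => ins j a.1 a.2 := by
  refine continuous_pi fun k => ?_
  by_cases h : k = j
  · simp only [ins, h, dif_pos]; exact continuous_fst
  · simp only [ins, h, dif_neg, not_false_eq_true]
    exact (continuous_apply _).comp continuous_snd

theorem lintegral_ins {N : ℕ} (j : Fin N) {F : (Fin N → E2) → ENNReal} (hF : Measurable F) :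
    ∫⁻ X, F X = ∫⁻ x : E2, ∫⁻ Y, F (ins j x Y) := by
  have h1 := (volume_preserving_piEquivPiSubtypeProd (fun _ : Fin N => E2) (fun k => k = j)).symm
  have h2 : MeasurePreserving (MeasurableEquiv.funUnique {k : Fin N // k = j} E2).symm volume
      (@volume _ (@MeasureSpace.pi _ (Subtype.fintype fun k => k = j) _ _)) := by
    convert (volume_preserving_funUnique {k : Fin N // k = j} E2).symm
  have h3 := h2.prod (MeasurePreserving.id (volume : Measure ({k : Fin N // ¬ (k = j)} → E2)))
  rw [← (h1.comp h3).lintegral_comp hF, lintegral_prod]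
  · refine lintegral_congr fun x => lintegral_congr fun Y => ?_
    congr 1
  · exact ((hF.comp (h1.comp h3).measurable)).aemeasurable

section
variable {N : ℕ} {R α : ℝ} {Ψ : (Fin N → E2) → ℂ}

/-- Sum of one-particle marginals. -/
def marg (G : Fin N → (Fin N → E2) → ENNReal) (x : E2) : ENNReal :=
  ∑ j, ∫⁻ Y, G j (ins j x Y)

theorem measurable_marg {G : Fin N → (Fin N → E2) → ENNReal} (hG : ∀ j, Measurable (G j)) :
    Measurable (marg G) := by
  unfold marg
  refine Finset.measurable_fun_sum _ fun j _ => ?_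
  exact Measurable.lintegral_prod_right' ((hG j).comp (continuous_ins j).measurable)

theorem setLIntegral_marg {G : Fin N → (Fin N → E2) → ENNReal} (hG : ∀ j, Measurable (G j))
    {Q : Set E2} (hQ : MeasurableSet Q) :
    ∫⁻ x in Q, marg G x = ∫⁻ X, ∑ j, {X | X j ∈ Q}.indicator (G j) X := by
  rw [lintegral_finsetSum _ fun j _ => (hG j).indicator (meas_mem j hQ)]
  unfold marg
  rw [lintegral_finsetSum]
  · refine Finset.sum_congr rfl fun j _ => ?_
    rw [lintegral_ins j ((hG j).indicator (meas_mem j hQ)), ← lintegral_indicator hQ]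
    refine lintegral_congr fun x => ?_
    by_cases hx : x ∈ Q
    · rw [Set.indicator_of_mem hx]
      refine lintegral_congr fun Y => ?_
      rw [Set.indicator_of_mem]
      simpa [ins_self] using hx
    · rw [Set.indicator_of_notMem hx, ← lintegral_zero]
      refine lintegral_congr fun Y => ?_
      rw [Set.indicator_of_notMem]
      simpa [ins_self] using hx
  · intro j _
    exact Measurable.lintegral_prod_right' ((hG j).comp (continuous_ins j).measurable)

/-- Line-integral kernel. -/
def kap (R α L θ : ℝ) {N : ℕ} (Ψ : (Fin N → E2) → ℂ) (j : Fin N) (X : Fin N → E2) : ENNReal :=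
  ENNReal.ofReal (1 / L + θ) * fE Ψ X + ENNReal.ofReal (1 / θ) * eE R α Ψ j X

theorem measurable_kap (hR : 0 < R) (hΨ : ContDiff ℝ 1 Ψ) (L θ : ℝ) (j : Fin N) :
    Measurable (kap R α L θ Ψ j) :=
  ((measurable_fE hΨ).const_mul _).add ((measurable_eE hR hΨ j).const_mul _)

theorem kap_ge {L θ : ℝ} (hL : 0 < L) (hθ : 0 < θ) (j : Fin N) (X : Fin N → E2) (c : Fin 2) :
    ENNReal.ofReal ((1 / L + θ) * ‖Ψ X‖ ^ 2 + (1 / θ) * ‖covD R α Ψ j X c‖ ^ 2) ≤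
      kap R α L θ Ψ j X := by
  unfold kap fE eE
  rw [← ENNReal.ofReal_mul (by positivity), ← ENNReal.ofReal_mul (by positivity),
    ← ENNReal.ofReal_add (by positivity) (by positivity)]
  apply ENNReal.ofReal_le_ofReal
  gcongr
  exact Finset.single_le_sum (f := fun c => ‖covD R α Ψ j X c‖ ^ 2)
    (fun _ _ => by positivity) (Finset.mem_univ c)

theorem line0 (hR : 0 < R) (hΨ : ContDiff ℝ 1 Ψ) {L θ : ℝ} (hL : 0 < L) (hθ : 0 < θ)
    (j : Fin N) (X : Fin N → E2) {p s t : ℝ} (hs : s ∈ Set.Ico p (p + L)) :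
    fE Ψ (Function.update X j !₂[s, t]) ≤
      ∫⁻ s' in Set.Ico p (p + L), kap R α L θ Ψ j (Function.update X j !₂[s', t]) := by
  have hw := differentiable_update hΨ X j
  have h := line1 (z := fun s => Ψ (Function.update X j !₂[s, t]))
    (d := fun s => covD R α Ψ j (Function.update X j !₂[s, t]) 0)
    (a := fun s => α * Avec R (Function.update X j !₂[s, t]) j 0)
    (fun s => by
      have := hasDerivAt_mk0 hw s t
      rwa [fderiv_eq_of_cov (covD_update R α hΨ X j !₂[s, t] 0)] at this)
    (((continuous_covD hR hΨ j 0).comp (continuous_const.update j continuous_id)).comp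
      (continuous_mk2.comp (by fun_prop : Continuous fun s : ℝ => (s, t)))) hL hθ hs
  exact h.trans (lintegral_mono fun s => kap_ge hL hθ j _ 0)

theorem line0' (hR : 0 < R) (hΨ : ContDiff ℝ 1 Ψ) {L θ : ℝ} (hL : 0 < L) (hθ : 0 < θ)
    (j : Fin N) (X : Fin N → E2) {p s t : ℝ} (ht : t ∈ Set.Ico p (p + L)) :
    fE Ψ (Function.update X j !₂[s, t]) ≤
      ∫⁻ t' in Set.Ico p (p + L), kap R α L θ Ψ j (Function.update X j !₂[s, t']) := by
  have hw := differentiable_update hΨ X j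
  have h := line1 (z := fun t => Ψ (Function.update X j !₂[s, t]))
    (d := fun t => covD R α Ψ j (Function.update X j !₂[s, t]) 1)
    (a := fun t => α * Avec R (Function.update X j !₂[s, t]) j 1)
    (fun t => by
      have := hasDerivAt_mk1 hw s t
      rwa [fderiv_eq_of_cov (covD_update R α hΨ X j !₂[s, t] 1)] at this)
    (((continuous_covD hR hΨ j 1).comp (continuous_const.update j continuous_id)).comp
      (continuous_mk2.comp (by fun_prop : Continuous fun t : ℝ => (s, t)))) hL hθ ht
  exact h.trans (lintegral_mono fun s => kap_ge hL hθ j _ 1)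

/-- The density, extended-real valued. -/
def rhoE (Ψ : (Fin N → E2) → ℂ) : E2 → ENNReal := marg fun _ => fE Ψ

theorem measurable_rhoE (hΨ : ContDiff ℝ 1 Ψ) : Measurable (rhoE Ψ) :=
  measurable_marg fun _ => measurable_fE hΨ

theorem rho_line0 (hR : 0 < R) (hΨ : ContDiff ℝ 1 Ψ) {L θ : ℝ} (hL : 0 < L) (hθ : 0 < θ)
    {p s t : ℝ} (hs : s ∈ Set.Ico p (p + L)) :
    rhoE Ψ !₂[s, t] ≤ ∫⁻ s' in Set.Ico p (p + L), marg (kap R α L θ Ψ) !₂[s', t] := by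
  have hm : ∀ j : Fin N, Measurable fun a : ℝ × ({k : Fin N // k ≠ j} → E2) =>
      kap R α L θ Ψ j (ins j !₂[a.1, t] a.2) := fun j =>
    (measurable_kap hR hΨ L θ j).comp ((continuous_ins j).comp
      ((continuous_mk2.comp (by fun_prop : Continuous fun a : ℝ × ({k : Fin N // k ≠ j} → E2) =>
        (a.1, t))).prodMk continuous_snd)).measurable
  unfold rhoE marg
  rw [lintegral_finsetSum _ fun j _ => (hm j).lintegral_prod_right']
  refine Finset.sum_le_sum fun j _ => ?_
  rw [lintegral_lintegral_swap (hm j).aemeasurable]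
  refine lintegral_mono fun Y => ?_
  have := line0 (α := α) (t := t) hR hΨ hL hθ j (ins j 0 Y) hs
  simp only [← ins_update] at this
  exact this

theorem rho_line1 (hR : 0 < R) (hΨ : ContDiff ℝ 1 Ψ) {L θ : ℝ} (hL : 0 < L) (hθ : 0 < θ)
    {p s t : ℝ} (ht : t ∈ Set.Ico p (p + L)) :
    rhoE Ψ !₂[s, t] ≤ ∫⁻ t' in Set.Ico p (p + L), marg (kap R α L θ Ψ) !₂[s, t'] := by
  have hm : ∀ j : Fin N, Measurable fun a : ℝ × ({k : Fin N // k ≠ j} → E2) =>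
      kap R α L θ Ψ j (ins j !₂[s, a.1] a.2) := fun j =>
    (measurable_kap hR hΨ L θ j).comp ((continuous_ins j).comp
      ((continuous_mk2.comp (by fun_prop : Continuous fun a : ℝ × ({k : Fin N // k ≠ j} → E2) =>
        (s, a.1))).prodMk continuous_snd)).measurable
  unfold rhoE marg
  rw [lintegral_finsetSum _ fun j _ => (hm j).lintegral_prod_right']
  refine Finset.sum_le_sum fun j _ => ?_
  rw [lintegral_lintegral_swap (hm j).aemeasurable]
  refine lintegral_mono fun Y => ?_
  have := line0' (α := α) (s := s) hR hΨ hL hθ j (ins j 0 Y) ht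
  simp only [← ins_update] at this
  exact this

theorem rho_sq_aux {ρ K : E2 → ENNReal} (hρ : Measurable ρ) (hK : Measurable K) {p : E2} {L : ℝ}
    (h0 : ∀ s t, s ∈ Set.Ico (p 0) (p 0 + L) →
      ρ !₂[s, t] ≤ ∫⁻ s' in Set.Ico (p 0) (p 0 + L), K !₂[s', t])
    (h1 : ∀ s t, t ∈ Set.Ico (p 1) (p 1 + L) →
      ρ !₂[s, t] ≤ ∫⁻ t' in Set.Ico (p 1) (p 1 + L), K !₂[s, t']) :
    ∫⁻ x in box p L, ρ x ^ 2 ≤ (∫⁻ x in box p L, K x) ^ 2 := by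
  have hK2 : Measurable fun a : ℝ × ℝ => K !₂[a.1, a.2] := hK.comp measurable_mk2
  have hK3 : Measurable fun a : ℝ × ℝ => K !₂[a.2, a.1] :=
    hK2.comp measurable_swap
  have hV : Measurable fun t => ∫⁻ s' in Set.Ico (p 0) (p 0 + L), K !₂[s', t] :=
    hK3.lintegral_prod_right'
  have hW : Measurable fun s => ∫⁻ t' in Set.Ico (p 1) (p 1 + L), K !₂[s, t'] :=
    hK2.lintegral_prod_right'
  rw [setLIntegral_box (hρ.pow_const 2), setLIntegral_box hK, sq]
  calc _ ≤ ∫⁻ s in Set.Ico (p 0) (p 0 + L), ∫⁻ t in Set.Ico (p 1) (p 1 + L),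
        (∫⁻ t' in Set.Ico (p 1) (p 1 + L), K !₂[s, t']) *
        (∫⁻ s' in Set.Ico (p 0) (p 0 + L), K !₂[s', t]) := by
        refine setLIntegral_mono' measurableSet_Ico fun s hs => ?_
        refine setLIntegral_mono' measurableSet_Ico fun t ht => ?_
        rw [sq]
        exact mul_le_mul' (h1 s t ht) (h0 s t hs)
    _ = _ := by
        simp_rw [lintegral_const_mul _ hV]
        rw [lintegral_mul_const _ hW]
        congr 1
        exact lintegral_lintegral_swap hK3.aemeasurable

theorem rho_sq (hR : 0 < R) (hΨ : ContDiff ℝ 1 Ψ) {L θ : ℝ} (hL : 0 < L) (hθ : 0 < θ)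
    (p : E2) : ∫⁻ x in box p L, rhoE Ψ x ^ 2 ≤
      (∫⁻ x in box p L, marg (kap R α L θ Ψ) x) ^ 2 :=
  rho_sq_aux (measurable_rhoE hΨ) (measurable_marg fun j => measurable_kap hR hΨ L θ j)
    (fun _ _ hs => rho_line0 hR hΨ hL hθ hs) (fun _ _ ht => rho_line1 hR hΨ hL hθ ht)

end


section
variable {N : ℕ} {R α : ℝ} {Ψ : (Fin N → E2) → ℂ}

/-- Mass in `Q`. -/
def mQ (Ψ : (Fin N → E2) → ℂ) (Q : Set E2) : ENNReal := ∫⁻ x in Q, rhoE Ψ x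

/-- Energy in `Q`. -/
def EQ (R α : ℝ) (Ψ : (Fin N → E2) → ℂ) (Q : Set E2) : ENNReal := ∫⁻ X, eQ R α Ψ Q X

/-- Squared density in `Q`. -/
def PQ (Ψ : (Fin N → E2) → ℂ) (Q : Set E2) : ENNReal := ∫⁻ x in Q, rhoE Ψ x ^ 2

theorem mQ_eq (hΨ : ContDiff ℝ 1 Ψ) {Q : Set E2} (hQ : MeasurableSet Q) :
    mQ Ψ Q = ∫⁻ X, ((pat Q X).card : ENNReal) * fE Ψ X := by
  unfold mQ rhoE
  rw [setLIntegral_marg (fun _ => measurable_fE hΨ) hQ]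
  refine lintegral_congr fun X => ?_
  classical
  have : ∀ j : Fin N, {X : Fin N → E2 | X j ∈ Q}.indicator (fE Ψ) X =
      if j ∈ pat Q X then fE Ψ X else 0 := by
    intro j
    rw [Set.indicator_apply]
    simp only [Set.mem_ofPred_eq, mem_pat]
  simp_rw [this]
  rw [Finset.sum_ite_mem, Finset.univ_inter, Finset.sum_const, nsmul_eq_mul]

theorem marg_kap_int (hR : 0 < R) (hΨ : ContDiff ℝ 1 Ψ) (L θ : ℝ) {Q : Set E2}
    (hQ : MeasurableSet Q) : ∫⁻ x in Q, marg (kap R α L θ Ψ) x =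
      ENNReal.ofReal (1 / L + θ) * mQ Ψ Q + ENNReal.ofReal (1 / θ) * EQ R α Ψ Q := by
  have h1 : ∀ x, marg (kap R α L θ Ψ) x = ENNReal.ofReal (1 / L + θ) * rhoE Ψ x +
      ENNReal.ofReal (1 / θ) * marg (eE R α Ψ) x := by
    intro x
    unfold marg rhoE marg kap
    rw [Finset.mul_sum, Finset.mul_sum, ← Finset.sum_add_distrib]
    refine Finset.sum_congr rfl fun j _ => ?_
    have hi : Measurable fun Y => ins j x Y :=
      ((continuous_ins j).comp (by fun_prop : Continuous fun Y => (x, Y))).measurable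
    have hi2 : Measurable fun Y => ENNReal.ofReal (1 / L + θ) * fE Ψ (ins j x Y) :=
      ((measurable_fE hΨ).comp hi).const_mul _
    rw [lintegral_add_left hi2,
      lintegral_const_mul' _ _ ENNReal.ofReal_ne_top, lintegral_const_mul' _ _ ENNReal.ofReal_ne_top]
  simp_rw [h1]
  rw [lintegral_add_left ((measurable_rhoE hΨ).const_mul _),
      lintegral_const_mul' _ _ ENNReal.ofReal_ne_top, lintegral_const_mul' _ _ ENNReal.ofReal_ne_top,
      setLIntegral_marg (fun j => measurable_eE hR hΨ j) hQ]
  rfl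

theorem gag (hR : 0 < R) (hΨ : ContDiff ℝ 1 Ψ) (p : E2) {L M : ℝ} (hL : 0 < L) (hM : 0 < M)
    (hm : mQ Ψ (box p L) ≤ ENNReal.ofReal M) (hE : EQ R α Ψ (box p L) ≠ ⊤) :
    PQ Ψ (box p L) ≤
      ENNReal.ofReal (9 * M * (EQ R α Ψ (box p L)).toReal + 9 * M ^ 2 / L ^ 2) := by
  set E := (EQ R α Ψ (box p L)).toReal with hEd
  have hE0 : 0 ≤ E := ENNReal.toReal_nonneg
  set θ := √(E / M + 1 / L ^ 2) with hθd
  have hpos : 0 < E / M + 1 / L ^ 2 := by positivity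
  have hθ : 0 < θ := Real.sqrt_pos.2 hpos
  have hθ2 : θ ^ 2 = E / M + 1 / L ^ 2 := Real.sq_sqrt hpos.le
  have hLθ : 1 / L ≤ θ := by
    rw [hθd]; apply Real.le_sqrt_of_sq_le
    rw [div_pow, one_pow]
    have : 0 ≤ E / M := by positivity
    linarith
  have hEθ : E ≤ θ ^ 2 * M := by
    rw [hθ2, add_mul, div_mul_cancel₀ _ hM.ne']
    have : 0 ≤ 1 / L ^ 2 * M := by positivity
    linarith
  have h := rho_sq (α := α) hR hΨ hL hθ p
  rw [marg_kap_int hR hΨ L θ (measurableSet_box p L)] at h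
  refine h.trans ?_
  have hE1 : EQ R α Ψ (box p L) = ENNReal.ofReal E := (ENNReal.ofReal_toReal hE).symm
  rw [hE1]
  calc _ ≤ (ENNReal.ofReal (1 / L + θ) * ENNReal.ofReal M +
        ENNReal.ofReal (1 / θ) * ENNReal.ofReal E) ^ 2 := by gcongr
    _ = ENNReal.ofReal (((1 / L + θ) * M + 1 / θ * E) ^ 2) := by
        rw [← ENNReal.ofReal_mul (by positivity), ← ENNReal.ofReal_mul (by positivity),
          ← ENNReal.ofReal_add (by positivity) (by positivity), ENNReal.ofReal_pow (by positivity)]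
    _ ≤ _ := by
        apply ENNReal.ofReal_le_ofReal
        have h1 : 1 / θ * E ≤ θ * M := by
          rw [one_div, inv_mul_le_iff₀ hθ]; nlinarith
        have h2 : (1 / L + θ) * M + 1 / θ * E ≤ 3 * θ * M := by nlinarith
        calc _ ≤ (3 * θ * M) ^ 2 := by
              apply pow_le_pow_left₀ (by positivity) h2
          _ = 9 * M ^ 2 * θ ^ 2 := by ring
          _ = _ := by rw [hθ2]; field_simp

/-- Real version of the exclusion constant. -/
def KBr : ℝ := 6 * 5000 ^ 4

theorem KB_eq : KB = ENNReal.ofReal KBr := by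
  unfold KB KBr
  rw [ENNReal.ofReal_mul (by norm_num), ENNReal.ofReal_pow (by norm_num)]
  norm_num

theorem excl (hR : 0 < R) (h0 : 0 ≤ α) (h2 : α ≤ 2) (hΨ : ContDiff ℝ 1 Ψ) (hA : Antisym N Ψ)
    (h1 : ∫⁻ X, fE Ψ X = 1) (p : E2) {L : ℝ} (hL : 0 < L)
    (hm : mQ Ψ (box p L) ≠ ⊤) (hE : EQ R α Ψ (box p L) ≠ ⊤) :
    |α - 1| * ((mQ Ψ (box p L)).toReal - 1) ≤ KBr * L ^ 2 * (EQ R α Ψ (box p L)).toReal := by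
  have h := localExclusion hR h0 h2 hΨ hA p hL
  have hK0 : 0 < KBr := by unfold KBr; norm_num
  have key : ENNReal.ofReal |α - 1| * mQ Ψ (box p L) ≤
      KB * ENNReal.ofReal (L ^ 2) * EQ R α Ψ (box p L) + ENNReal.ofReal |α - 1| := by
    calc _ ≤ ENNReal.ofReal |α - 1| *
          ((∫⁻ X, (((pat (box p L) X).card - 1 : ℕ) : ENNReal) * fE Ψ X) + 1) := by
          refine mul_le_mul_right ?_ _
          rw [mQ_eq hΨ (measurableSet_box p L), ← h1, ← lintegral_add_right _ (measurable_fE hΨ)]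
          refine lintegral_mono fun X => ?_
          have : ((pat (box p L) X).card : ENNReal) ≤
              (((pat (box p L) X).card - 1 : ℕ) : ENNReal) + 1 := by
            exact_mod_cast (by omega : (pat (box p L) X).card ≤ (pat (box p L) X).card - 1 + 1)
          calc _ ≤ ((((pat (box p L) X).card - 1 : ℕ) : ENNReal) + 1) * fE Ψ X :=
                mul_le_mul_left this _
            _ = _ := by rw [add_mul, one_mul]
      _ ≤ _ := by
          rw [mul_add, mul_one]
          exact add_le_add_left h _
  rw [KB_eq, ← ENNReal.ofReal_toReal hm, ← ENNReal.ofReal_toReal hE,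
    ← ENNReal.ofReal_mul (by positivity), ← ENNReal.ofReal_mul (by positivity),
    ← ENNReal.ofReal_mul (by positivity), ← ENNReal.ofReal_add (by positivity) (by positivity),
    ENNReal.ofReal_le_ofReal_iff (by positivity)] at key
  linarith

theorem lint_box_split {F : E2 → ENNReal} {p : E2} {L : ℝ} (hF : Measurable F)
    (hL : 0 < L) : ∫⁻ x in box p L, F x = ∑ b, ∫⁻ x in box (ch p L b) (L / 2), F x := by
  classical
  rw [← lintegral_indicator (measurableSet_box p L)]
  simp_rw [← lintegral_indicator (measurableSet_box _ _)]
  rw [← lintegral_finsetSum _ fun b _ => hF.indicator (measurableSet_box _ _)]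
  refine lintegral_congr fun x => ?_
  have := box_sum (p := p) hL x (F x)
  simp only [Set.indicator_apply]
  convert this

theorem EQ_split (hR : 0 < R) (hΨ : ContDiff ℝ 1 Ψ) {p : E2} {L : ℝ} (hL : 0 < L) :
    EQ R α Ψ (box p L) = ∑ b, EQ R α Ψ (box (ch p L b) (L / 2)) := by
  unfold EQ
  rw [← lintegral_finsetSum _ fun b _ => measurable_eQ hR hΨ (measurableSet_box _ _)]
  exact lintegral_congr fun X => eQ_split hL X

/-- Real-valued final recursion. -/
theorem rec2 (hR : 0 < R) (h0 : 0 ≤ α) (h2 : α ≤ 2) (h3 : α ≠ 1) (hΨ : ContDiff ℝ 1 Ψ)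
    (hA : Antisym N Ψ) (h1 : ∫⁻ X, fE Ψ X = 1)
    (hm : ∀ Q, MeasurableSet Q → mQ Ψ Q ≠ ⊤)
    (hE : ∀ Q, MeasurableSet Q → EQ R α Ψ Q ≠ ⊤) {δ : ℝ}
    (hδ : ∀ p L, 0 < L → L ≤ δ → (mQ Ψ (box p L)).toReal ≤ 25) (d : ℕ) :
    ∀ p L, 0 < L → L ≤ 2 ^ d * δ → (PQ Ψ (box p L)).toReal ≤
      (225 + 2835 * KBr) / |α - 1| * (EQ R α Ψ (box p L)).toReal +
        144 / L ^ 2 * (5 - (mQ Ψ (box p L)).toReal) := by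
  have hK0 : 0 < KBr := by unfold KBr; norm_num
  have hν : 0 < |α - 1| := abs_pos.2 (sub_ne_zero.2 h3)
  have hν1 : |α - 1| ≤ 1 := abs_le.2 ⟨by linarith, by linarith⟩
  have gagR : ∀ p L M, 0 < L → 0 < M → (mQ Ψ (box p L)).toReal ≤ M →
      (PQ Ψ (box p L)).toReal ≤
        9 * M * (EQ R α Ψ (box p L)).toReal + 9 * M ^ 2 / L ^ 2 := by
    intro p L M hL hM h
    refine ENNReal.toReal_le_of_le_ofReal (by positivity) ?_
    refine gag hR hΨ p hL hM ?_ (hE _ (measurableSet_box _ _))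
    rw [← ENNReal.ofReal_toReal (hm _ (measurableSet_box p L))]
    exact ENNReal.ofReal_le_ofReal h
  have base : ∀ p L, 0 < L → (mQ Ψ (box p L)).toReal ≤ 25 → (PQ Ψ (box p L)).toReal ≤
      (225 + 2835 * KBr) / |α - 1| * (EQ R α Ψ (box p L)).toReal +
        144 / L ^ 2 * (5 - (mQ Ψ (box p L)).toReal) := by
    intro p L hL h25
    have hex := excl hR h0 h2 hΨ hA h1 p hL (hm _ (measurableSet_box _ _))
      (hE _ (measurableSet_box _ _))
    have g4 := gagR p L 4 hL (by norm_num)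
    have g25 := gagR p L 25 hL (by norm_num) h25
    have hE0 : 0 ≤ (EQ R α Ψ (box p L)).toReal := ENNReal.toReal_nonneg
    generalize (EQ R α Ψ (box p L)).toReal = E at *
    generalize (PQ Ψ (box p L)).toReal = P at *
    generalize (mQ Ψ (box p L)).toReal = μ at *
    generalize |α - 1| = ν at *
    have hL2 : 0 < L ^ 2 := by positivity
    have hA1 : (225 + 2835 * KBr) / ν * E = 225 * (E / ν) + 2835 * KBr * E / ν := by ring
    have hEν : E ≤ E / ν := by rw [le_div_iff₀ hν]; nlinarith
    have hKE : 0 ≤ 2835 * KBr * E / ν := by positivity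
    rw [hA1]
    by_cases h4 : μ ≤ 4
    · have := g4 h4
      have : 9 * 4 ^ 2 / L ^ 2 ≤ 144 / L ^ 2 * (5 - μ) := by
        rw [div_mul_eq_mul_div]
        refine div_le_div_of_nonneg_right ?_ hL2.le
        linarith
      linarith
    · push Not at h4
      have h5 : 8505 / L ^ 2 ≤ 2835 * KBr * E / ν := by
        rw [div_le_div_iff₀ hL2 hν]
        nlinarith
      have h6 : 9 * 25 ^ 2 / L ^ 2 ≤ 8505 / L ^ 2 + 144 / L ^ 2 * (5 - μ) := by
        rw [div_mul_eq_mul_div, ← add_div]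
        gcongr
        linarith
      linarith
  induction d with
  | zero => intro p L hL hLd; exact base p L hL (hδ p L hL (by simpa using hLd))
  | succ d ih =>
    intro p L hL hLd
    by_cases h25 : (mQ Ψ (box p L)).toReal ≤ 25
    · exact base p L hL h25
    push Not at h25
    have hih := fun b => ih (ch p L b) (L / 2) (by linarith) (by rw [pow_succ] at hLd; linarith)
    have hPf : ∀ p L, 0 < L → PQ Ψ (box p L) ≠ ⊤ := by
      intro p L hL
      refine ne_top_of_le_ne_top ENNReal.ofReal_ne_top (gag (α := α) hR hΨ p hL
        (M := (mQ Ψ (box p L)).toReal + 1) (by positivity) ?_ (hE _ (measurableSet_box _ _)))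
      conv_lhs => rw [← ENNReal.ofReal_toReal (hm _ (measurableSet_box p L))]
      exact ENNReal.ofReal_le_ofReal (by linarith)
    have e1 : (PQ Ψ (box p L)).toReal = ∑ b, (PQ Ψ (box (ch p L b) (L / 2))).toReal := by
      rw [← ENNReal.toReal_sum fun b _ => hPf _ _ (by linarith)]
      unfold PQ
      rw [lint_box_split ((measurable_rhoE hΨ).pow_const 2) hL]
    have e2 : (mQ Ψ (box p L)).toReal = ∑ b, (mQ Ψ (box (ch p L b) (L / 2))).toReal := by
      rw [← ENNReal.toReal_sum fun b _ => hm _ (measurableSet_box _ _)]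
      unfold mQ
      rw [lint_box_split (measurable_rhoE hΨ) hL]
    have e3 : (EQ R α Ψ (box p L)).toReal = ∑ b, (EQ R α Ψ (box (ch p L b) (L / 2))).toReal := by
      rw [← ENNReal.toReal_sum fun b _ => hE _ (measurableSet_box _ _), EQ_split hR hΨ hL]
    have hs := Finset.sum_le_sum fun b (_ : b ∈ Finset.univ) => hih b
    rw [← e1, Finset.sum_add_distrib, ← Finset.mul_sum, ← Finset.mul_sum, Finset.sum_sub_distrib,
      ← e2, ← e3] at hs
    refine hs.trans ?_
    have hc : ∑ _b : Fin 2 → Bool, (5 : ℝ) = 20 := by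
      rw [Finset.sum_const]; simp; norm_num
    rw [hc]
    have : 144 / (L / 2) ^ 2 * (20 - (mQ Ψ (box p L)).toReal) ≤
        144 / L ^ 2 * (5 - (mQ Ψ (box p L)).toReal) := by
      have : 144 / (L / 2) ^ 2 = 144 / L ^ 2 * 4 := by field_simp; norm_num
      rw [this, mul_assoc]
      refine mul_le_mul_of_nonneg_left ?_ (by positivity)
      linarith
    linarith

end


section
variable {N : ℕ} {R α : ℝ} {Ψ : (Fin N → E2) → ℂ}

theorem exists_radius (hc : HasCompactSupport Ψ) : ∃ r : ℝ, 0 < r ∧ ∀ X, r < ‖X‖ → Ψ X = 0 := by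
  obtain ⟨r, hr⟩ := hc.isCompact.isBounded.exists_norm_le
  refine ⟨max r 1, by positivity, fun X hX => ?_⟩
  by_contra h
  have := hr X (subset_tsupport _ h)
  exact absurd (lt_of_le_of_lt (le_max_left r 1) hX) (not_lt.2 this)

theorem ins_norm_left (j : Fin N) (x : E2) (Y : {k : Fin N // k ≠ j} → E2) :
    ‖x‖ ≤ ‖ins j x Y‖ := by
  have := norm_le_pi_norm (ins j x Y) j
  rwa [ins_self] at this

theorem ins_norm_right (j : Fin N) (x : E2) (Y : {k : Fin N // k ≠ j} → E2) :
    ‖Y‖ ≤ ‖ins j x Y‖ := by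
  rw [pi_norm_le_iff_of_nonneg (norm_nonneg _)]
  intro k
  have := norm_le_pi_norm (ins j x Y) k
  simpa [ins, k.2] using this

theorem rho_zero {r : ℝ} (hr : ∀ X, r < ‖X‖ → Ψ X = 0) {x : E2} (hx : r < ‖x‖) :
    rhoE Ψ x = 0 := by
  unfold rhoE marg
  refine Finset.sum_eq_zero fun j _ => ?_
  rw [← lintegral_zero]
  refine lintegral_congr fun Y => ?_
  simp [fE, hr _ (hx.trans_le (ins_norm_left j x Y))]

theorem density_eq (hΨ : ContDiff ℝ 1 Ψ) {r : ℝ} (hr : ∀ X, r < ‖X‖ → Ψ X = 0) (x : E2) :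
    ENNReal.ofReal (density N Ψ x) = rhoE Ψ x := by
  unfold density rhoE marg fE
  rw [ENNReal.ofReal_sum_of_nonneg fun j _ => integral_nonneg fun Y => by positivity]
  refine Finset.sum_congr rfl fun j _ => ?_
  have hcont : Continuous fun Y => ‖Ψ (ins j x Y)‖ ^ 2 :=
    (hΨ.continuous.comp ((continuous_ins j).comp
      (by fun_prop : Continuous fun Y => (x, Y)))).norm.pow 2
  have hsup : HasCompactSupport fun Y => ‖Ψ (ins j x Y)‖ ^ 2 := by
    refine HasCompactSupport.intro (isCompact_closedBall 0 r) fun Y hY => ?_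
    rw [mem_closedBall_zero_iff, not_le] at hY
    simp [hr _ (hY.trans_le (ins_norm_right j x Y))]
  exact ofReal_integral_eq_lintegral_ofReal (hcont.integrable_of_hasCompactSupport hsup)
    (Filter.Eventually.of_forall fun Y => by positivity)

theorem density_nonneg (x : E2) : 0 ≤ density N Ψ x :=
  Finset.sum_nonneg fun j _ => integral_nonneg fun Y => by positivity

theorem rho_bdd (hΨ : ContDiff ℝ 1 Ψ) (hc : HasCompactSupport Ψ) :
    ∃ c : ENNReal, c ≠ ⊤ ∧ ∀ x, rhoE Ψ x ≤ c := by
  obtain ⟨r, hr0, hr⟩ := exists_radius hc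
  obtain ⟨C, hC⟩ := hΨ.continuous.bounded_above_of_compact_support hc
  refine ⟨∑ j : Fin N, ENNReal.ofReal (C ^ 2) *
    volume (Metric.closedBall (0 : {k : Fin N // k ≠ j} → E2) r), ?_, fun x => ?_⟩
  · refine ENNReal.sum_ne_top.2 fun j _ => ENNReal.mul_ne_top ENNReal.ofReal_ne_top ?_
    exact (isCompact_closedBall _ _).measure_lt_top.ne
  · unfold rhoE marg
    refine Finset.sum_le_sum fun j _ => ?_
    rw [← setLIntegral_const, ← lintegral_indicator Metric.isClosed_closedBall.measurableSet]
    refine lintegral_mono fun Y => ?_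
    by_cases hY : Y ∈ Metric.closedBall (0 : {k : Fin N // k ≠ j} → E2) r
    · rw [Set.indicator_of_mem hY]
      exact ENNReal.ofReal_le_ofReal (pow_le_pow_left₀ (norm_nonneg _) (hC _) 2)
    · rw [Set.indicator_of_notMem hY]
      rw [mem_closedBall_zero_iff, not_le] at hY
      simp [fE, hr _ (hY.trans_le (ins_norm_right j x Y))]

theorem volume_box (p : E2) {L : ℝ} (hL : 0 < L) : volume (box p L) = ENNReal.ofReal (L ^ 2) := by
  have := setLIntegral_box (F := fun _ => 1) measurable_const p L
  rw [setLIntegral_one] at this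
  rw [this]
  simp only [lintegral_const, Real.volume_Ico, Measure.restrict_apply_univ]
  rw [add_sub_cancel_left, add_sub_cancel_left, one_mul, ← ENNReal.ofReal_mul hL.le, sq]

theorem fE_int (hΨ : ContDiff ℝ 1 Ψ) (hc : HasCompactSupport Ψ)
    (h1 : (∫ X : Fin N → E2, ‖Ψ X‖ ^ 2) = 1) : ∫⁻ X, fE Ψ X = 1 := by
  unfold fE
  have hcont : Continuous fun X => ‖Ψ X‖ ^ 2 := hΨ.continuous.norm.pow 2
  have hsup : HasCompactSupport fun X => ‖Ψ X‖ ^ 2 :=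
    hc.comp_left (g := fun z : ℂ => ‖z‖ ^ 2) (by simp)
  rw [← ofReal_integral_eq_lintegral_ofReal (hcont.integrable_of_hasCompactSupport hsup)
    (Filter.Eventually.of_forall fun Y => by positivity), h1, ENNReal.ofReal_one]

theorem eE_int (hR : 0 < R) (hΨ : ContDiff ℝ 1 Ψ) (hc : HasCompactSupport Ψ) :
    ∑ j, ∫⁻ X, eE R α Ψ j X = ENNReal.ofReal (kinE R α N Ψ) := by
  unfold kinE eE
  rw [ENNReal.ofReal_sum_of_nonneg fun j _ => integral_nonneg fun Y =>
    Finset.sum_nonneg fun _ _ => by positivity]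
  refine Finset.sum_congr rfl fun j _ => ?_
  have hsup : HasCompactSupport fun X => ∑ c, ‖covD R α Ψ j X c‖ ^ 2 := by
    refine HasCompactSupport.intro hc.isCompact fun X hX => ?_
    have e1 : Ψ X = 0 := image_eq_zero_of_notMem_tsupport hX
    have e2 : fderiv ℝ Ψ X = 0 := by
      by_contra h
      exact hX (support_fderiv_subset ℝ h)
    simp [covD, e1, e2]
  exact (ofReal_integral_eq_lintegral_ofReal
    ((continuous_e hR hΨ j).integrable_of_hasCompactSupport hsup)
    (Filter.Eventually.of_forall fun Y => Finset.sum_nonneg fun _ _ => by positivity)).symm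

theorem EQ_le (hR : 0 < R) (hΨ : ContDiff ℝ 1 Ψ) (hc : HasCompactSupport Ψ) (Q : Set E2) :
    EQ R α Ψ Q ≤ ENNReal.ofReal (kinE R α N Ψ) := by
  rw [← eE_int hR hΨ hc, ← lintegral_finsetSum _ fun j _ => measurable_eE hR hΨ j]
  unfold EQ eQ
  refine lintegral_mono fun X => Finset.sum_le_sum fun j _ => Set.indicator_le_self _ _ _

theorem mQ_fin (hΨ : ContDiff ℝ 1 Ψ) (h1 : ∫⁻ X, fE Ψ X = 1) {Q : Set E2}
    (hQ : MeasurableSet Q) : mQ Ψ Q ≠ ⊤ := by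
  rw [mQ_eq hΨ hQ]
  have : ∫⁻ X, ((pat Q X).card : ENNReal) * fE Ψ X ≤ (N : ENNReal) * 1 := by
    rw [← h1, ← lintegral_const_mul _ (measurable_fE hΨ)]
    refine lintegral_mono fun X => mul_le_mul_left ?_ _
    have : (pat Q X).card ≤ N := by simpa using Finset.card_le_univ (pat Q X)
    exact Nat.cast_le.2 this
  exact ne_top_of_le_ne_top (by simp) this

theorem kinE_nonneg : 0 ≤ kinE R α N Ψ :=
  Finset.sum_nonneg fun j _ => integral_nonneg fun Y => Finset.sum_nonneg fun _ _ => by positivity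

theorem final (hR : 0 < R) (h0 : 0 ≤ α) (h2 : α ≤ 2) (h3 : α ≠ 1) (hΨ : ContDiff ℝ 1 Ψ)
    (hc : HasCompactSupport Ψ) (hA : Antisym N Ψ) (hn : (∫ X : Fin N → E2, ‖Ψ X‖ ^ 2) = 1) :
    ∫ x, density N Ψ x ^ 2 ≤ (225 + 2835 * KBr) / |α - 1| * kinE R α N Ψ := by
  have h1 := fE_int hΨ hc hn
  obtain ⟨r, hr0, hr⟩ := exists_radius hc
  obtain ⟨c, hcf, hcb⟩ := rho_bdd hΨ hc
  have hm : ∀ Q, MeasurableSet Q → mQ Ψ Q ≠ ⊤ := fun Q hQ => mQ_fin hΨ h1 hQ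
  have hE : ∀ Q, MeasurableSet Q → EQ R α Ψ Q ≠ ⊤ := fun Q _ =>
    ne_top_of_le_ne_top ENNReal.ofReal_ne_top (EQ_le hR hΨ hc Q)
  have hK0 : 0 < KBr := by unfold KBr; norm_num
  have hν : 0 < |α - 1| := abs_pos.2 (sub_ne_zero.2 h3)
  have hm2 : ∀ p L, 0 < L → (mQ Ψ (box p L)).toReal ≤ c.toReal * L ^ 2 := by
    intro p L hL
    refine ENNReal.toReal_le_of_le_ofReal (by positivity) ?_
    rw [ENNReal.ofReal_mul ENNReal.toReal_nonneg, ENNReal.ofReal_toReal hcf, ← volume_box p hL,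
      ← setLIntegral_const]
    exact lintegral_mono fun x => hcb x
  have hδ0 : 0 < 1 / (c.toReal + 1) := by positivity
  have hδ : ∀ p L, 0 < L → L ≤ 1 / (c.toReal + 1) → (mQ Ψ (box p L)).toReal ≤ 25 := by
    intro p L hL hLd
    refine (hm2 p L hL).trans ?_
    have hc0 : 0 ≤ c.toReal := ENNReal.toReal_nonneg
    rw [le_div_iff₀ (by positivity)] at hLd
    have : c.toReal * L ≤ 1 := by nlinarith
    have h' : L ≤ 1 := by nlinarith
    nlinarith
  have main : ∀ L, 4 * r ≤ L → PQ Ψ (box !₂[-(L / 2), -(L / 2)] L) = ∫⁻ x, rhoE Ψ x ^ 2 := by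
    intro L hL
    unfold PQ
    rw [← lintegral_indicator (measurableSet_box _ _)]
    refine lintegral_congr fun x => ?_
    by_cases hx : x ∈ box !₂[-(L / 2), -(L / 2)] L
    · rw [Set.indicator_of_mem hx]
    · rw [Set.indicator_of_notMem hx, rho_zero hr, zero_pow two_ne_zero]
      by_contra hxr
      push Not at hxr
      apply hx
      intro i
      have hi : |x i| ≤ r := (PiLp.norm_apply_le x i).trans hxr
      have hi2 := abs_le.1 hi
      have hp : (!₂[-(L / 2), -(L / 2)] : E2) i = -(L / 2) := by fin_cases i <;> rfl
      rw [hp]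
      constructor <;> linarith [hi2.1, hi2.2]
  have hdm : ∀ x, density N Ψ x = (rhoE Ψ x).toReal := fun x => by
    rw [← density_eq hΨ hr x, ENNReal.toReal_ofReal (density_nonneg x)]
  have hIntg : ∫ x, density N Ψ x ^ 2 = (∫⁻ x, rhoE Ψ x ^ 2).toReal := by
    rw [integral_eq_lintegral_of_nonneg_ae (Filter.Eventually.of_forall fun x => by positivity)]
    · congr 1
      refine lintegral_congr fun x => ?_
      rw [ENNReal.ofReal_pow (density_nonneg x), density_eq hΨ hr]
    · simp_rw [hdm]
      exact ((measurable_rhoE hΨ).ennreal_toReal.pow_const 2).aestronglyMeasurable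
  rw [hIntg]
  refine le_of_forall_pos_le_add fun ε hε => ?_
  set L := max (4 * r) (max 1 (720 / ε)) with hLd
  have hL4 : 4 * r ≤ L := le_max_left _ _
  have hL1 : 1 ≤ L := (le_max_left _ _).trans (le_max_right _ _)
  have hLε : 720 / ε ≤ L := (le_max_right _ _).trans (le_max_right _ _)
  obtain ⟨d, hd⟩ := pow_unbounded_of_one_lt (L / (1 / (c.toReal + 1))) (one_lt_two : (1 : ℝ) < 2)
  rw [div_lt_iff₀ hδ0] at hd
  have h := rec2 (α := α) hR h0 h2 h3 hΨ hA h1 hm hE hδ d !₂[-(L / 2), -(L / 2)] L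
    (by linarith) hd.le
  rw [main L hL4] at h
  refine h.trans (add_le_add ?_ ?_)
  · exact mul_le_mul_of_nonneg_left
      (ENNReal.toReal_le_of_le_ofReal kinE_nonneg (EQ_le hR hΨ hc _)) (by positivity)
  · have hm0 : 0 ≤ (mQ Ψ (box !₂[-(L / 2), -(L / 2)] L)).toReal := ENNReal.toReal_nonneg
    calc _ ≤ 144 / L ^ 2 * 5 := mul_le_mul_of_nonneg_left (by linarith) (by positivity)
      _ = 720 / L ^ 2 := by ring
      _ ≤ ε := by
        rw [div_le_iff₀ hε] at hLε
        rw [div_le_iff₀ (by positivity)]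
        nlinarith
end

/-- **Lieb–Thirring inequality for extended anyons.** -/
theorem lieb_thirring_extended_anyons :
    ∃ C : ℝ, 0 < C ∧
      ∀ (R α : ℝ), 0 < R → α ∈ Set.Icc (0 : ℝ) 2 →
        ∀ N : ℕ, 1 ≤ N →
          ∀ Ψ : (Fin N → E2) → ℂ,
            ContDiff ℝ (⊤ : ℕ∞) Ψ → HasCompactSupport Ψ → Antisym N Ψ →
            (∫ X : Fin N → E2, ‖Ψ X‖ ^ 2) = 1 →
            C * |α - 1| * ∫ x : E2, density N Ψ x ^ 2 ≤ kinE R α N Ψ := by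
  have hK0 : 0 < KBr := by unfold KBr; norm_num
  have hA0 : 0 < 225 + 2835 * KBr := by positivity
  refine ⟨1 / (225 + 2835 * KBr), by positivity, ?_⟩
  intro R α hR hα N _ Ψ hΨ hc hA hn
  by_cases h3 : α = 1
  · rw [h3, sub_self, abs_zero, mul_zero, zero_mul]
    exact kinE_nonneg
  have hν : 0 < |α - 1| := abs_pos.2 (sub_ne_zero.2 h3)
  have hΨ1 : ContDiff ℝ 1 Ψ := hΨ.of_le (by exact_mod_cast le_top)
  have h := final hR hα.1 hα.2 h3 hΨ1 hc hA hn
  calc _ ≤ 1 / (225 + 2835 * KBr) * |α - 1| *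
        ((225 + 2835 * KBr) / |α - 1| * kinE R α N Ψ) :=
        mul_le_mul_of_nonneg_left h (by positivity)
    _ = _ := by field_simp
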